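/- arXiv:2004.05596 — 6 statements merged into one kernel-verified Lean document; each statement's English description precedes it below -/
import Mathlib

section
/- (Fatou, 1906) Let f(t) = ∑_{n≥0} a_n t^n be a formal power series whose coefficients a_n are nonnegative integers and are polynomially bounded, i.e., there exist constants b, c > 0 such that a_n ≤ b·n^c for all n ≥ 1. If f is algebraic over ℚ(t), then f is rational. -/
/-- A formal power series with rational coefficients is algebraic over `ℚ(t)` if it is a root of
a nonzero polynomial `P(t,z) ∈ ℚ[t][z]`. -/
def PSAlgebraic (f : PowerSeries ℚ) : Prop :=
  ∃ P : Polynomial (Polynomial ℚ), P ≠ 0 ∧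
    Polynomial.eval₂ Polynomial.coeToPowerSeries.ringHom f P = 0

/-- A formal power series is rational if `q(t)·f(t) = p(t)` for polynomials `p, q` with `q ≠ 0`. -/
def PSRational (f : PowerSeries ℚ) : Prop :=
  ∃ p q : Polynomial ℚ, q ≠ 0 ∧ (q : PowerSeries ℚ) * f = (p : PowerSeries ℚ)

open Polynomial in
/-- The roots of a monic polynomial over `ℂ[t]` are uniformly bounded for `t` in the closed unit
disc. -/
theorem exists_norm_root_le_of_monic {Q : ℂ[X][X]} (hQ : Q.Monic) :
    ∃ M : ℝ, ∀ z w : ℂ, ‖z‖ ≤ 1 → eval₂ (evalRingHom z) w Q = 0 → ‖w‖ ≤ M := by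
  have hcoeff : ∀ q : ℂ[X], ∃ B : NNReal, ∀ z : ℂ, ‖z‖ ≤ 1 → ‖q.eval z‖₊ ≤ B := by
    intro q
    obtain ⟨B, hB⟩ := (isCompact_closedBall (0 : ℂ) 1).exists_bound_of_continuousOn
      q.continuous.continuousOn
    refine ⟨B.toNNReal, fun z hz => ?_⟩
    exact NNReal.coe_le_coe.mp ((hB z (by simpa using hz)).trans (Real.le_coe_toNNReal B))
  choose B hB using hcoeff
  refine ⟨((Finset.range Q.natDegree).sup (fun i => B (Q.coeff i)) + 1 : NNReal),
    fun z w hz hw => ?_⟩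
  have hmonic := hQ.map (evalRingHom z)
  have hroot : (Q.map (evalRingHom z)).IsRoot w := by rwa [IsRoot.def, eval_map]
  refine NNReal.coe_le_coe.mpr ((hroot.norm_lt_cauchyBound hmonic.ne_zero).le.trans ?_)
  rw [cauchyBound, hmonic.leadingCoeff, hQ.natDegree_map, nnnorm_one, div_one]
  gcongr with i
  rw [coeff_map]
  exact hB _ z hz

/-- Bessel's inequality for the coefficients of an absolutely convergent power series that is
bounded on the unit circle. -/
theorem sum_sq_norm_le_of_norm_tsum_le {c : ℕ → ℂ} (hc : Summable fun n => ‖c n‖) {M : ℝ}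
    (hM : ∀ z : ℂ, ‖z‖ = 1 → ‖∑' n, c n * z ^ n‖ ≤ M) (s : Finset ℕ) :
    ∑ n ∈ s, ‖c n‖ ^ 2 ≤ M ^ 2 := by
  have hM0 : 0 ≤ M := (norm_nonneg _).trans (hM 1 (by simp))
  let F : ℕ → C(AddCircle (1 : ℝ), ℂ) := fun n => c n • fourier (n : ℤ)
  have hF : Summable F := by
    refine Summable.of_norm ?_
    simpa only [F, norm_smul, fourier_norm, mul_one] using hc
  let G := ∑' n, F n
  let L : C(AddCircle (1 : ℝ), ℂ) →L[ℂ] MeasureTheory.Lp ℂ 2 (@AddCircle.haarAddCircle 1 _) :=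
    ContinuousMap.toLp 2 AddCircle.haarAddCircle ℂ
  have hG : ‖G‖ ≤ M := by
    refine (ContinuousMap.norm_le _ hM0).mpr fun x => ?_
    have hx : G x = ∑' n, c n * (AddCircle.toCircle x : ℂ) ^ n := by
      rw [← ContinuousMap.tsum_apply hF x]
      refine tsum_congr fun n => ?_
      simp [F, fourier_apply, AddCircle.toCircle_nsmul]
    rw [hx]
    exact hM _ (Circle.norm_coe _)
  have hLG : ‖L G‖ ≤ M := by
    refine (L.le_opNorm G).trans ?_
    have h1 : ‖L‖ ≤ 1 := by
      refine (ContinuousMap.toLp_norm_le (AddCircle.haarAddCircle (T := (1 : ℝ)))).trans ?_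
      simp [MeasureTheory.measureUnivNNReal]
    exact (mul_le_mul h1 hG (norm_nonneg _) zero_le_one).trans (one_mul M).le
  have hinner : ∀ n : ℕ, inner ℂ (fourierLp (T := (1 : ℝ)) 2 (n : ℤ)) (L G) = c n := by
    intro n
    have h := ((innerSL ℂ (fourierLp (T := (1 : ℝ)) 2 (n : ℤ))).comp L).hasSum hF.hasSum
    refine h.unique ?_
    refine (hasSum_ite_eq n (c n)).congr_fun fun m => ?_
    have := orthonormal_iff_ite.mp (orthonormal_fourier (T := (1 : ℝ))) (n : ℤ) (m : ℤ)
    simp only [ContinuousLinearMap.comp_apply, F, map_smul, innerSL_apply_apply, smul_eq_mul]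
    change c m * inner ℂ (fourierLp (T := (1 : ℝ)) 2 (n : ℤ)) (fourierLp 2 (m : ℤ)) = _
    rw [this]
    by_cases hmn : m = n <;> simp [hmn, eq_comm (a := n)]
  have hbessel := ((orthonormal_fourier (T := (1 : ℝ))).comp (fun n : ℕ => (n : ℤ))
    Nat.cast_injective).sum_inner_products_le (s := s) (L G)
  simp only [Function.comp_apply, hinner] at hbessel
  exact hbessel.trans (by gcongr)

/-- A power series with integer coefficients that converges absolutely in the open unit disc and is
bounded there is a polynomial. -/
theorem exists_eq_coe_of_norm_tsum_le {g : PowerSeries ℤ} {M : ℝ}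
    (hsum : ∀ z : ℂ, ‖z‖ < 1 → Summable fun n => ‖((PowerSeries.coeff n g : ℤ) : ℂ) * z ^ n‖)
    (hM : ∀ z : ℂ, ‖z‖ < 1 → ‖∑' n, ((PowerSeries.coeff n g : ℤ) : ℂ) * z ^ n‖ ≤ M) :
    ∃ p : Polynomial ℤ, (p : PowerSeries ℤ) = g := by
  have hr : ∀ s : Finset ℕ, ∀ r ∈ Set.Ico (0 : ℝ) 1,
      ∑ n ∈ s, (‖((PowerSeries.coeff n g : ℤ) : ℂ)‖ * r ^ n) ^ 2 ≤ M ^ 2 := by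
    rintro s r ⟨hr0, hr1⟩
    have hnorm : ‖(r : ℂ)‖ = r := by simp [abs_of_nonneg hr0]
    have h := sum_sq_norm_le_of_norm_tsum_le (hsum (r : ℂ) (by rwa [hnorm])) (M := M)
      (fun z hz => by
        simpa only [mul_assoc, ← mul_pow] using hM (r * z) (by rwa [norm_mul, hnorm, hz, mul_one])) s
    simpa only [norm_mul, norm_pow, hnorm] using h
  have hone : ∀ s : Finset ℕ, ∑ n ∈ s, ‖((PowerSeries.coeff n g : ℤ) : ℂ)‖ ^ 2 ≤ M ^ 2 := by
    intro s
    have hcont : Continuous fun r : ℝ =>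
        ∑ n ∈ s, (‖((PowerSeries.coeff n g : ℤ) : ℂ)‖ * r ^ n) ^ 2 := by fun_prop
    have h := (hcont.tendsto 1).mono_left (nhdsWithin_le_nhds (s := Set.Iio 1))
    simp only [one_pow, mul_one] at h
    exact le_of_tendsto h (Filter.mem_of_superset (Ico_mem_nhdsLT zero_lt_one) (hr s))
  have hcard : ∀ s : Finset ℕ, (∀ n ∈ s, PowerSeries.coeff n g ≠ 0) → s.card ≤ ⌊M ^ 2⌋₊ := by
    intro s hs
    refine Nat.le_floor (le_trans ?_ (hone s))
    rw [← nsmul_one]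
    refine Finset.card_nsmul_le_sum s _ _ fun n hn => ?_
    rw [Complex.norm_intCast]
    have : (1 : ℝ) ≤ |((PowerSeries.coeff n g : ℤ) : ℝ)| := by
      exact_mod_cast Int.one_le_abs (hs n hn)
    exact one_le_pow₀ this
  have hfin : {n | PowerSeries.coeff n g ≠ 0}.Finite := by
    by_contra hinf
    obtain ⟨s, hs, hs'⟩ := Set.Infinite.exists_subset_card_eq hinf (⌊M ^ 2⌋₊ + 1)
    have := hcard s fun n hn => hs hn
    omega
  obtain ⟨N, hN⟩ := hfin.bddAbove
  refine ⟨PowerSeries.trunc (N + 1) g, PowerSeries.ext fun n => ?_⟩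
  rw [Polynomial.coeff_coe, PowerSeries.coeff_trunc]
  split_ifs with h
  · rfl
  · by_contra h'
    exact h (Nat.lt_succ_of_le (hN (Ne.symm h')))

namespace PowerSeries

/-- The ring of complex power series that converge absolutely at `z`. -/
def absConvergentAt (z : ℂ) : Subring (PowerSeries ℂ) where
  carrier := {f | Summable fun n => ‖coeff n f * z ^ n‖}
  zero_mem' := by simp [summable_zero]
  one_mem' := summable_of_ne_finset_zero (s := {0}) fun n hn => by
    simp_all [coeff_one]
  add_mem' {f g} hf hg := by
    refine (Summable.add hf hg).of_nonneg_of_le (fun _ => norm_nonneg _) fun n => ?_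
    rw [map_add, add_mul]
    exact norm_add_le _ _
  neg_mem' {f} hf := by simpa using hf
  mul_mem' {f g} hf hg := by
    refine (summable_norm_sum_mul_antidiagonal_of_summable_norm hf hg).congr fun n => ?_
    rw [coeff_mul, Finset.sum_mul]
    refine congrArg _ (Finset.sum_congr rfl fun ij hij => ?_)
    rw [← Finset.HasAntidiagonal.mem_antidiagonal.mp hij]
    ring

/-- Evaluation at `z` of the power series that converge absolutely there. -/
noncomputable def evalAbsConvergentAt (z : ℂ) : absConvergentAt z →+* ℂ where
  toFun f := ∑' n, coeff n (f : PowerSeries ℂ) * z ^ n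
  map_zero' := by simp
  map_one' := by
    rw [tsum_eq_single 0 fun n hn => by simp [coeff_one, hn]]
    simp
  map_add' f g := by
    rw [← Summable.tsum_add f.2.of_norm g.2.of_norm]
    exact tsum_congr fun n => by simp [add_mul]
  map_mul' f g := by
    rw [tsum_mul_tsum_eq_tsum_sum_antidiagonal_of_summable_norm f.2 g.2]
    refine tsum_congr fun n => ?_
    rw [Subring.coe_mul, coeff_mul, Finset.sum_mul]
    refine Finset.sum_congr rfl fun ij hij => ?_
    rw [← Finset.HasAntidiagonal.mem_antidiagonal.mp hij]
    ring

theorem coe_mem_absConvergentAt (z : ℂ) (p : Polynomial ℂ) :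
    (p : PowerSeries ℂ) ∈ absConvergentAt z :=
  summable_of_ne_finset_zero (s := p.support) fun n hn => by
    simp [Polynomial.notMem_support_iff.mp hn]

/-- The polynomials as power series converging absolutely at `z`. -/
noncomputable def polynomialToAbsConvergentAt (z : ℂ) : Polynomial ℂ →+* absConvergentAt z :=
  Polynomial.coeToPowerSeries.ringHom.codRestrict (absConvergentAt z) (coe_mem_absConvergentAt z)

theorem evalAbsConvergentAt_comp_polynomialToAbsConvergentAt (z : ℂ) :
    (evalAbsConvergentAt z).comp (polynomialToAbsConvergentAt z) = Polynomial.evalRingHom z := by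
  refine RingHom.ext fun p => ?_
  change ∑' n, coeff n (p : PowerSeries ℂ) * z ^ n = p.eval z
  rw [Polynomial.eval_eq_sum, Polynomial.sum_def, tsum_eq_sum (s := p.support)]
  · simp
  · intro n hn
    simp [Polynomial.notMem_support_iff.mp hn]

/-- A polynomial relation satisfied by a power series holds pointwise where it converges. -/
theorem eval₂_tsum_eq_zero {Q : Polynomial (Polynomial ℂ)} {g : PowerSeries ℂ}
    (hQ : Polynomial.eval₂ Polynomial.coeToPowerSeries.ringHom g Q = 0) {z : ℂ}
    (hg : g ∈ absConvergentAt z) :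
    Polynomial.eval₂ (Polynomial.evalRingHom z) (∑' n, coeff n g * z ^ n) Q = 0 := by
  have h : Polynomial.eval₂ (polynomialToAbsConvergentAt z) ⟨g, hg⟩ Q = 0 := by
    apply Subtype.val_injective
    change (absConvergentAt z).subtype _ = 0
    rw [Polynomial.hom_eval₂]
    exact hQ
  have h' := congrArg (evalAbsConvergentAt z) h
  rwa [Polynomial.hom_eval₂, evalAbsConvergentAt_comp_polynomialToAbsConvergentAt, map_zero] at h'

theorem mem_absConvergentAt_of_norm_coeff_le {f : PowerSeries ℂ} {b c : ℝ} (hb : 0 ≤ b)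
    (hbound : ∀ n : ℕ, 1 ≤ n → ‖coeff n f‖ ≤ b * (n : ℝ) ^ c) {z : ℂ} (hz : ‖z‖ < 1) :
    f ∈ absConvergentAt z := by
  have h := (summable_pow_mul_geometric_of_norm_lt_one (R := ℝ) ⌈c⌉₊
    (r := ‖z‖) (by simpa using hz)).mul_left b
  refine h.of_norm_bounded_eventually_nat ?_
  filter_upwards [Filter.eventually_ge_atTop 1] with n hn
  rw [norm_norm, norm_mul, norm_pow, ← mul_assoc]
  gcongr
  refine (hbound n hn).trans ?_
  rw [← Real.rpow_natCast]
  gcongr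
  · exact_mod_cast hn
  · exact Nat.le_ceil c

end PowerSeries

/-- **Fatou (1906).** If the coefficients of a power series are nonnegative integers which are
polynomially bounded, then the series is either rational or transcendental: if it is algebraic
over `ℚ(t)`, then it is rational. -/
theorem fatou_algebraic_implies_rational (a : ℕ → ℕ) (b c : ℝ) (hb : 0 < b) (hc : 0 < c)
    (hbound : ∀ n : ℕ, 1 ≤ n → (a n : ℝ) ≤ b * (n : ℝ) ^ c)
    (halg : PSAlgebraic (PowerSeries.mk fun n => (a n : ℚ))) :
    PSRational (PowerSeries.mk fun n => (a n : ℚ)) := by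
  obtain ⟨P, hP0, hP⟩ := halg
  obtain ⟨d, hd, hdP⟩ :=
    IsLocalization.integerNormalization_spec (nonZeroDivisors ℤ) P.leadingCoeff
  set q := IsLocalization.integerNormalization (nonZeroDivisors ℤ) P.leadingCoeff
  have hd0 : d ≠ 0 := nonZeroDivisors.ne_zero hd
  -- Rescale so that the leading coefficient has integer coefficients.
  set R : Polynomial (Polynomial ℚ) := d • P with hR
  have hR0 : R ≠ 0 := smul_ne_zero hd0 hP0
  have hRlead : R.leadingCoeff = q.map (Int.castRingHom ℚ) := by
    rw [hR, zsmul_eq_mul, Polynomial.leadingCoeff_mul, ← Polynomial.C_eq_intCast,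
      Polynomial.leadingCoeff_C, ← zsmul_eq_mul]
    exact hdP.symm
  have hReval : Polynomial.eval₂ Polynomial.coeToPowerSeries.ringHom
      (PowerSeries.mk fun n => (a n : ℚ)) R = 0 := by
    rw [hR, zsmul_eq_mul, Polynomial.eval₂_mul, hP, mul_zero]
  have hQ := Polynomial.integralNormalization_eval₂_eq_zero _ hReval
    (fun p hp => Polynomial.coe_injective ℚ (by simpa using hp))
  have hQmonic := Polynomial.monic_integralNormalization hR0
  set Q := R.integralNormalization
  let f : PowerSeries ℤ := PowerSeries.mk fun n => (a n : ℤ)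
  let g : PowerSeries ℤ := (q : PowerSeries ℤ) * f
  have hf : PowerSeries.map (Int.castRingHom ℚ) f = PowerSeries.mk fun n => (a n : ℚ) := by
    ext n; simp [f]
  have hg : Polynomial.coeToPowerSeries.ringHom R.leadingCoeff *
      (PowerSeries.mk fun n => (a n : ℚ)) = PowerSeries.map (Int.castRingHom ℚ) g := by
    rw [hRlead, map_mul, hf, Polynomial.coeToPowerSeries.ringHom_apply, Polynomial.polynomial_map_coe]
  rw [hg] at hQ
  have hQc : Polynomial.eval₂ Polynomial.coeToPowerSeries.ringHom
      (PowerSeries.map (Int.castRingHom ℂ) g)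
      (Q.map (Polynomial.mapRingHom (algebraMap ℚ ℂ))) = 0 := by
    have h := congrArg (PowerSeries.map (algebraMap ℚ ℂ)) hQ
    rw [Polynomial.hom_eval₂, map_zero] at h
    rw [Polynomial.eval₂_map]
    convert h using 2
    · ext <;> simp
    · ext; simp
  have hfmem : ∀ z : ℂ, ‖z‖ < 1 →
      PowerSeries.map (Int.castRingHom ℂ) f ∈ PowerSeries.absConvergentAt z := fun z hz =>
    PowerSeries.mem_absConvergentAt_of_norm_coeff_le hb.le
      (fun n hn => by simpa [f] using hbound n hn) hz
  have hgmem : ∀ z : ℂ, ‖z‖ < 1 →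
      PowerSeries.map (Int.castRingHom ℂ) g ∈ PowerSeries.absConvergentAt z := by
    intro z hz
    rw [map_mul, ← Polynomial.polynomial_map_coe]
    exact mul_mem (PowerSeries.coe_mem_absConvergentAt z _) (hfmem z hz)
  obtain ⟨M, hM⟩ := exists_norm_root_le_of_monic
    (hQmonic.map (Polynomial.mapRingHom (algebraMap ℚ ℂ)))
  obtain ⟨p, hp⟩ := exists_eq_coe_of_norm_tsum_le (g := g) (M := M)
    (fun z hz => by simpa [PowerSeries.absConvergentAt] using hgmem z hz)
    (fun z hz => by
      simpa using hM z _ hz.le (PowerSeries.eval₂_tsum_eq_zero hQc (hgmem z hz)))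
  refine ⟨p.map (Int.castRingHom ℚ), R.leadingCoeff, Polynomial.leadingCoeff_ne_zero.mpr hR0, ?_⟩
  rw [Polynomial.polynomial_map_coe, hp, ← hg, Polynomial.coeToPowerSeries.ringHom_apply]
end

section
/- The coefficients of an algebraic power series with nonnegative integer coefficients are either of polynomial or of exponential growth: if f(t) = ∑_{n≥0} a_n t^n with all a_n nonnegative integers is algebraic over ℚ(t), then either there exist b, c > 0 with a_n ≤ b·n^c for all n ≥ 1, or there exist b₂ > 0 and c₂ > 1 with a_n ≤ b₂·c₂^n for all n together with b₁ > 0 and c₁ > 1 such that a_n ≥ b₁·c₁^n for infinitely many n. -/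
namespace PSAlgebraic

open Polynomial

/-- Evaluation of a polynomial `R(t, z)` at `z = g` for a power series `g`. -/
noncomputable def evalAt (g : PowerSeries ℚ) : ℚ[X][X] →+* PowerSeries ℚ :=
  eval₂RingHom coeToPowerSeries.ringHom g

@[simp]
lemma evalAt_C (g : PowerSeries ℚ) (p : ℚ[X]) : evalAt g (C p) = (p : PowerSeries ℚ) := by
  simp [evalAt]

@[simp]
lemma evalAt_X (g : PowerSeries ℚ) : evalAt g X = g := by
  simp [evalAt]

/-- Induction on `ℚ[t][z]`, viewed as the ring generated by the constants, `t` and `z`. -/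
lemma bivariate_induction {motive : ℚ[X][X] → Prop}
    (const : ∀ q : ℚ, motive (C (C q))) (t : motive (C X)) (z : motive X)
    (add : ∀ R S, motive R → motive S → motive (R + S))
    (mul : ∀ R S, motive R → motive S → motive (R * S)) (R : ℚ[X][X]) : motive R := by
  have hC : ∀ p : ℚ[X], motive (C p) := by
    intro p
    induction p using Polynomial.induction_on' with
    | add p q hp hq => rw [C_add]; exact add _ _ hp hq
    | monomial n q =>
      induction n with
      | zero => simpa using const q
      | succ n ih =>
        have : (C (monomial (n + 1) q) : ℚ[X][X]) = C (monomial n q) * C X := by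
          rw [← C_mul, monomial_mul_X]
        rw [this]
        exact mul _ _ ih t
  induction R using Polynomial.induction_on' with
  | add R S hR hS => exact add _ _ hR hS
  | monomial n p =>
    induction n with
    | zero => simpa using hC p
    | succ n ih =>
      rw [← monomial_mul_X]
      exact mul _ _ ih z

/-! ### Truncated weighted norms -/

/-- The `ℓ¹` norm with weights `r ^ n` of the first `N` coefficients of a power series. -/
noncomputable def truncNorm (N : ℕ) (r : ℝ) (g : PowerSeries ℚ) : ℝ :=
  ∑ n ∈ Finset.range N, |((PowerSeries.coeff n g : ℚ) : ℝ)| * r ^ n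

lemma truncNorm_nonneg (N : ℕ) {r : ℝ} (hr : 0 ≤ r) (g : PowerSeries ℚ) :
    0 ≤ truncNorm N r g :=
  Finset.sum_nonneg fun _ _ => by positivity

lemma truncNorm_add_le (N : ℕ) {r : ℝ} (hr : 0 ≤ r) (g h : PowerSeries ℚ) :
    truncNorm N r (g + h) ≤ truncNorm N r g + truncNorm N r h := by
  unfold truncNorm
  rw [← Finset.sum_add_distrib]
  refine Finset.sum_le_sum fun n _ => ?_
  rw [← add_mul, map_add, Rat.cast_add]
  gcongr
  exact abs_add_le _ _

lemma truncNorm_mul_le (N : ℕ) {r : ℝ} (hr : 0 ≤ r) (g h : PowerSeries ℚ) :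
    truncNorm N r (g * h) ≤ truncNorm N r g * truncNorm N r h := by
  unfold truncNorm
  rw [Finset.sum_mul_sum, ← Finset.sum_product']
  calc ∑ n ∈ Finset.range N, |((PowerSeries.coeff n (g * h) : ℚ) : ℝ)| * r ^ n
      ≤ ∑ n ∈ Finset.range N, ∑ p ∈ Finset.HasAntidiagonal.antidiagonal n,
          (|((PowerSeries.coeff p.1 g : ℚ) : ℝ)| * r ^ p.1) *
            (|((PowerSeries.coeff p.2 h : ℚ) : ℝ)| * r ^ p.2) := by
        refine Finset.sum_le_sum fun n _ => ?_
        rw [PowerSeries.coeff_mul, Rat.cast_sum]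
        calc _ ≤ (∑ p ∈ Finset.HasAntidiagonal.antidiagonal n,
              |((PowerSeries.coeff p.1 g * PowerSeries.coeff p.2 h : ℚ) : ℝ)|) * r ^ n := by
              gcongr
              exact Finset.abs_sum_le_sum_abs _ _
          _ = _ := by
            rw [Finset.sum_mul]
            refine Finset.sum_congr rfl fun p hp => ?_
            rw [← Finset.HasAntidiagonal.mem_antidiagonal.mp hp, Rat.cast_mul, abs_mul, pow_add]
            ring
    _ = ∑ p ∈ (Finset.range N).biUnion Finset.HasAntidiagonal.antidiagonal,
          (|((PowerSeries.coeff p.1 g : ℚ) : ℝ)| * r ^ p.1) *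
            (|((PowerSeries.coeff p.2 h : ℚ) : ℝ)| * r ^ p.2) := by
        rw [Finset.sum_biUnion]
        intro i _ j _ hij
        refine Finset.disjoint_left.mpr fun p hi hj => hij ?_
        rw [← Finset.HasAntidiagonal.mem_antidiagonal.mp hi,
          Finset.HasAntidiagonal.mem_antidiagonal.mp hj]
    _ ≤ _ := by
        refine Finset.sum_le_sum_of_subset_of_nonneg ?_ fun p _ _ => by positivity
        intro p hp
        simp only [Finset.mem_biUnion, Finset.mem_range, Finset.HasAntidiagonal.mem_antidiagonal,
          Finset.mem_product] at hp ⊢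
        omega

lemma truncNorm_C_le (N : ℕ) (r : ℝ) (q : ℚ) :
    truncNorm N r (PowerSeries.C q) ≤ |(q : ℝ)| := by
  unfold truncNorm
  cases N with
  | zero => simp
  | succ N => simp [Finset.sum_range_succ', PowerSeries.coeff_C]

lemma truncNorm_succ_X_mul (N : ℕ) (r : ℝ) (g : PowerSeries ℚ) :
    truncNorm (N + 1) r (PowerSeries.X * g) = r * truncNorm N r g := by
  unfold truncNorm
  rw [Finset.sum_range_succ', Finset.mul_sum]
  simp only [PowerSeries.coeff_succ_X_mul, PowerSeries.coeff_zero_X_mul]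
  simp only [Rat.cast_zero, abs_zero, zero_mul, add_zero]
  exact Finset.sum_congr rfl fun n _ => by ring

lemma truncNorm_X_le (N : ℕ) {r : ℝ} (hr : 0 ≤ r) : truncNorm N r PowerSeries.X ≤ r := by
  cases N with
  | zero => simpa [truncNorm] using hr
  | succ N =>
    have h := truncNorm_C_le N r 1
    rw [← mul_one (PowerSeries.X : PowerSeries ℚ), truncNorm_succ_X_mul]
    simp only [map_one, Rat.cast_one, abs_one] at h
    nlinarith

lemma exists_truncNorm_evalAt_le (ε : ℝ) (R : ℚ[X][X]) :
    ∃ M : ℝ, 0 ≤ M ∧ ∀ (N : ℕ) (r : ℝ) (g : PowerSeries ℚ), 0 ≤ r → r ≤ 1 →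
      truncNorm N r g ≤ ε → truncNorm N r (evalAt g R) ≤ M := by
  induction R using bivariate_induction with
  | const q =>
    exact ⟨|(q : ℝ)|, abs_nonneg _, fun N r g hr _ _ => by simpa using truncNorm_C_le N r q⟩
  | t => exact ⟨1, zero_le_one, fun N r g hr hr1 _ => by
      simpa using (truncNorm_X_le N hr).trans hr1⟩
  | z => exact ⟨|ε|, abs_nonneg _, fun N r g _ _ h => by simpa using h.trans (le_abs_self ε)⟩
  | add R S hR hS =>
    obtain ⟨M, hM, h⟩ := hR
    obtain ⟨M', hM', h'⟩ := hS
    refine ⟨M + M', by positivity, fun N r g hr hr1 hg => ?_⟩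
    rw [map_add]
    exact (truncNorm_add_le N hr _ _).trans (add_le_add (h N r g hr hr1 hg) (h' N r g hr hr1 hg))
  | mul R S hR hS =>
    obtain ⟨M, hM, h⟩ := hR
    obtain ⟨M', hM', h'⟩ := hS
    refine ⟨M * M', by positivity, fun N r g hr hr1 hg => ?_⟩
    rw [map_mul]
    exact (truncNorm_mul_le N hr _ _).trans
      (mul_le_mul (h N r g hr hr1 hg) (h' N r g hr hr1 hg) (truncNorm_nonneg N hr _) hM)

/-! ### Algebraic power series have positive radius of convergence -/

/-- A solution of the fixed point equation `h = c + t R(t, h)` has bounded weighted norms. -/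
lemma exists_truncNorm_le_of_fixedPoint {h : PowerSeries ℚ} {c : ℚ} {R : ℚ[X][X]}
    (hh : h = PowerSeries.C c + PowerSeries.X * evalAt h R) :
    ∃ r ε : ℝ, 0 < r ∧ r ≤ 1 ∧ ∀ N, truncNorm N r h ≤ ε := by
  obtain ⟨M, hM, hR⟩ := exists_truncNorm_evalAt_le (|(c : ℝ)| + 1) R
  have hr : (0 : ℝ) < 1 / (M + 1) := by positivity
  have hr1 : 1 / (M + 1) ≤ 1 := by rw [div_le_one (by positivity)]; linarith
  refine ⟨1 / (M + 1), |(c : ℝ)| + 1, hr, hr1, fun N => ?_⟩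
  induction N with
  | zero => simp only [truncNorm, Finset.range_zero, Finset.sum_empty]; positivity
  | succ N ih =>
    rw [hh]
    refine (truncNorm_add_le _ hr.le _ _).trans (add_le_add (truncNorm_C_le _ _ c) ?_)
    rw [truncNorm_succ_X_mul, div_mul_eq_mul_div, div_le_one (by positivity), one_mul]
    linarith [hR N _ h hr.le hr1 ih]

/-- An algebraic power series is a root of a polynomial at which the derivative of that
polynomial does not vanish. -/
lemma exists_separable {f : PowerSeries ℚ} (hf : PSAlgebraic f) :
    ∃ P : ℚ[X][X], evalAt f P = 0 ∧ evalAt f (derivative P) ≠ 0 := by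
  obtain ⟨P, hP, hroot⟩ := hf
  replace hroot : evalAt f P = 0 := hroot
  induction hn : P.natDegree using Nat.strong_induction_on generalizing P with
  | _ n ih =>
    by_cases hd : evalAt f (derivative P) = 0
    · have hpos : P.natDegree ≠ 0 := by
        intro h0
        rw [eq_C_of_natDegree_eq_zero h0, evalAt_C] at hroot
        rw [Polynomial.coe_eq_zero_iff] at hroot
        exact hP (by rw [eq_C_of_natDegree_eq_zero h0, hroot, C_0])
      refine ih _ ?_ (derivative P) ?_ hd rfl
      · rw [← hn]; exact natDegree_derivative_lt hpos
      · intro h0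
        exact hpos (derivative_eq_zero.mp h0)
    · exact ⟨P, hroot, hd⟩

lemma exists_eq_X_pow_mul {g : PowerSeries ℚ} (hg : g ≠ 0) :
    ∃ (m : ℕ) (v : PowerSeries ℚ), g = PowerSeries.X ^ m * v ∧ PowerSeries.constantCoeff v ≠ 0 := by
  refine ⟨g.order.toNat, g.divXPowOrder, (PowerSeries.X_pow_order_mul_divXPowOrder).symm, ?_⟩
  rwa [Ne, PowerSeries.constantCoeff_divXPowOrder_eq_zero_iff]

lemma exists_coe_eq_of_coe_eq_X_pow_mul {p : ℚ[X]} {m : ℕ} {v : PowerSeries ℚ}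
    (h : (p : PowerSeries ℚ) = PowerSeries.X ^ m * v) : ∃ q : ℚ[X], v = q := by
  have hd : X ^ m ∣ p := by
    rw [X_pow_dvd_iff]
    intro d hd
    rw [← Polynomial.coeff_coe, h, PowerSeries.coeff_X_pow_mul', if_neg (by omega)]
  obtain ⟨q, rfl⟩ := hd
  refine ⟨q, ?_⟩
  rw [Polynomial.coe_mul, Polynomial.coe_pow, Polynomial.coe_X] at h
  exact (mul_left_cancel₀ (pow_ne_zero m PowerSeries.X_ne_zero) h).symm

/-- Every algebraic power series is a polynomial expression in a solution of a fixed point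
equation `h = c + t R(t, h)`. -/
lemma exists_fixedPoint {f : PowerSeries ℚ} (hf : PSAlgebraic f) :
    ∃ (h : PowerSeries ℚ) (c : ℚ) (R S : ℚ[X][X]),
      h = PowerSeries.C c + PowerSeries.X * evalAt h R ∧ f = evalAt h S := by
  obtain ⟨P, hP, hP'⟩ := exists_separable hf
  obtain ⟨m, s, hs, hs0⟩ := exists_eq_X_pow_mul hP'
  obtain ⟨h, hh⟩ : ∃ h, f = (f.trunc (m + 1) : PowerSeries ℚ) + PowerSeries.X ^ (m + 1) * h := by
    have : (PowerSeries.X : PowerSeries ℚ) ^ (m + 1) ∣ f - (f.trunc (m + 1) : PowerSeries ℚ) := by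
      rw [PowerSeries.X_pow_dvd_iff]
      intro d hd
      simp [PowerSeries.coeff_trunc, hd]
    obtain ⟨h, hh⟩ := this
    exact ⟨h, by rw [← hh]; ring⟩
  set u := f.trunc (m + 1) with hu
  have hS : f = evalAt h (C u + C (X ^ (m + 1)) * X) := by
    simp only [map_add, map_mul, evalAt_C, evalAt_X, Polynomial.coe_pow, Polynomial.coe_X]
    exact hh
  have hev : ∀ (g : PowerSeries ℚ) (Q S : ℚ[X][X]),
      evalAt g (eval S (Q.map C)) = evalAt (evalAt g S) Q := by
    intro g Q S
    rw [eval_map, evalAt, evalAt, coe_eval₂RingHom, coe_eval₂RingHom, ← coe_eval₂RingHom, hom_eval₂]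
    congr 1
    exact RingHom.ext fun p => evalAt_C g p
  have hCu : ∀ Q : ℚ[X][X], evalAt h (eval (C u) (Q.map C)) = (Q.eval u : ℚ[X]) := by
    intro Q
    rw [hev, evalAt_C, evalAt, coe_eval₂RingHom]
    exact (hom_eval₂ Q (RingHom.id _) coeToPowerSeries.ringHom u).symm
  obtain ⟨k, hk⟩ := binomExpansion (P.map C) (C u) (C (X ^ (m + 1)) * X)
  have htaylor := congrArg (evalAt h) hk
  rw [hev, ← hS, hP, map_add, map_add, map_mul, map_mul, derivative_map, hCu, hCu] at htaylor
  simp only [map_mul, map_pow, evalAt_C, evalAt_X, Polynomial.coe_X] at htaylor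
  obtain ⟨l, hl⟩ := evalSubFactor ((derivative P).map C) (C u + C (X ^ (m + 1)) * X) (C u)
  have hder := congrArg (evalAt h) hl
  rw [map_sub, hev, ← hS, hCu, hs] at hder
  simp only [add_sub_cancel_left, map_mul, map_pow, evalAt_C, evalAt_X,
    Polynomial.coe_X] at hder
  have hv : (((derivative P).eval u : ℚ[X]) : PowerSeries ℚ) =
      PowerSeries.X ^ m * (s - PowerSeries.X * (evalAt h l * h)) := by
    linear_combination -hder
  obtain ⟨v, hv'⟩ := exists_coe_eq_of_coe_eq_X_pow_mul hv
  rw [hv'] at hv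
  have hv0 : v.coeff 0 ≠ 0 := by
    have := congrArg PowerSeries.constantCoeff hv'
    simp at this
    rwa [← this]
  have hw : ((P.eval u : ℚ[X]) : PowerSeries ℚ) =
      PowerSeries.X ^ (2 * m + 1) * -((v : PowerSeries ℚ) * h
        + PowerSeries.X * (evalAt h k * h ^ 2)) := by
    rw [hv] at htaylor
    linear_combination -htaylor
  obtain ⟨w, hw'⟩ := exists_coe_eq_of_coe_eq_X_pow_mul hw
  have hsplit : ∀ p : ℚ[X], (p : PowerSeries ℚ) =
      PowerSeries.X * (p.divX : PowerSeries ℚ) + PowerSeries.C (p.coeff 0) := by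
    intro p
    conv_lhs => rw [← X_mul_divX_add p]
    rw [Polynomial.coe_add, Polynomial.coe_mul, Polynomial.coe_X, Polynomial.coe_C]
  rw [hsplit v, hsplit w] at hw'
  have hinv : PowerSeries.C (v.coeff 0)⁻¹ * PowerSeries.C (v.coeff 0) = (1 : PowerSeries ℚ) := by
    rw [← map_mul, inv_mul_cancel₀ hv0, map_one]
  refine ⟨h, -((v.coeff 0)⁻¹ * w.coeff 0),
    -(C (C (v.coeff 0)⁻¹) * (C w.divX + C v.divX * X + k * X ^ 2)), _, ?_, hS⟩
  simp only [map_neg, map_mul, map_add, map_pow, evalAt_C, evalAt_X, Polynomial.coe_C]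
  linear_combination (-PowerSeries.C (v.coeff 0)⁻¹) * hw' - h * hinv

/-- The coefficients of an algebraic power series grow at most exponentially. -/
lemma exists_abs_coeff_le {f : PowerSeries ℚ} (hf : PSAlgebraic f) :
    ∃ b c : ℝ, 0 < b ∧ 1 < c ∧ ∀ n, |((PowerSeries.coeff n f : ℚ) : ℝ)| ≤ b * c ^ n := by
  obtain ⟨h, c, R, S, hh, rfl⟩ := exists_fixedPoint hf
  obtain ⟨r, ε, hr, hr1, hN⟩ := exists_truncNorm_le_of_fixedPoint hh
  obtain ⟨M, hM, hS⟩ := exists_truncNorm_evalAt_le ε S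
  refine ⟨M + 1, r⁻¹ + 1, by positivity, by simpa using hr, fun n => ?_⟩
  have h1 := hS (n + 1) r h hr.le hr1 (hN _)
  have h2 : |((PowerSeries.coeff n (evalAt h S) : ℚ) : ℝ)| * r ^ n ≤ M :=
    (Finset.single_le_sum (f := fun n => |((PowerSeries.coeff n (evalAt h S) : ℚ) : ℝ)| * r ^ n)
      (fun _ _ => by positivity) (Finset.self_mem_range_succ n)).trans h1
  calc |((PowerSeries.coeff n (evalAt h S) : ℚ) : ℝ)|
      = |((PowerSeries.coeff n (evalAt h S) : ℚ) : ℝ)| * r ^ n * r⁻¹ ^ n := by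
        rw [mul_assoc, ← mul_pow, mul_inv_cancel₀ hr.ne', one_pow, mul_one]
    _ ≤ (M + 1) * (r⁻¹ + 1) ^ n := by
        gcongr <;> linarith

/-! ### Growth of algebraic functions at the boundary of the unit disc -/

/-- Evaluation of a rational polynomial at a real number. -/
noncomputable def realEval (x : ℝ) : ℚ[X] →+* ℝ :=
  eval₂RingHom (algebraMap ℚ ℝ) x

lemma continuous_realEval (p : ℚ[X]) : Continuous fun x => realEval x p :=
  p.continuous_eval₂ _

lemma hasSum_mul_of_summable_abs {x : ℝ} {g h : PowerSeries ℚ} {s t : ℝ}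
    (hg : Summable fun n => |((PowerSeries.coeff n g : ℚ) : ℝ) * x ^ n|)
    (hgs : HasSum (fun n => ((PowerSeries.coeff n g : ℚ) : ℝ) * x ^ n) s)
    (hh : Summable fun n => |((PowerSeries.coeff n h : ℚ) : ℝ) * x ^ n|)
    (hht : HasSum (fun n => ((PowerSeries.coeff n h : ℚ) : ℝ) * x ^ n) t) :
    (Summable fun n => |((PowerSeries.coeff n (g * h) : ℚ) : ℝ) * x ^ n|) ∧
      HasSum (fun n => ((PowerSeries.coeff n (g * h) : ℚ) : ℝ) * x ^ n) (s * t) := by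
  have key : ∀ n, ((PowerSeries.coeff n (g * h) : ℚ) : ℝ) * x ^ n =
      ∑ p ∈ Finset.HasAntidiagonal.antidiagonal n, (((PowerSeries.coeff p.1 g : ℚ) : ℝ) * x ^ p.1) *
        (((PowerSeries.coeff p.2 h : ℚ) : ℝ) * x ^ p.2) := by
    intro n
    rw [PowerSeries.coeff_mul, Rat.cast_sum, Finset.sum_mul]
    refine Finset.sum_congr rfl fun p hp => ?_
    rw [← Finset.HasAntidiagonal.mem_antidiagonal.mp hp, Rat.cast_mul, pow_add]
    ring
  simp only [← Real.norm_eq_abs] at hg hh ⊢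
  have hs := summable_norm_sum_mul_antidiagonal_of_summable_norm hg hh
  have ht := tsum_mul_tsum_eq_tsum_sum_antidiagonal_of_summable_norm hg hh
  rw [hgs.tsum_eq, hht.tsum_eq] at ht
  simp only [key]
  refine ⟨hs, ?_⟩
  rw [ht]
  exact hs.of_norm.hasSum

lemma summable_hasSum_monomial (x : ℝ) (m : ℕ) (q : ℚ) :
    (Summable fun n => |((PowerSeries.coeff n (PowerSeries.monomial m q) : ℚ) : ℝ) * x ^ n|) ∧
      HasSum (fun n => ((PowerSeries.coeff n (PowerSeries.monomial m q) : ℚ) : ℝ) * x ^ n)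
        (q * x ^ m) := by
  have h0 : ∀ n, n ≠ m → ((PowerSeries.coeff n (PowerSeries.monomial m q) : ℚ) : ℝ) * x ^ n = 0 := by
    intro n hn
    rw [PowerSeries.coeff_monomial, if_neg hn, Rat.cast_zero, zero_mul]
  constructor
  · refine summable_of_ne_finset_zero (s := {m}) fun n hn => ?_
    rw [h0 n (by simpa using hn), abs_zero]
  · convert hasSum_single m h0 using 1
    simp

/-- Where a power series converges absolutely, polynomial expressions in it may be evaluated
termwise. -/
lemma hasSum_evalAt {x s : ℝ} {g : PowerSeries ℚ}
    (hg : Summable fun n => |((PowerSeries.coeff n g : ℚ) : ℝ) * x ^ n|)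
    (hgs : HasSum (fun n => ((PowerSeries.coeff n g : ℚ) : ℝ) * x ^ n) s) (R : ℚ[X][X]) :
    (Summable fun n => |((PowerSeries.coeff n (evalAt g R) : ℚ) : ℝ) * x ^ n|) ∧
      HasSum (fun n => ((PowerSeries.coeff n (evalAt g R) : ℚ) : ℝ) * x ^ n)
        (R.eval₂ (realEval x) s) := by
  induction R using bivariate_induction with
  | const q => simpa [realEval] using summable_hasSum_monomial x 0 q
  | t =>
    have := summable_hasSum_monomial x 1 1
    rw [← PowerSeries.X_eq] at this
    simpa [realEval] using this
  | z =>
    rw [evalAt_X, eval₂_X]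
    exact ⟨hg, hgs⟩
  | add R S hR hS =>
    simp only [map_add, Rat.cast_add, add_mul, eval₂_add]
    refine ⟨Summable.of_nonneg_of_le (fun _ => abs_nonneg _) (fun _ => abs_add_le _ _)
      (hR.1.add hS.1), hR.2.add hS.2⟩
  | mul R S hR hS =>
    rw [map_mul, eval₂_mul]
    exact hasSum_mul_of_summable_abs hR.1 hR.2 hS.1 hS.2

lemma exists_abs_realEval_le (p : ℚ[X]) :
    ∃ M : ℝ, 0 ≤ M ∧ ∀ x ∈ Set.Icc (0 : ℝ) 1, |realEval x p| ≤ M := by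
  obtain ⟨M, hM⟩ := isCompact_Icc.exists_bound_of_continuousOn
    (continuous_realEval p).continuousOn (s := Set.Icc (0 : ℝ) 1)
  exact ⟨M, (norm_nonneg _).trans (hM 0 (by simp)), hM⟩

/-- A nonzero polynomial vanishes at most polynomially at `1`. -/
lemma exists_le_abs_realEval {p : ℚ[X]} (hp : p ≠ 0) :
    ∃ (k : ℕ) (c δ : ℝ), 0 < c ∧ 0 < δ ∧
      ∀ x, 1 - δ < x → x < 1 → c * (1 - x) ^ k ≤ |realEval x p| := by
  obtain ⟨q, hq, hdvd⟩ := p.exists_eq_pow_rootMultiplicity_mul_and_not_dvd hp 1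
  set k := p.rootMultiplicity 1
  have hq1 : realEval 1 q ≠ 0 := by
    rw [dvd_iff_isRoot, IsRoot.def] at hdvd
    have : realEval 1 q = ((q.eval 1 : ℚ) : ℝ) := by
      simp [realEval]
    rw [this]
    exact_mod_cast hdvd
  have hpos : |realEval 1 q| / 2 < |realEval 1 q| := half_lt_self (abs_pos.mpr hq1)
  obtain ⟨δ, hδ, hball⟩ := Metric.eventually_nhds_iff.mp
    ((continuous_realEval q).abs.continuousAt.eventually_const_lt hpos)
  refine ⟨k, |realEval 1 q| / 2, δ, by positivity, hδ, fun x hx hx1 => ?_⟩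
  have hb := hball (y := x) (by rw [Real.dist_eq, abs_sub_lt_iff]; constructor <;> linarith)
  have : realEval x p = (x - 1) ^ k * realEval x q := by
    conv_lhs => rw [hq]
    simp [realEval]
  rw [this, abs_mul, abs_pow, abs_sub_comm, abs_of_pos (by linarith : 0 < 1 - x), mul_comm]
  have : 0 ≤ (1 - x) ^ k := pow_nonneg (by linarith) k
  gcongr

/-- The branches of an algebraic function grow at most polynomially at `1`. -/
lemma exists_abs_root_le {P : ℚ[X][X]} (hP : P ≠ 0) :
    ∃ (k : ℕ) (B δ : ℝ), 0 < B ∧ 0 < δ ∧ ∀ x y, 0 ≤ x → 1 - δ < x → x < 1 →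
      P.eval₂ (realEval x) y = 0 → |y| * (1 - x) ^ k ≤ B := by
  obtain ⟨k, c, δ, hc, hδ, hlead⟩ := exists_le_abs_realEval (leadingCoeff_ne_zero.mpr hP)
  choose M hM0 hM using fun i => exists_abs_realEval_le (P.coeff i)
  set S := ∑ i ∈ Finset.range P.natDegree, M i with hSdef
  have hS : 0 ≤ S := Finset.sum_nonneg fun i _ => hM0 i
  refine ⟨k, 1 + S / c, δ, by positivity, hδ, fun x y hx0 hx hx1 hroot => ?_⟩
  have hx1' : 0 < 1 - x := by linarith
  have hpow1 : (1 - x) ^ k ≤ 1 := pow_le_one₀ hx1'.le (by linarith)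
  have hpow0 : 0 < (1 - x) ^ k := by positivity
  rcases le_total |y| 1 with hy | hy
  · calc |y| * (1 - x) ^ k ≤ 1 * 1 := by gcongr
      _ ≤ 1 + S / c := by rw [one_mul]; linarith [div_nonneg hS hc.le]
  have hl := hlead x hx hx1
  rw [eval₂_eq_sum_range, Finset.sum_range_succ, add_eq_zero_iff_neg_eq] at hroot
  have habs : |realEval x P.leadingCoeff| * |y| ^ P.natDegree ≤
      ∑ i ∈ Finset.range P.natDegree, M i * |y| ^ i := by
    rw [← abs_pow, ← abs_mul, leadingCoeff, ← hroot, abs_neg]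
    refine (Finset.abs_sum_le_sum_abs _ _).trans (Finset.sum_le_sum fun i _ => ?_)
    rw [abs_mul, abs_pow]
    gcongr
    exact hM i x ⟨hx0, hx1.le⟩
  have hsum : (∑ i ∈ Finset.range P.natDegree, M i * |y| ^ i) * |y| ≤ S * |y| ^ P.natDegree := by
    rw [Finset.sum_mul, hSdef, Finset.sum_mul]
    refine Finset.sum_le_sum fun i hi => ?_
    rw [mul_assoc, ← pow_succ]
    have := hM0 i
    have := Finset.mem_range.mp hi
    gcongr
    omega
  have hyd : 0 < |y| ^ P.natDegree := by positivity
  have h1 : |realEval x P.leadingCoeff| * |y| ≤ S := by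
    refine le_of_mul_le_mul_right ?_ hyd
    calc _ = |realEval x P.leadingCoeff| * |y| ^ P.natDegree * |y| := by ring
      _ ≤ _ := (mul_le_mul_of_nonneg_right habs (abs_nonneg y)).trans hsum
  have h2 : c * (1 - x) ^ k * |y| ≤ S :=
    (mul_le_mul_of_nonneg_right hl (abs_nonneg y)).trans h1
  have h3 : |y| * (1 - x) ^ k ≤ S / c := by
    rw [le_div_iff₀ hc]
    linarith
  linarith

/-- An algebraic power series with nonnegative coefficients which converges on `[0, 1)` has
coefficients of polynomial growth. -/
lemma exists_polynomial_growth {a : ℕ → ℕ} (halg : PSAlgebraic (PowerSeries.mk fun n => (a n : ℚ)))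
    (hsum : ∀ x : ℝ, 0 < x → x < 1 → Summable fun n => (a n : ℝ) * x ^ n) :
    ∃ b c : ℝ, 0 < b ∧ 0 < c ∧ ∀ n : ℕ, 1 ≤ n → (a n : ℝ) ≤ b * (n : ℝ) ^ c := by
  obtain ⟨P, hP, hroot⟩ := halg
  obtain ⟨k, B, δ, hB, hδ, hbound⟩ := exists_abs_root_le hP
  obtain ⟨N, hN⟩ := exists_nat_gt (1 / δ)
  have hlarge : ∀ n : ℕ, N ≤ n → 1 ≤ n →
      (a n : ℝ) ≤ B * Real.exp 1 * 2 ^ k * (n : ℝ) ^ k := by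
    intro n hn hn1
    have hn0 : (0 : ℝ) < n := by exact_mod_cast hn1
    have hn1' : (1 : ℝ) ≤ n := by exact_mod_cast hn1
    set x : ℝ := n / (n + 1) with hx
    have hx0 : 0 < x := by positivity
    have hx1 : 1 - x = 1 / (n + 1) := by rw [hx]; field_simp; ring
    have hxlt : 0 < 1 - x := by rw [hx1]; positivity
    have hxδ : 1 - x < δ := by
      rw [hx1, div_lt_comm₀ (by positivity) hδ]
      have : (N : ℝ) ≤ n := by exact_mod_cast hn
      linarith
    have hs := hsum x hx0 (by linarith)
    have hev := hasSum_evalAt (x := x) (g := PowerSeries.mk fun n => (a n : ℚ))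
      (s := ∑' n, (a n : ℝ) * x ^ n) (by simpa [abs_mul] using hs.abs)
      (by simpa using hs.hasSum) P
    have hzero : evalAt (PowerSeries.mk fun n => (a n : ℚ)) P = 0 := hroot
    rw [hzero] at hev
    have hPx : P.eval₂ (realEval x) (∑' n, (a n : ℝ) * x ^ n) = 0 := by
      refine hev.2.unique ?_
      simp
    have hb := hbound x _ hx0.le (by linarith) (by linarith) hPx
    have hterm : (a n : ℝ) * x ^ n ≤ |∑' n, (a n : ℝ) * x ^ n| :=
      (hs.le_tsum n fun _ _ => by positivity).trans (le_abs_self _)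
    have hexp : 1 ≤ x ^ n * Real.exp 1 := by
      have h1 : 1 ≤ x * Real.exp (1 / n) := by
        have := Real.add_one_le_exp (1 / (n : ℝ))
        calc (1 : ℝ) = x * (1 / n + 1) := by rw [hx]; field_simp; ring
          _ ≤ _ := by gcongr
      calc (1 : ℝ) ≤ (x * Real.exp (1 / n)) ^ n := one_le_pow₀ h1
        _ = _ := by rw [mul_pow, ← Real.exp_nat_mul, mul_one_div_cancel hn0.ne']
    have hk : (1 : ℝ) ≤ (1 - x) ^ k * (2 ^ k * (n : ℝ) ^ k) := by
      rw [← mul_pow, ← mul_pow]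
      refine one_le_pow₀ ?_
      rw [hx1, div_mul_eq_mul_div, le_div_iff₀ (by positivity)]
      linarith
    calc (a n : ℝ) ≤ a n * (x ^ n * Real.exp 1) * ((1 - x) ^ k * (2 ^ k * (n : ℝ) ^ k)) := by
          rw [mul_assoc]
          exact le_mul_of_one_le_right (by positivity) (one_le_mul_of_one_le_of_one_le hexp hk)
      _ = (a n * x ^ n) * (1 - x) ^ k * (Real.exp 1 * 2 ^ k * (n : ℝ) ^ k) := by ring
      _ ≤ B * (Real.exp 1 * 2 ^ k * (n : ℝ) ^ k) := by
          gcongr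
          exact (mul_le_mul_of_nonneg_right hterm (by positivity)).trans hb
      _ = _ := by ring
  set A : ℝ := ∑ i ∈ Finset.range N, (a i : ℝ) with hA
  have hA0 : 0 ≤ A := by positivity
  refine ⟨B * Real.exp 1 * 2 ^ k + A, (k + 1 : ℕ), by positivity, by positivity, fun n hn => ?_⟩
  rw [Real.rpow_natCast]
  have hn1 : (1 : ℝ) ≤ n := by exact_mod_cast hn
  rcases le_or_gt N n with h | h
  · refine (hlarge n h hn).trans ?_
    gcongr
    · linarith
    · omega
  · have h1 : (a n : ℝ) ≤ A :=
      Finset.single_le_sum (f := fun i => (a i : ℝ)) (fun _ _ => by positivity)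
        (Finset.mem_range.mpr h)
    have h2 : (1 : ℝ) ≤ (n : ℝ) ^ (k + 1) := one_le_pow₀ hn1
    have h3 : 0 < B * Real.exp 1 * 2 ^ k := by positivity
    nlinarith

/-- A power series with nonnegative coefficients which diverges somewhere in `(0, 1)` has
coefficients that are exponentially large infinitely often. -/
lemma exists_exponential_lower_bound {a : ℕ → ℕ} {x : ℝ} (hx0 : 0 < x) (hx1 : x < 1)
    (hx : ¬ Summable fun n => (a n : ℝ) * x ^ n) :
    ∃ b c : ℝ, 0 < b ∧ 1 < c ∧ ∀ N : ℕ, ∃ n : ℕ, N ≤ n ∧ b * c ^ n ≤ (a n : ℝ) := by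
  obtain ⟨y, hxy, hy1⟩ := exists_between hx1
  have hy0 : 0 < y := hx0.trans hxy
  refine ⟨1, y⁻¹, one_pos, (one_lt_inv₀ hy0).mpr hy1, ?_⟩
  by_contra! hcon
  obtain ⟨N, hN⟩ := hcon
  refine hx ?_
  rw [← summable_nat_add_iff N]
  refine Summable.of_nonneg_of_le (fun _ => by positivity) (fun n => ?_)
    ((summable_nat_add_iff N).mpr (summable_geometric_of_lt_one (div_nonneg hx0.le hy0.le)
      ((div_lt_one hy0).mpr hxy)))
  have := (hN (n + N) (by omega)).le
  calc (a (n + N) : ℝ) * x ^ (n + N) ≤ (1 * y⁻¹ ^ (n + N)) * x ^ (n + N) := by gcongr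
    _ = (x / y) ^ (n + N) := by rw [one_mul, ← mul_pow, div_eq_inv_mul]

end PSAlgebraic

/-- The coefficients of an algebraic power series with nonnegative integer coefficients are
either of polynomial or of exponential growth. -/
theorem algebraic_coeffs_polynomial_or_exponential_growth (a : ℕ → ℕ)
    (halg : PSAlgebraic (PowerSeries.mk fun n => (a n : ℚ))) :
    (∃ b c : ℝ, 0 < b ∧ 0 < c ∧ ∀ n : ℕ, 1 ≤ n → (a n : ℝ) ≤ b * (n : ℝ) ^ c) ∨
    ((∃ b₂ c₂ : ℝ, 0 < b₂ ∧ 1 < c₂ ∧ ∀ n : ℕ, (a n : ℝ) ≤ b₂ * c₂ ^ n) ∧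
     (∃ b₁ c₁ : ℝ, 0 < b₁ ∧ 1 < c₁ ∧ ∀ N : ℕ, ∃ n : ℕ, N ≤ n ∧ b₁ * c₁ ^ n ≤ (a n : ℝ))) := by
  by_cases hsum : ∀ x : ℝ, 0 < x → x < 1 → Summable fun n => (a n : ℝ) * x ^ n
  · exact Or.inl (PSAlgebraic.exists_polynomial_growth halg hsum)
  · push Not at hsum
    obtain ⟨x, hx0, hx1, hx⟩ := hsum
    refine Or.inr ⟨?_, PSAlgebraic.exists_exponential_lower_bound hx0 hx1 hx⟩
    obtain ⟨b, c, hb, hc, h⟩ := PSAlgebraic.exists_abs_coeff_le halg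
    exact ⟨b, c, hb, hc, fun n => by simpa using h n⟩
end

section
/- (Hilbert–Serre) Let K be a field and let R = ⨁_{n≥0} R_n be a commutative graded K-algebra with R_0 = K which is generated as a K-algebra by finitely many homogeneous elements of positive degrees m_1, …, m_k. Then every homogeneous component R_n is finite dimensional over K, and the Hilbert series H(R,t) = ∑_{n≥0} dim_K(R_n)·t^n is a rational function whose denominator is a product of binomials 1 − t^{m_i}: the power series ∏_{i=1}^k (1 − t^{m_i}) · H(R,t) is a polynomial with integer coefficients. -/
open DirectSum

section HilbertSerre

variable {K A : Type*} [Field K] [CommRing A] [Algebra K A]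

/-- A subspace stable under multiplication by a generating set of the algebra is stable under
multiplication by every element. -/
theorem Submodule.mul_mem_of_adjoin_eq_top {s : Set A} (hgen : Algebra.adjoin K s = ⊤)
    (W : Submodule K A) (hW : ∀ y ∈ s, ∀ w ∈ W, y * w ∈ W) (a : A) {w : A} (hw : w ∈ W) :
    a * w ∈ W := by
  have ha : a ∈ Algebra.adjoin K s := hgen ▸ Algebra.mem_top
  induction ha using Algebra.adjoin_induction generalizing w with
  | mem y hy => exact hW y hy w hw
  | algebraMap r => rw [← Algebra.smul_def]; exact W.smul_mem r hw
  | add y z _ _ hy hz => rw [add_mul]; exact W.add_mem (hy hw) (hz hw)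
  | mul y z _ _ hy hz => rw [mul_assoc]; exact hy (hz hw)

variable (𝒜 : ℕ → Submodule K A)

/-- The degree `n` part of an ideal, as a `K`-subspace. -/
def Ideal.gradedPart (I : Ideal A) (n : ℕ) : Submodule K A :=
  I.restrictScalars K ⊓ 𝒜 n

theorem Ideal.mem_gradedPart {I : Ideal A} {n : ℕ} {a : A} :
    a ∈ I.gradedPart 𝒜 n ↔ a ∈ I ∧ a ∈ 𝒜 n :=
  Iff.rfl

theorem Ideal.gradedPart_top (n : ℕ) : (⊤ : Ideal A).gradedPart 𝒜 n = 𝒜 n :=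
  inf_eq_right.2 fun _ _ => Submodule.mem_top (R := A)

theorem Ideal.gradedPart_bot (n : ℕ) : (⊥ : Ideal A).gradedPart 𝒜 n = ⊥ :=
  le_bot_iff.1 fun _ h => h.1

/-- The Hilbert series of the degreewise difference of two ideals; for `J ≤ I` this is the Hilbert
series of `I ⧸ J`. -/
noncomputable def Ideal.relHilbertSeries (I J : Ideal A) : PowerSeries ℤ :=
  PowerSeries.mk fun n =>
    (Module.finrank K (I.gradedPart 𝒜 n) : ℤ) - Module.finrank K (J.gradedPart 𝒜 n)

variable [GradedAlgebra 𝒜]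

/-- If finitely many elements of positive degrees generate `A` and `𝒜 0` is spanned by `1`, the homogeneous
components are finite dimensional. -/
theorem GradedAlgebra.finite_component_of_adjoin_eq_top (h0 : 𝒜 0 = Submodule.span K {1})
    {ι : Type*} [Finite ι] {x : ι → A} {m : ι → ℕ} (hm : ∀ i, 0 < m i)
    (hx : ∀ i, x i ∈ 𝒜 (m i)) (hgen : Algebra.adjoin K (Set.range x) = ⊤) (n : ℕ) :
    Module.Finite K (𝒜 n) := by
  have := Fintype.ofFinite ι
  induction n using Nat.strong_induction_on with
  | _ n ih =>
  rcases Nat.eq_zero_or_pos n with rfl | hn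
  · rw [h0]; infer_instance
  have hfin (i : ι) : Module.Finite K
      ((𝒜 (n - m i)).map (LinearMap.mulRight K (x i)) : Submodule K A) := by
    have := ih (n - m i) (by have := hm i; omega)
    infer_instance
  refine Submodule.finiteDimensional_of_le
    (S₂ := ⨆ i, (𝒜 (n - m i)).map (LinearMap.mulRight K (x i))) fun a ha => ?_
  let W : Submodule K A := 𝒜 0 ⊔ (Ideal.span (Set.range x)).restrictScalars K
  have haW : a ∈ W := by
    have h1 : (1 : A) ∈ W := Submodule.mem_sup_left (SetLike.GradedOne.one_mem)
    simpa using W.mul_mem_of_adjoin_eq_top hgen (fun y hy w _ => Submodule.mem_sup_right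
      (Ideal.mul_mem_right w _ (Ideal.subset_span hy))) a h1
  obtain ⟨c, hc, b, hb, rfl⟩ := Submodule.mem_sup.1 haW
  obtain ⟨f, rfl⟩ := Ideal.mem_span_range_iff_exists_fun.1
    ((Submodule.restrictScalars_mem K _ _).1 hb)
  rw [← decompose_of_mem_same 𝒜 ha, decompose_add, decompose_sum, DirectSum.add_apply,
    Submodule.coe_add, decompose_of_mem_ne 𝒜 hc hn.ne, zero_add, DFinsupp.finsetSum_apply,
    Submodule.coe_sum]
  refine Submodule.sum_mem _ fun i _ => ?_
  rw [coe_decompose_mul_of_right_mem 𝒜 n (hx i)]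
  split_ifs
  · exact Submodule.mem_iSup_of_mem i ⟨_, (decompose 𝒜 (f i) (n - m i)).2, rfl⟩
  · exact Submodule.zero_mem _

/-- If the generators of `A` multiply a finitely generated ideal `I` into a homogeneous ideal `J`,
then `I` and `J` agree in large degrees. -/
theorem Ideal.exists_gradedPart_le {s : Set A} (hgen : Algebra.adjoin K s = ⊤) {I J : Ideal A}
    (hI : I.FG) (hJ : J.IsHomogeneous 𝒜) (hs : ∀ y ∈ s, ∀ a ∈ I, y * a ∈ J) :
    ∃ N, ∀ n ≥ N, I.gradedPart 𝒜 n ≤ J.gradedPart 𝒜 n := by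
  classical
  obtain ⟨g, rfl⟩ := hI
  obtain ⟨N, hN⟩ : ∃ N, ∀ n ≥ N, ∀ b ∈ Submodule.span K (g : Set A),
      (decompose 𝒜 b n : A) = 0 := by
    refine ⟨(g.sup fun b => (decompose 𝒜 b).support.sup id) + 1, fun n hn b hb => ?_⟩
    induction hb using Submodule.span_induction with
    | mem b hb =>
      by_contra h
      have hmem : n ∈ (decompose 𝒜 b).support := by
        rw [DFinsupp.mem_support_iff]
        exact fun h' => h (by rw [h']; rfl)
      have h1 : n ≤ (decompose 𝒜 b).support.sup id := Finset.le_sup (f := id) hmem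
      have h2 := Finset.le_sup (f := fun b => (decompose 𝒜 b).support.sup id) hb
      simp only at h2
      omega
    | zero => simp
    | add y z _ _ hy hz => simp [decompose_add, hy, hz]
    | smul c y _ hy => simp [decompose_smul, DirectSum.smul_apply, hy]
  refine ⟨N, fun n hn a ha => ⟨?_, ha.2⟩⟩
  let W : Submodule K A := J.restrictScalars K ⊔ Submodule.span K (g : Set A)
  have hWstable : ∀ y ∈ s, ∀ w ∈ W, y * w ∈ W := by
    intro y hy w hw
    obtain ⟨j, hj, b, hb, rfl⟩ := Submodule.mem_sup.1 hw
    rw [mul_add]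
    exact Submodule.mem_sup_left (J.add_mem (J.mul_mem_left y hj)
      (hs y hy b (Submodule.span_le_restrictScalars K A _ hb)))
  have haW : a ∈ W := by
    have ha1 := ha.1
    change a ∈ Submodule.span A (g : Set A) at ha1
    clear ha
    induction ha1 using Submodule.span_induction with
    | mem b hb => exact Submodule.mem_sup_right (Submodule.subset_span hb)
    | zero => exact W.zero_mem
    | add y z _ _ hy hz => exact W.add_mem hy hz
    | smul c y _ hy => exact W.mul_mem_of_adjoin_eq_top hgen hWstable c hy
  obtain ⟨j, hj, b, hb, rfl⟩ := Submodule.mem_sup.1 haW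
  change j + b ∈ J
  rw [← decompose_of_mem_same 𝒜 ha.2, decompose_add, DirectSum.add_apply, Submodule.coe_add,
    hN n hn b hb, add_zero]
  exact hJ n hj

/-- Rank–nullity for a linear map restricted to a subspace. -/
theorem Submodule.finrank_map_add_finrank_inf_ker {V V' : Type*} [AddCommGroup V] [Module K V]
    [AddCommGroup V'] [Module K V'] (f : V →ₗ[K] V') (p : Submodule K V) [Module.Finite K p] :
    Module.finrank K (p.map f) + Module.finrank K (p ⊓ LinearMap.ker f : Submodule K V) =
      Module.finrank K p := by
  have h := (f.domRestrict p).finrank_range_add_finrank_ker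
  rw [LinearMap.range_domRestrict, LinearMap.ker_domRestrict] at h
  rw [← h, ← (Submodule.comap_equiv_self_of_inj_of_le p.injective_subtype
      (inf_le_left.trans p.range_subtype.ge) (p := p ⊓ LinearMap.ker f)).finrank_eq,
    Submodule.comap_inf, Submodule.comap_subtype_self, top_inf_eq]

theorem Ideal.isHomogeneous_comap_mulLeft {J : Ideal A} (hJ : J.IsHomogeneous 𝒜) {x : A} {d : ℕ}
    (hx : x ∈ 𝒜 d) : Ideal.IsHomogeneous 𝒜 (Submodule.comap (LinearMap.mulLeft A x) J) := by
  intro n a ha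
  change x * _ ∈ J
  rw [← coe_decompose_mul_add_of_left_mem 𝒜 hx]
  exact hJ _ ha

variable {𝒜}

/-- The exact sequence of the multiplication by a homogeneous `x` on `I ⧸ J`, read off on Hilbert
series. -/
theorem Ideal.one_sub_X_pow_mul_relHilbertSeries (hfin : ∀ n, Module.Finite K (𝒜 n))
    {I J : Ideal A} (hI : I.IsHomogeneous 𝒜) (hJ : J.IsHomogeneous 𝒜)
    {x : A} {d : ℕ} (hx : x ∈ 𝒜 d) :
    (1 - (PowerSeries.X : PowerSeries ℤ) ^ d) * I.relHilbertSeries 𝒜 J =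
      I.relHilbertSeries 𝒜 (Ideal.span {x} * I ⊔ J) -
        PowerSeries.X ^ d * Ideal.relHilbertSeries 𝒜
          (I ⊓ Submodule.comap (LinearMap.mulLeft A x) J) J := by
  set L := Ideal.span {x} * I ⊔ J
  set I' : Ideal A := I ⊓ Submodule.comap (LinearMap.mulLeft A x) J with hI'
  have hfinPart (I : Ideal A) (n : ℕ) : Module.Finite K (I.gradedPart 𝒜 n) :=
    Submodule.finiteDimensional_of_le inf_le_right
  have hcomp {n : ℕ} {l : A} (hl : l ∈ L.gradedPart 𝒜 n) :
      ∃ b ∈ I, ∃ j ∈ J, (decompose 𝒜 (x * b) n : A) + j = l := by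
    obtain ⟨y, hy, j, hj, hyj⟩ := Submodule.mem_sup.1 hl.1
    obtain ⟨b, hb, rfl⟩ := Ideal.mem_span_singleton_mul.1 hy
    refine ⟨b, hb, decompose 𝒜 j n, hJ n hj, ?_⟩
    rw [← decompose_of_mem_same 𝒜 hl.2, ← hyj, decompose_add, DirectSum.add_apply,
      Submodule.coe_add]
  have hlow {n : ℕ} (hn : ¬ d ≤ n) : L.gradedPart 𝒜 n = J.gradedPart 𝒜 n := by
    apply le_antisymm
    · refine fun l hl => ⟨?_, hl.2⟩
      obtain ⟨b, -, j, hj, rfl⟩ := hcomp hl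
      rw [coe_decompose_mul_of_left_mem_of_not_le 𝒜 hx hn, zero_add]
      exact hj
    · exact inf_le_inf_right _ fun _ h => Submodule.mem_sup_right h
  have hhigh (n : ℕ) :
      (Module.finrank K (I.gradedPart 𝒜 n) : ℤ) - Module.finrank K (I'.gradedPart 𝒜 n) =
      Module.finrank K (L.gradedPart 𝒜 (d + n)) - Module.finrank K (J.gradedPart 𝒜 (d + n)) := by
    let q : A →ₗ[K] A ⧸ J.restrictScalars K := (J.restrictScalars K).mkQ
    let φ : A →ₗ[K] A ⧸ J.restrictScalars K := q ∘ₗ LinearMap.mulLeft K x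
    have hφ := Submodule.finrank_map_add_finrank_inf_ker φ (I.gradedPart 𝒜 n)
    have hq := Submodule.finrank_map_add_finrank_inf_ker q (L.gradedPart 𝒜 (d + n))
    have hkerφ : I.gradedPart 𝒜 n ⊓ LinearMap.ker φ = I'.gradedPart 𝒜 n := by
      ext a
      simp [φ, q, hI', Ideal.mem_gradedPart]
      tauto
    have hkerq : L.gradedPart 𝒜 (d + n) ⊓ LinearMap.ker q = J.gradedPart 𝒜 (d + n) := by
      ext a
      have : a ∈ J → a ∈ L := fun h => Submodule.mem_sup_right h
      simp [q, Ideal.mem_gradedPart]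
      tauto
    have hmap : (I.gradedPart 𝒜 n).map φ = (L.gradedPart 𝒜 (d + n)).map q := by
      apply le_antisymm
      · rintro _ ⟨a, ha, rfl⟩
        exact ⟨x * a, ⟨Submodule.mem_sup_left (Ideal.mem_span_singleton_mul.2 ⟨a, ha.1, rfl⟩),
          SetLike.GradedMul.mul_mem hx ha.2⟩, rfl⟩
      · rintro _ ⟨l, hl, rfl⟩
        obtain ⟨b, hb, j, hj, rfl⟩ := hcomp hl
        rw [coe_decompose_mul_add_of_left_mem 𝒜 hx]
        refine ⟨decompose 𝒜 b n, ⟨hI n hb, SetLike.coe_mem _⟩, ?_⟩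
        have hj0 : q j = 0 := (Submodule.Quotient.mk_eq_zero _).2 hj
        rw [map_add, hj0, add_zero]
        rfl
    rw [hkerφ] at hφ
    rw [hkerq, ← hmap] at hq
    omega
  ext n
  rw [sub_mul, one_mul, map_sub, map_sub, PowerSeries.coeff_X_pow_mul',
    PowerSeries.coeff_X_pow_mul']
  simp only [Ideal.relHilbertSeries, PowerSeries.coeff_mk]
  split_ifs with h
  · obtain ⟨n, rfl⟩ := Nat.exists_eq_add_of_le h
    have := hhigh n
    rw [Nat.add_sub_cancel_left]
    omega
  · rw [hlow h]

/-- A power series with eventually vanishing coefficients is a polynomial. -/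
theorem PowerSeries.mem_range_coe_of_coeff_eq_zero {R : Type*} [CommRing R] {f : PowerSeries R}
    {N : ℕ} (h : ∀ n ≥ N, f.coeff n = 0) :
    f ∈ (Polynomial.coeToPowerSeries.ringHom (R := R)).range := by
  refine ⟨f.trunc N, ?_⟩
  ext n
  rw [Polynomial.coeToPowerSeries.ringHom_apply, Polynomial.coeff_coe, PowerSeries.coeff_trunc]
  split_ifs with hn
  · rfl
  · exact (h n (not_lt.1 hn)).symm

/-- Hilbert–Serre for a subquotient `I ⧸ J` annihilated by the generators outside `S`. -/
theorem Ideal.prod_mul_relHilbertSeries_mem_range [IsNoetherianRing A]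
    (hfin : ∀ n, Module.Finite K (𝒜 n)) {ι : Type*} {x : ι → A} {m : ι → ℕ}
    (hx : ∀ i, x i ∈ 𝒜 (m i)) (hgen : Algebra.adjoin K (Set.range x) = ⊤) (S : Finset ι)
    {I J : Ideal A} (hI : I.IsHomogeneous 𝒜) (hJ : J.IsHomogeneous 𝒜) (hJI : J ≤ I)
    (hS : ∀ i ∉ S, ∀ a ∈ I, x i * a ∈ J) :
    (∏ i ∈ S, (1 - (PowerSeries.X : PowerSeries ℤ) ^ m i)) * I.relHilbertSeries 𝒜 J ∈
      (Polynomial.coeToPowerSeries.ringHom (R := ℤ)).range := by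
  classical
  induction S using Finset.induction_on generalizing I J with
  | empty =>
    obtain ⟨N, hN⟩ := Ideal.exists_gradedPart_le 𝒜 hgen (IsNoetherian.noetherian I) hJ
      (by rintro _ ⟨i, rfl⟩; exact hS i (Finset.notMem_empty i))
    rw [Finset.prod_empty, one_mul]
    refine PowerSeries.mem_range_coe_of_coeff_eq_zero (N := N) fun n hn => ?_
    rw [Ideal.relHilbertSeries, PowerSeries.coeff_mk,
      (hN n hn).antisymm (inf_le_inf_right _ fun _ h => hJI h), sub_self]
  | insert i S hi ih =>
    have hX : (PowerSeries.X : PowerSeries ℤ) ^ m i ∈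
        (Polynomial.coeToPowerSeries.ringHom (R := ℤ)).range := ⟨Polynomial.X ^ m i, by simp⟩
    rw [Finset.prod_insert hi, mul_comm (1 - _), mul_assoc,
      Ideal.one_sub_X_pow_mul_relHilbertSeries hfin hI hJ (hx i), mul_sub, mul_left_comm]
    refine sub_mem (ih hI ?_ ?_ ?_) (mul_mem hX (ih ?_ hJ ?_ ?_))
    · exact (((Ideal.homogeneous_span 𝒜 _ (by rintro _ rfl; exact ⟨_, hx i⟩)).mul hI).sup hJ)
    · exact sup_le Ideal.mul_le_right hJI
    · intro j hj a ha
      by_cases hji : j = i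
      · subst hji
        exact Submodule.mem_sup_left (Ideal.mem_span_singleton_mul.2 ⟨a, ha, rfl⟩)
      · exact Submodule.mem_sup_right (hS j (by simp [hji, hj]) a ha)
    · exact hI.inf (Ideal.isHomogeneous_comap_mulLeft 𝒜 hJ (hx i))
    · exact le_inf hJI fun a ha => J.mul_mem_left _ ha
    · intro j hj a ha
      by_cases hji : j = i
      · subst hji
        exact ha.2
      · exact hS j (by simp [hji, hj]) a ha.1

end HilbertSerre


/-- **Hilbert–Serre.** Let `R = ⨁ₙ Rₙ` be a commutative graded `K`-algebra with `R₀ = K`,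
generated as a `K`-algebra by finitely many homogeneous elements `x i` of positive degrees
`m i`. Then every homogeneous component is finite dimensional over `K`, and the Hilbert series
`H(R,t) = ∑ dim_K(Rₙ)·tⁿ` becomes a polynomial with integer coefficients after multiplication
by `∏ᵢ (1 − t^{m i})`. -/
theorem hilbert_serre {K A : Type*} [Field K] [CommRing A] [Algebra K A]
    (𝒜 : ℕ → Submodule K A) [GradedAlgebra 𝒜]
    (h0 : 𝒜 0 = Submodule.span K {1})
    (k : ℕ) (x : Fin k → A) (m : Fin k → ℕ)
    (hm : ∀ i, 0 < m i) (hx : ∀ i, x i ∈ 𝒜 (m i))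
    (hgen : Algebra.adjoin K (Set.range x) = ⊤) :
    (∀ n : ℕ, Module.Finite K (𝒜 n)) ∧
    ∃ p : Polynomial ℤ,
      (∏ i : Fin k, (1 - (PowerSeries.X : PowerSeries ℤ) ^ (m i))) *
        PowerSeries.mk (fun n => (Module.finrank K (𝒜 n) : ℤ)) = (p : PowerSeries ℤ) := by

  have hfin := GradedAlgebra.finite_component_of_adjoin_eq_top 𝒜 h0 hm hx hgen
  refine ⟨hfin, ?_⟩
  have hft : Algebra.FiniteType K A :=
    ⟨⟨(Set.finite_range x).toFinset, by rw [Set.Finite.coe_toFinset, hgen]⟩⟩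
  have := Algebra.FiniteType.isNoetherianRing K A
  obtain ⟨p, hp⟩ := Ideal.prod_mul_relHilbertSeries_mem_range hfin hx hgen Finset.univ
    (Ideal.IsHomogeneous.top 𝒜) (Ideal.IsHomogeneous.bot 𝒜) bot_le
    (fun i hi => absurd (Finset.mem_univ i) hi)
  refine ⟨p, ?_⟩
  rw [Polynomial.coeToPowerSeries.ringHom_apply] at hp
  rw [hp]
  congr 1
  ext n
  rw [Ideal.relHilbertSeries, PowerSeries.coeff_mk, PowerSeries.coeff_mk, Ideal.gradedPart_top,
    Ideal.gradedPart_bot, finrank_bot, Nat.cast_zero, sub_zero]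
end

section
/- (Mahler) Lacunary power series with nonnegative integer coefficients are transcendental: let (n_k)_{k≥1} be a strictly increasing sequence of nonnegative integers with n_{k+1} − n_k → ∞ as k → ∞, and let a_{n_k} be positive integers for all k. Then the power series f(t) = ∑_{k≥1} a_{n_k} t^{n_k} is transcendental over ℚ(t). -/
open Polynomial in
theorem IsAlgebraic.exists_aeval_derivative_ne_zero {A B : Type*} [CommRing A] [CharZero A]
    [CommRing B] [IsDomain B] [Algebra A B] [FaithfulSMul A B] {x : B} (hx : IsAlgebraic A x) :
    ∃ P : A[X], aeval x P = 0 ∧ aeval x (derivative P) ≠ 0 := by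
  have := IsDomain.of_faithfulSMul A B
  by_contra! h
  obtain ⟨P, hP, hPx⟩ := hx
  have key : ∀ k : ℕ, ∀ Q : A[X], Q.natDegree < k → aeval x Q = 0 → Q = 0 := by
    intro k
    induction k with
    | zero => intro Q hQ; omega
    | succ k ih =>
      intro Q hQ hQx
      have hdeg : Q.natDegree = 0 := by
        by_contra hne
        refine hne (derivative_eq_zero.mp (ih _ ?_ (h Q hQx)))
        have := natDegree_derivative_lt hne
        omega
      rw [eq_C_of_natDegree_eq_zero hdeg] at hQx ⊢
      rw [aeval_C, FaithfulSMul.algebraMap_eq_zero_iff] at hQx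
      rw [hQx, C_0]
  exact hP (key _ P (Nat.lt_succ_self _) hPx)

/-- In characteristic zero, the iterated derivatives of an algebraic element are linearly
dependent. -/
theorem Derivation.not_linearIndependent_iterate_of_isAlgebraic {R A B : Type*}
    [CommRing R] [CommRing A] [CharZero A] [CommRing B] [IsDomain B] [Algebra R A] [Algebra R B]
    [Algebra A B] [FaithfulSMul A B] (d : Derivation R A A) (D : Derivation R B B)
    (hD : ∀ a, algebraMap A B (d a) = D (algebraMap A B a)) {x : B} (hx : IsAlgebraic A x) :
    ¬ LinearIndependent A (fun i : ℕ => D^[i] x) := by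
  have := IsDomain.of_faithfulSMul A B
  let E := FractionRing B
  let K := FractionRing A
  have : FaithfulSMul A E := FaithfulSMul.trans A B E
  let : Algebra K E := FractionRing.liftAlgebra A E
  have hinj : Function.Injective (algebraMap B E) := FaithfulSMul.algebraMap_injective B E
  let F := IntermediateField.adjoin K {algebraMap B E x}
  have hA : ∀ a : A, algebraMap A E a ∈ F := fun a => by
    rw [IsScalarTower.algebraMap_apply A K E]
    exact F.algebraMap_mem _
  have hxE : IsAlgebraic A (algebraMap B E x) := hx.algebraMap
  have : FiniteDimensional K F :=
    IntermediateField.adjoin.finiteDimensional (hxE.extendScalars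
      (FaithfulSMul.algebraMap_injective A K)).isIntegral
  have hFalg : ∀ y : B, algebraMap B E y ∈ F → IsAlgebraic A y := fun y hy => by
    have h1 : IsAlgebraic K (algebraMap B E y) :=
      (Algebra.IsAlgebraic.isAlgebraic (R := K) (⟨_, hy⟩ : F)).algebraMap (A := E)
    have h2 : IsAlgebraic A (algebraMap B E y) :=
      (IsFractionRing.isAlgebraic_iff A K E).mpr h1
    exact (isAlgebraic_algebraMap_iff hinj).mp h2
  have hstep : ∀ y : B, algebraMap B E y ∈ F → algebraMap B E (D y) ∈ F := fun y hy => by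
    obtain ⟨P, hP, hP'⟩ := (hFalg y hy).exists_aeval_derivative_ne_zero
    have haeval : ∀ Q : Polynomial A, algebraMap B E (Polynomial.aeval y Q) ∈ F := fun Q => by
      induction Q using Polynomial.induction_on' with
      | add p q hp hq => simpa using F.add_mem hp hq
      | monomial n a =>
        simp only [Polynomial.aeval_monomial, map_mul, map_pow,
          ← IsScalarTower.algebraMap_apply A B E]
        exact F.mul_mem (hA a) (F.pow_mem hy n)
    have hchain := Derivation.apply_aeval_eq' d D (Algebra.linearMap A B) hD y P
    rw [hP, map_zero] at hchain
    have hcoeff : algebraMap B E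
        (PolynomialModule.eval y (PolynomialModule.map B (Algebra.linearMap A B)
          (d.mapCoeffs P))) ∈ F := by
      generalize d.mapCoeffs P = q
      induction q using PolynomialModule.induction_linear with
      | zero => simp
      | add p q hp hq => simpa using F.add_mem hp hq
      | single n a =>
        simp only [PolynomialModule.map_single, PolynomialModule.eval_single, smul_eq_mul,
          map_mul, map_pow, Algebra.linearMap_apply, ← IsScalarTower.algebraMap_apply A B E]
        exact F.mul_mem (F.pow_mem hy n) (hA a)
    have hne : algebraMap B E (Polynomial.aeval y (Polynomial.derivative P)) ≠ 0 := by
      simpa using hP'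
    have heq : algebraMap B E (D y) = -algebraMap B E
        (PolynomialModule.eval y (PolynomialModule.map B (Algebra.linearMap A B)
          (d.mapCoeffs P))) / algebraMap B E (Polynomial.aeval y (Polynomial.derivative P)) := by
      rw [eq_div_iff hne, ← map_mul, ← map_neg]
      congr 1
      rw [smul_eq_mul] at hchain
      linear_combination -hchain
    rw [heq]
    exact F.div_mem (F.neg_mem hcoeff) (haeval _)
  have hiter : ∀ i : ℕ, algebraMap B E (D^[i] x) ∈ F := fun i => by
    induction i with
    | zero => exact IntermediateField.mem_adjoin_simple_self K _
    | succ i ih =>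
      rw [Function.iterate_succ_apply']
      exact hstep _ ih
  intro hli
  have hliE : LinearIndependent A (fun i : ℕ => algebraMap B E (D^[i] x)) :=
    hli.map' (IsScalarTower.toAlgHom A B E).toLinearMap (LinearMap.ker_eq_bot.mpr hinj)
  rw [LinearIndependent.iff_fractionRing A K] at hliE
  have hliF : LinearIndependent K (fun i : ℕ => (⟨_, hiter i⟩ : F)) :=
    LinearIndependent.of_comp F.val.toLinearMap hliE
  exact not_finite_iff_infinite.mpr inferInstance hliF.finite

namespace PowerSeries

/-- The Euler derivation `t d/dt`. -/
noncomputable def euler (R : Type*) [CommRing R] : Derivation R R⟦X⟧ R⟦X⟧ :=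
  (X : R⟦X⟧) • derivative R

theorem coeff_euler {R : Type*} [CommRing R] (f : R⟦X⟧) (n : ℕ) :
    coeff n (euler R f) = n * coeff n f := by
  cases n with
  | zero => simp [euler]
  | succ n => simp [euler, coeff_succ_X_mul, coeff_derivative, mul_comm]

theorem coeff_iterate_euler {R : Type*} [CommRing R] (f : R⟦X⟧) (i n : ℕ) :
    coeff n ((euler R)^[i] f) = n ^ i * coeff n f := by
  induction i with
  | zero => simp
  | succ i ih => rw [Function.iterate_succ_apply', coeff_euler, ih]; ring

theorem not_linearIndependent_iterate_euler {f : ℚ⟦X⟧} (hf : PSAlgebraic f) :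
    ¬ LinearIndependent (Polynomial ℚ) (fun i : ℕ => (euler ℚ)^[i] f) := by
  have halg (p : Polynomial ℚ) : algebraMap (Polynomial ℚ) ℚ⟦X⟧ p = p := by
    simp [algebraMap_apply']
  have : FaithfulSMul (Polynomial ℚ) ℚ⟦X⟧ := by
    rw [faithfulSMul_iff_algebraMap_injective]
    intro p q h
    simpa [halg] using h
  let d : Derivation ℚ (Polynomial ℚ) (Polynomial ℚ) :=
    (Polynomial.X : Polynomial ℚ) • Polynomial.derivative'
  have hd (p : Polynomial ℚ) :
      algebraMap (Polynomial ℚ) ℚ⟦X⟧ (d p) = euler ℚ (algebraMap (Polynomial ℚ) ℚ⟦X⟧ p) := by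
    simp [halg, d, euler, derivative_coe]
  have hf : IsAlgebraic (Polynomial ℚ) f := by
    obtain ⟨P, hP, hPf⟩ := hf
    refine ⟨P, hP, ?_⟩
    rw [Polynomial.aeval_def, ← hPf]
    congr 1
  exact d.not_linearIndependent_iterate_of_isAlgebraic (euler ℚ) hd hf

/-- A nontrivial linear relation between the iterated Euler derivatives of `f` annihilates every
coefficient of large index which is preceded by a sufficiently long gap. -/
theorem exists_forall_coeff_eq_zero_of_not_linearIndependent {f : ℚ⟦X⟧}
    (hf : ¬ LinearIndependent (Polynomial ℚ) (fun i : ℕ => (euler ℚ)^[i] f)) :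
    ∃ N : ℕ, ∀ m ≥ N, (∀ l < m, m ≤ l + N → coeff l f = 0) → coeff m f = 0 := by
  obtain ⟨s, q, hrel, i₀, hi₀, hq₀⟩ := not_linearIndependent_iff.mp hf
  let p : ℕ → Polynomial ℚ := fun j => ∑ i ∈ s, Polynomial.monomial i ((q i).coeff j)
  have hp (j i : ℕ) (hi : i ∈ s) : (p j).coeff i = (q i).coeff j := by
    simp [p, Polynomial.coeff_monomial, hi]
  have hex : ∃ j, p j ≠ 0 := by
    obtain ⟨j, hj⟩ := Polynomial.ext_iff.not.mp hq₀ |> not_forall.mp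
    refine ⟨j, fun h => hj ?_⟩
    rw [← hp j i₀ hi₀, h]
    simp
  classical
  let j₀ := Nat.find hex
  have hj₀ : p j₀ ≠ 0 := Nat.find_spec hex
  have hlt : ∀ j < j₀, p j = 0 := fun j hj => not_not.mp (Nat.find_min hex hj)
  let M := s.sup fun i => (q i).natDegree
  have hM : ∀ j, M < j → p j = 0 := fun j hj => Finset.sum_eq_zero fun i hi => by
    rw [Polynomial.coeff_eq_zero_of_natDegree_lt, map_zero]
    exact (Finset.le_sup (f := fun i => (q i).natDegree) hi).trans_lt hj
  have hcoeff (n : ℕ) :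
      ∑ x ∈ Finset.HasAntidiagonal.antidiagonal n, (p x.1).eval (x.2 : ℚ) * coeff x.2 f = 0 := by
    have := congrArg (coeff n) hrel
    simp only [map_sum, Algebra.smul_def, algebraMap_apply', coeff_mul, coeff_iterate_euler,
      map_zero] at this
    rw [Finset.sum_comm] at this
    rw [← this]
    refine Finset.sum_congr rfl fun x _ => ?_
    simp [p, Polynomial.eval_finsetSum, Finset.sum_mul, mul_assoc]
  have hroots : ∃ N : ℕ, ∀ m : ℕ, N ≤ m → (p j₀).eval (m : ℚ) ≠ 0 := by
    obtain ⟨N, hN⟩ := ((p j₀).rootSet_finite ℚ |>.preimage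
      (Nat.cast_injective (R := ℚ)).injOn).bddAbove
    refine ⟨N + 1, fun m hm h => ?_⟩
    have : m ≤ N := hN (by simp [Polynomial.mem_rootSet, hj₀, h])
    omega
  obtain ⟨N, hN⟩ := hroots
  refine ⟨N + M, fun m hm hgap => ?_⟩
  have h := hcoeff (j₀ + m)
  rw [Finset.sum_eq_single (j₀, m)] at h
  · exact (mul_eq_zero.mp h).resolve_left (hN m (by omega))
  · rintro ⟨j, l⟩ hjl hne
    rw [Finset.HasAntidiagonal.mem_antidiagonal] at hjl
    simp only at hjl ⊢
    rcases lt_trichotomy j j₀ with hj | rfl | hj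
    · simp [hlt j hj]
    · exact absurd (by simp; omega) hne
    · by_cases hjM : M < j
      · simp [hM j hjM]
      · rw [hgap l (by omega) (by omega), mul_zero]
  · simp

end PowerSeries

/-- **Mahler.** Lacunary power series with nonnegative integer coefficients are transcendental:
if `(n k)` is a strictly increasing sequence of nonnegative integers with gaps
`n (k+1) − n k → ∞`, and `f = ∑ₖ c (n k) · t^(n k)` has positive integer coefficients
`c (n k)` at the exponents `n k` and zero coefficients elsewhere, then `f` is transcendental
over `ℚ(t)`. -/
theorem mahler_lacunary_transcendental (n : ℕ → ℕ) (hmono : StrictMono n)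
    (hgap : Filter.Tendsto (fun k => n (k + 1) - n k) Filter.atTop Filter.atTop)
    (c : ℕ → ℕ) (hpos : ∀ k, 0 < c (n k))
    (hsupp : ∀ m : ℕ, m ∉ Set.range n → c m = 0) :
    ¬ PSAlgebraic (PowerSeries.mk fun m => (c m : ℚ)) := by
  intro halg
  obtain ⟨N, hN⟩ := PowerSeries.exists_forall_coeff_eq_zero_of_not_linearIndependent
    (PowerSeries.not_linearIndependent_iterate_euler halg)
  obtain ⟨k, hk⟩ := (hgap.eventually_gt_atTop N).exists
  have h := hN (n (k + 1)) (by omega) fun l hl hlN => by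
    rw [PowerSeries.coeff_mk, hsupp l, Nat.cast_zero]
    rintro ⟨j, rfl⟩
    have h1 : j ≤ k := Nat.lt_succ_iff.mp (hmono.lt_iff_lt.mp hl)
    have h2 := hmono.monotone h1
    omega
  rw [PowerSeries.coeff_mk, Nat.cast_eq_zero] at h
  exact (hpos (k + 1)).ne' h
end

section
/- (Bézivin) Let α : ℕ → ℕ be a multiplicative function with nonnegative integer values (α(mn) = α(m)·α(n) for all coprime m, n ≥ 1) such that its generating function a(t) = ∑_{n≥1} α(n) t^n is algebraic over ℚ(t). Then either α(n) = 0 for all sufficiently large n (i.e., a(t) is a polynomial), or there exist a nonnegative integer k and a multiplicative periodic function χ : ℕ → ℚ (i.e., χ(mn)=χ(m)χ(n) for coprime m,n, and χ(n+T)=χ(n) for some period T ≥ 1 and all n ≥ 1) such that α(n) = n^k·χ(n) for all n ≥ 1. -/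
/-- The Euler operator `t ↦ t · d/dt` on power series. -/
noncomputable def PowerSeries.euler_s9 : Derivation ℚ (PowerSeries ℚ) (PowerSeries ℚ) :=
  (PowerSeries.X : PowerSeries ℚ) • PowerSeries.derivative ℚ

theorem PowerSeries.coeff_euler_s9 (F : PowerSeries ℚ) (n : ℕ) :
    PowerSeries.coeff n (PowerSeries.euler_s9 F) = n * PowerSeries.coeff n F := by
  cases n with
  | zero => simp [PowerSeries.euler_s9]
  | succ n =>
    simp only [PowerSeries.euler_s9, Derivation.coe_smul, Pi.smul_apply, smul_eq_mul,
      PowerSeries.coeff_succ_X_mul, PowerSeries.coeff_derivative]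
    push_cast
    ring

theorem PowerSeries.coeff_euler_iterate (F : PowerSeries ℚ) (i n : ℕ) :
    PowerSeries.coeff n (PowerSeries.euler_s9^[i] F) = n ^ i * PowerSeries.coeff n F := by
  induction i with
  | zero => simp
  | succ i ih => rw [Function.iterate_succ_apply', coeff_euler_s9, ih]; ring

theorem PowerSeries.algebraMap_polynomial_eq_coe (p : Polynomial ℚ) :
    algebraMap (Polynomial ℚ) (PowerSeries ℚ) p = (p : PowerSeries ℚ) := by
  simp [PowerSeries.algebraMap_apply']

theorem PowerSeries.euler_coe (p : Polynomial ℚ) :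
    PowerSeries.euler_s9 (algebraMap (Polynomial ℚ) (PowerSeries ℚ) p) =
      algebraMap (Polynomial ℚ) (PowerSeries ℚ) (Polynomial.X * Polynomial.derivative p) := by
  simp [PowerSeries.euler_s9, algebraMap_polynomial_eq_coe, PowerSeries.derivative_coe]

theorem PowerSeries.exists_euler_aeval (F : PowerSeries ℚ) (G : Polynomial (Polynomial ℚ)) :
    ∃ H : Polynomial (Polynomial ℚ), PowerSeries.euler_s9 (Polynomial.aeval F G) =
      Polynomial.aeval F H + Polynomial.aeval F G.derivative * PowerSeries.euler_s9 F := by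
  induction G using Polynomial.induction_on' with
  | add p q hp hq =>
    obtain ⟨H₁, h₁⟩ := hp
    obtain ⟨H₂, h₂⟩ := hq
    refine ⟨H₁ + H₂, ?_⟩
    simp only [map_add, h₁, h₂]
    ring
  | monomial n a =>
    refine ⟨Polynomial.monomial n (Polynomial.X * Polynomial.derivative a), ?_⟩
    simp only [Polynomial.aeval_monomial, Derivation.leibniz, Derivation.leibniz_pow, euler_coe,
      Polynomial.derivative_monomial, smul_eq_mul, nsmul_eq_mul, map_mul, map_natCast]
    ring

instance : FaithfulSMul (Polynomial ℚ) (PowerSeries ℚ) := by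
  rw [faithfulSMul_iff_algebraMap_injective]
  intro p q h
  simpa only [PowerSeries.algebraMap_polynomial_eq_coe, Polynomial.coe_inj] using h

theorem exists_separable_annihilator {F : PowerSeries ℚ} (hF : PSAlgebraic F) :
    ∃ P : Polynomial (Polynomial ℚ), Polynomial.aeval F P = 0 ∧
      Polynomial.aeval F P.derivative ≠ 0 := by
  obtain ⟨P₀, hP₀, hP₀F⟩ := hF
  have hP₀F' : Polynomial.aeval F P₀ = 0 := by
    rw [Polynomial.aeval_def, ← hP₀F]
    congr 1
  obtain ⟨P, ⟨hP, hPF⟩, hmin⟩ := (measure (Polynomial.natDegree (R := Polynomial ℚ))).wf.has_min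
    {P | P ≠ 0 ∧ Polynomial.aeval F P = 0} ⟨P₀, hP₀, hP₀F'⟩
  refine ⟨P, hPF, fun h => ?_⟩
  have hdeg : P.natDegree ≠ 0 := by
    intro h0
    rw [Polynomial.eq_C_of_natDegree_eq_zero h0, Polynomial.aeval_C,
      PowerSeries.algebraMap_polynomial_eq_coe, Polynomial.coe_eq_zero_iff] at hPF
    apply hP
    rw [Polynomial.eq_C_of_natDegree_eq_zero h0, hPF, Polynomial.C_0]
  refine hmin P.derivative ⟨fun h0 => hdeg (Polynomial.derivative_eq_zero.1 h0),
    h⟩ ?_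
  exact Polynomial.natDegree_derivative_lt hdeg

/-- The elements of a domain that are rational functions of a fixed algebraic element span a
module of finite rank over the base ring. -/
theorem exists_linear_relation_of_rational_in_algebraic {R A : Type*} [CommRing R] [IsDomain R]
    [CommRing A] [IsDomain A] [Algebra R A] [FaithfulSMul R A] {F : A} (hF : IsAlgebraic R F)
    {y : ℕ → A} (hy : ∀ i, ∃ G H : Polynomial R, Polynomial.aeval F H ≠ 0 ∧
      Polynomial.aeval F H * y i = Polynomial.aeval F G) :
    ∃ (d : ℕ) (c : Fin d → R), c ≠ 0 ∧ ∑ i, c i • y i = 0 := by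
  have : FaithfulSMul R (FractionRing A) := FaithfulSMul.trans R A (FractionRing A)
  let := FractionRing.liftAlgebra R (FractionRing A)
  let ι := algebraMap A (FractionRing A)
  let E := IntermediateField.adjoin (FractionRing R) {ι F}
  have hFE : ι F ∈ E := IntermediateField.mem_adjoin_simple_self _ _
  have hinj : Function.Injective ι := IsFractionRing.injective A (FractionRing A)
  have hint : IsIntegral (FractionRing R) (ι F) :=
    ((hF.algebraMap (A := FractionRing A)).extendScalars
      (IsFractionRing.injective R (FractionRing R))).isIntegral
  have hmem (G : Polynomial R) : ι (Polynomial.aeval F G) ∈ E := by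
    rw [← Polynomial.aeval_algebraMap_apply, ← Polynomial.aeval_map_algebraMap (FractionRing R)]
    exact IntermediateField.algebra_adjoin_le_adjoin _ _ (Polynomial.aeval_mem_adjoin_singleton _ _)
  have hyE (i : ℕ) : ι (y i) ∈ E := by
    obtain ⟨G, H, hH, h⟩ := hy i
    have h0 : ι (Polynomial.aeval F H) ≠ 0 := by simpa [ι] using hH
    have : ι (y i) = ι (Polynomial.aeval F G) / ι (Polynomial.aeval F H) := by
      rw [eq_div_iff h0, ← h, map_mul, mul_comm]
    rw [this]
    exact E.div_mem (hmem G) (hmem H)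
  have : FiniteDimensional (FractionRing R) E := IntermediateField.adjoin.finiteDimensional hint
  let d := Module.finrank (FractionRing R) E + 1
  have hdep : ¬ LinearIndependent R (fun i : Fin d => ι (y i)) := by
    rw [LinearIndependent.iff_fractionRing R (FractionRing R)]
    intro h
    have h2 : LinearIndependent (FractionRing R) (fun i : Fin d => (⟨ι (y i), hyE i⟩ : E)) :=
      LinearIndependent.of_comp E.val.toLinearMap h
    have := h2.fintype_card_le_finrank
    simp [d] at this
  rw [Fintype.not_linearIndependent_iff] at hdep
  obtain ⟨c, hc, i, hi⟩ := hdep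
  refine ⟨d, c, fun h => hi (by simp [h]), hinj ?_⟩
  simpa [ι, Algebra.smul_def, IsScalarTower.algebraMap_apply R A (FractionRing A)] using hc

/-- An algebraic power series satisfies a linear differential equation. -/
theorem exists_euler_relation {F : PowerSeries ℚ} (hF : PSAlgebraic F) :
    ∃ (d : ℕ) (c : Fin d → Polynomial ℚ), c ≠ 0 ∧
      ∑ i, c i • PowerSeries.euler_s9^[i] F = 0 := by
  obtain ⟨P, hP, hP'⟩ := exists_separable_annihilator hF
  have halg : IsAlgebraic (Polynomial ℚ) F := by
    refine ⟨P, fun h => hP' ?_, hP⟩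
    simp [h]
  refine exists_linear_relation_of_rational_in_algebraic halg
    (y := fun i => PowerSeries.euler_s9^[i] F) fun i => ?_
  induction i with
  | zero => exact ⟨Polynomial.X, 1, by simp, by simp⟩
  | succ i ih =>
    obtain ⟨G, H, hH, h⟩ := ih
    obtain ⟨P₁, hP₁⟩ := PowerSeries.exists_euler_aeval F P
    obtain ⟨G₁, hG₁⟩ := PowerSeries.exists_euler_aeval F G
    obtain ⟨H₁, hH₁⟩ := PowerSeries.exists_euler_aeval F H
    rw [hP, map_zero] at hP₁
    have h' := congrArg PowerSeries.euler_s9 h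
    rw [Derivation.leibniz, hG₁, hH₁] at h'
    simp only [smul_eq_mul] at h'
    refine ⟨P.derivative * (G₁ * H - H₁ * G) - P₁ * (G.derivative * H - H.derivative * G),
      P.derivative * H ^ 2, ?_, ?_⟩
    · rw [map_mul, map_pow]
      exact mul_ne_zero hP' (pow_ne_zero 2 hH)
    · rw [Function.iterate_succ_apply']
      simp only [map_mul, map_sub, map_pow]
      linear_combination (Polynomial.aeval F P.derivative * Polynomial.aeval F H) * h' -
        (Polynomial.aeval F P.derivative * (Polynomial.aeval F H₁ +
          Polynomial.aeval F H.derivative * PowerSeries.euler_s9 F)) * h -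
        (Polynomial.aeval F G.derivative * Polynomial.aeval F H -
          Polynomial.aeval F H.derivative * Polynomial.aeval F G) * hP₁

theorem Polynomial.exists_pos_le_abs_eval {p : Polynomial ℚ} (hp : p ≠ 0) :
    ∃ δ : ℚ, 0 < δ ∧ ∃ N : ℕ, ∀ m : ℕ, N ≤ m → δ ≤ |p.eval (m : ℚ)| := by
  rcases eq_or_ne p.natDegree 0 with h | h
  · rw [Polynomial.eq_C_of_natDegree_eq_zero h] at hp ⊢
    have h0 : p.coeff 0 ≠ 0 := by simpa using hp
    exact ⟨|p.coeff 0|, abs_pos.2 h0, 0, fun m _ => by simp⟩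
  · have ht := (p.abs_tendsto_atTop (Polynomial.natDegree_pos_iff_degree_pos.1
      (Nat.pos_of_ne_zero h))).comp (tendsto_natCast_atTop_atTop (R := ℚ))
    obtain ⟨N, hN⟩ := Filter.eventually_atTop.1 (ht.eventually_ge_atTop 1)
    exact ⟨1, one_pos, N, hN⟩

theorem Polynomial.exists_abs_eval_le_pow (p : Polynomial ℚ) :
    ∃ s N : ℕ, ∀ m : ℕ, N ≤ m → ∀ k : ℕ, k ≤ m → |p.eval (k : ℚ)| ≤ (m : ℚ) ^ s := by
  obtain ⟨N, hN⟩ := exists_nat_ge (∑ i ∈ Finset.range (p.natDegree + 1), |p.coeff i|)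
  refine ⟨p.natDegree + 1, N + 1, fun m hm k hk => ?_⟩
  have hm1 : (1 : ℚ) ≤ m := by exact_mod_cast (by omega : 1 ≤ m)
  rw [Polynomial.eval_eq_sum_range]
  calc |∑ i ∈ Finset.range (p.natDegree + 1), p.coeff i * (k : ℚ) ^ i|
      ≤ ∑ i ∈ Finset.range (p.natDegree + 1), |p.coeff i * (k : ℚ) ^ i| :=
        Finset.abs_sum_le_sum_abs _ _
    _ ≤ ∑ i ∈ Finset.range (p.natDegree + 1), |p.coeff i| * (m : ℚ) ^ p.natDegree := by
        refine Finset.sum_le_sum fun i hi => ?_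
        rw [abs_mul, abs_pow, Nat.abs_cast]
        refine mul_le_mul_of_nonneg_left ?_ (abs_nonneg _)
        calc (k : ℚ) ^ i ≤ (m : ℚ) ^ i := by gcongr
          _ ≤ _ := pow_le_pow_right₀ hm1 (by simpa [Nat.lt_succ_iff] using hi)
    _ = (∑ i ∈ Finset.range (p.natDegree + 1), |p.coeff i|) * (m : ℚ) ^ p.natDegree := by
        rw [Finset.sum_mul]
    _ ≤ m * (m : ℚ) ^ p.natDegree := by
        gcongr
        exact hN.trans (by exact_mod_cast (by omega : N ≤ m))
    _ = (m : ℚ) ^ (p.natDegree + 1) := by ring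

theorem exists_recurrence_of_euler_relation {F : PowerSeries ℚ} {d : ℕ} {c : Fin d → Polynomial ℚ}
    (hc : c ≠ 0) (h : ∑ i, c i • PowerSeries.euler_s9^[i] F = 0) :
    ∃ (D : ℕ) (p : ℕ → Polynomial ℚ), p 0 ≠ 0 ∧ ∀ m, D ≤ m →
      ∑ b ∈ Finset.range (D + 1),
        (p b).eval ((m - b : ℕ) : ℚ) * PowerSeries.coeff (m - b) F = 0 := by
  let p : ℕ → Polynomial ℚ := fun a =>
    ∑ i : Fin d, Polynomial.C ((c i).coeff a) * Polynomial.X ^ (i : ℕ)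
  have hcoeff (n : ℕ) : ∑ a ∈ Finset.range (n + 1),
      (p a).eval ((n - a : ℕ) : ℚ) * PowerSeries.coeff (n - a) F = 0 := by
    have hn := congrArg (PowerSeries.coeff n) h
    simp only [map_sum, Algebra.smul_def, PowerSeries.algebraMap_polynomial_eq_coe,
      PowerSeries.coeff_mul, PowerSeries.coeff_euler_iterate, Polynomial.coeff_coe, map_zero] at hn
    rw [← hn, Finset.sum_comm, Finset.Nat.sum_antidiagonal_eq_sum_range_succ_mk]
    refine Finset.sum_congr rfl fun a _ => ?_
    simp only [p, Polynomial.eval_finsetSum, Finset.sum_mul]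
    refine Finset.sum_congr rfl fun i _ => ?_
    simp [mul_assoc]
  have hp : ∃ a, p a ≠ 0 := by
    by_contra! hp
    refine hc (funext fun i => Polynomial.ext fun a => ?_)
    have := congrArg (Polynomial.coeff · i) (hp a)
    simpa [p, Polynomial.finsetSum_coeff, Polynomial.coeff_X_pow, Fin.val_inj] using this
  have hlarge : ∀ a, (∑ i, (c i).natDegree) < a → p a = 0 := by
    intro a ha
    refine Finset.sum_eq_zero fun i _ => ?_
    rw [Polynomial.coeff_eq_zero_of_natDegree_lt, Polynomial.C_0, zero_mul]
    exact (Finset.single_le_sum (f := fun i => (c i).natDegree) (fun _ _ => Nat.zero_le _)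
      (Finset.mem_univ i)).trans_lt ha
  classical
  set a₀ := Nat.find hp with ha₀
  refine ⟨∑ i, (c i).natDegree, fun b => p (a₀ + b), Nat.find_spec hp, fun m hm => ?_⟩
  rw [← hcoeff (a₀ + m)]
  have h1 : ∑ b ∈ Finset.range (∑ i, (c i).natDegree + 1),
        (p (a₀ + b)).eval ((m - b : ℕ) : ℚ) * PowerSeries.coeff (m - b) F =
      ∑ b ∈ Finset.range (m + 1),
        (p (a₀ + b)).eval ((m - b : ℕ) : ℚ) * PowerSeries.coeff (m - b) F := by
    refine Finset.sum_subset (Finset.range_mono (by omega)) fun b _ hb => ?_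
    rw [hlarge (a₀ + b) (by simp at hb; omega)]
    simp
  rw [h1, add_assoc a₀, Finset.sum_range_add _ a₀, Finset.sum_eq_zero (s := Finset.range a₀),
    zero_add]
  · refine Finset.sum_congr rfl fun b _ => ?_
    rw [Nat.add_sub_add_left]
  · intro a ha
    have := Nat.find_min hp (Finset.mem_range.1 ha)
    rw [not_not] at this
    simp [this]

/-- Coefficients of an algebraic power series are dominated by polynomial multiples of
preceding ones. -/
theorem exists_abs_coeff_le_of_algebraic {F : PowerSeries ℚ} (hF : PSAlgebraic F) :
    ∃ D s N : ℕ, ∀ m, N ≤ m → ∃ b, 1 ≤ b ∧ b ≤ D ∧ b < m ∧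
      |PowerSeries.coeff m F| ≤ (m : ℚ) ^ s * |PowerSeries.coeff (m - b) F| := by
  obtain ⟨d, c, hc, hrel⟩ := exists_euler_relation hF
  obtain ⟨D, p, hp, hrec⟩ := exists_recurrence_of_euler_relation hc hrel
  obtain ⟨δ, hδ, N₀, hN₀⟩ := Polynomial.exists_pos_le_abs_eval hp
  choose s N hsN using fun b => Polynomial.exists_abs_eval_le_pow (p b)
  obtain ⟨N₁, hN₁⟩ := exists_nat_ge (δ⁻¹ * (D + 1))
  set s' := ∑ b ∈ Finset.range (D + 1), s b with hs'
  set N' := ∑ b ∈ Finset.range (D + 1), N b with hN'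
  refine ⟨D + 1, s' + 1, N₀ + N₁ + N' + D + 2, fun m hm => ?_⟩
  obtain ⟨b, hb, hmax⟩ := (Finset.Icc 1 (D + 1)).exists_max_image
    (fun b => |PowerSeries.coeff (m - b) F|) ⟨1, by simp⟩
  rw [Finset.mem_Icc] at hb
  refine ⟨b, hb.1, hb.2, by omega, ?_⟩
  have hm1 : (1 : ℚ) ≤ m := by exact_mod_cast (by omega : 1 ≤ m)
  have hr := hrec m (by omega)
  rw [Finset.sum_range_succ', add_eq_zero_iff_eq_neg'] at hr
  simp only [Nat.sub_zero] at hr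
  have hle : δ * |PowerSeries.coeff m F| ≤
      (D + 1) * ((m : ℚ) ^ s' * |PowerSeries.coeff (m - b) F|) := by
    calc δ * |PowerSeries.coeff m F|
        ≤ |(p 0).eval (m : ℚ)| * |PowerSeries.coeff m F| := by
          gcongr
          exact hN₀ m (by omega)
      _ ≤ ∑ i ∈ Finset.range D, |(p (i + 1)).eval ((m - (i + 1) : ℕ) : ℚ) *
          PowerSeries.coeff (m - (i + 1)) F| := by
          rw [← abs_mul, hr, abs_neg]
          exact Finset.abs_sum_le_sum_abs _ _
      _ ≤ ∑ i ∈ Finset.range D, (m : ℚ) ^ s' * |PowerSeries.coeff (m - b) F| := by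
          refine Finset.sum_le_sum fun i hi => ?_
          rw [Finset.mem_range] at hi
          have hi' : i + 1 ∈ Finset.range (D + 1) := by simpa using hi
          rw [abs_mul]
          refine mul_le_mul ?_ (hmax (i + 1) (by simp; omega)) (abs_nonneg _) (by positivity)
          · refine (hsN (i + 1) m ?_ _ (Nat.sub_le _ _)).trans
              (pow_le_pow_right₀ hm1 (Finset.single_le_sum (fun _ _ => Nat.zero_le _) hi'))
            have := Finset.single_le_sum (f := N) (fun _ _ => Nat.zero_le _) hi'
            omega
      _ = D * ((m : ℚ) ^ s' * |PowerSeries.coeff (m - b) F|) := by simp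
      _ ≤ _ := by
          gcongr
          simp
  calc |PowerSeries.coeff m F| = δ⁻¹ * (δ * |PowerSeries.coeff m F|) := by field_simp
    _ ≤ δ⁻¹ * ((D + 1) * ((m : ℚ) ^ s' * |PowerSeries.coeff (m - b) F|)) := by gcongr
    _ = (δ⁻¹ * (D + 1)) * ((m : ℚ) ^ s' * |PowerSeries.coeff (m - b) F|) := by ring
    _ ≤ m * ((m : ℚ) ^ s' * |PowerSeries.coeff (m - b) F|) := by
        gcongr
        exact hN₁.trans (by exact_mod_cast (by omega : N₁ ≤ m))
    _ = _ := by ring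

/-- Any `D` consecutive residues can be forced to split off a coprime factor from a bounded set. -/
theorem exists_window_of_coprime_factors (D : ℕ) :
    ∃ (M : ℕ) (S : Finset ℕ), ∀ n, M ≤ n → ∃ w, w ≤ n ∧ n ≤ w + M ∧
      ∀ u, w ≤ u → u < w + D → ∃ q ∈ S, ∃ b, 2 ≤ q ∧ u = q * b ∧ Nat.Coprime q b := by
  let q : ℕ → ℕ := Nat.nth Nat.Prime
  have hq (j : ℕ) : (q j).Prime := Nat.prime_nth_prime j
  have hpos (j : ℕ) : 0 < q j ^ 2 := pow_pos (hq j).pos 2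
  have hpair : Set.Pairwise (Finset.range D : Set ℕ)
      (Function.onFun Nat.Coprime fun j => q j ^ 2) := by
    intro i _ j _ hij
    refine Nat.Coprime.pow 2 2 ((Nat.coprime_primes (hq i) (hq j)).2 fun h => hij ?_)
    exact Nat.nth_injective Nat.infinite_setOfPred_prime h
  let k := Nat.chineseRemainderOfFinset (fun j => q j + q j ^ 2 * j - j) (fun j => q j ^ 2)
    (Finset.range D) (fun j _ => (hpos j).ne') hpair
  have hkM : (k : ℕ) < ∏ j ∈ Finset.range D, q j ^ 2 :=
    Nat.chineseRemainderOfFinset_lt_prod _ _ (fun j _ => (hpos j).ne') hpair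
  set M := ∏ j ∈ Finset.range D, q j ^ 2 with hM
  refine ⟨M, (Finset.range D).image q, fun n hn => ⟨k + M * ((n - k) / M), ?_, ?_, ?_⟩⟩
  · have := Nat.mul_div_le (n - k) M
    omega
  · have := Nat.lt_mul_div_succ (n - k) (by omega : 0 < M)
    rw [mul_add] at this
    omega
  · intro u hu1 hu2
    obtain ⟨j, rfl⟩ := Nat.exists_eq_add_of_le hu1
    have hj : j ∈ Finset.range D := Finset.mem_range.2 (by omega)
    have hjle : j ≤ q j + q j ^ 2 * j := by
      have := Nat.le_mul_of_pos_left j (hpos j)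
      omega
    have hdvd : q j ^ 2 ∣ M := Finset.dvd_prod_of_mem (fun j => q j ^ 2) hj
    have hmod : k + M * ((n - k) / M) + j ≡ q j [MOD q j ^ 2] := by
      have h1 : M * ((n - k) / M) ≡ 0 [MOD q j ^ 2] :=
        (Nat.modEq_zero_iff_dvd.2 (hdvd.mul_right _))
      have h2 := ((k.2 j hj).add h1).add_right j
      rw [add_zero, Nat.sub_add_cancel hjle] at h2
      refine h2.trans ?_
      simp [Nat.ModEq]
    have hdiv : q j ∣ k + M * ((n - k) / M) + j :=
      ((hmod.of_dvd (dvd_pow_self _ two_ne_zero)).dvd_iff dvd_rfl).2 dvd_rfl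
    obtain ⟨b, hb⟩ := hdiv
    refine ⟨q j, Finset.mem_image_of_mem q hj, b, (hq j).two_le, hb, ?_⟩
    rw [(hq j).coprime_iff_not_dvd]
    intro hqb
    have h3 : q j ^ 2 ∣ q j := by
      rw [hb] at hmod
      refine (hmod.dvd_iff dvd_rfl).1 ?_
      rw [pow_two]
      exact mul_dvd_mul_left _ hqb
    have h4 := Nat.le_of_dvd (hq j).pos h3
    have := (hq j).two_le
    nlinarith

/-- A multiplicative function dominated by polynomial multiples of its bounded past grows
subexponentially. -/
theorem subexponential_of_recurrence {α : ℕ → ℕ}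
    (hmul : ∀ m n : ℕ, 1 ≤ m → 1 ≤ n → Nat.Coprime m n → α (m * n) = α m * α n)
    {D s N : ℕ}
    (hrec : ∀ m, N ≤ m → ∃ b, 1 ≤ b ∧ b ≤ D ∧ b ≤ m ∧ α m ≤ m ^ s * α (m - b))
    {C : ℝ} (hC : 1 < C) : ∃ A : ℝ, ∀ n, 1 ≤ n → (α n : ℝ) ≤ A * C ^ n := by
  obtain ⟨c, hc, rfl⟩ : ∃ c : ℝ, 1 < c ∧ c ^ 2 = C :=
    ⟨√C, by rwa [Real.lt_sqrt zero_le_one, one_pow], Real.sq_sqrt (by linarith)⟩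
  have hc0 : 0 < c := by linarith
  obtain ⟨M, S, hw⟩ := exists_window_of_coprime_factors D
  set B : ℝ := ∑ q ∈ S, (α q : ℝ) with hB
  have hB0 : 0 ≤ B := Finset.sum_nonneg fun _ _ => Nat.cast_nonneg _
  have hBle : ∀ q ∈ S, (α q : ℝ) ≤ B := fun q hq =>
    Finset.single_le_sum (f := fun q => (α q : ℝ)) (fun _ _ => Nat.cast_nonneg _) hq
  obtain ⟨n₁, hn₁⟩ : ∃ n₁ : ℕ, ∀ n : ℕ, n₁ ≤ n → (n : ℝ) ^ (s * M) * B ≤ c ^ n := by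
    have h := (tendsto_pow_const_div_const_pow_of_one_lt (s * M) hc).mul_const B
    rw [zero_mul] at h
    obtain ⟨n₁, h₁⟩ := Filter.eventually_atTop.1 (h.eventually_le_const zero_lt_one)
    refine ⟨n₁, fun n hn => ?_⟩
    have := h₁ n hn
    rwa [div_mul_eq_mul_div, div_le_one (pow_pos hc0 n)] at this
  set n₀ := n₁ + M + N + 1 with hn₀
  set A : ℝ := ∑ n ∈ Finset.range n₀, (α n : ℝ) with hA
  have hA0 : 0 ≤ A := Finset.sum_nonneg fun _ _ => Nat.cast_nonneg _
  refine ⟨A, fun n => ?_⟩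
  induction n using Nat.strong_induction_on with
  | _ n ih =>
  intro hn
  rcases lt_or_ge n n₀ with hlt | hge
  · calc (α n : ℝ) ≤ A := Finset.single_le_sum (f := fun n => (α n : ℝ))
          (fun _ _ => Nat.cast_nonneg _) (Finset.mem_range.2 hlt)
      _ ≤ A * (c ^ 2) ^ n := le_mul_of_one_le_right hA0 (one_le_pow₀ hC.le)
  · obtain ⟨w, hwn, hnw, hwin⟩ := hw n (by omega)
    have hn1 : (1 : ℝ) ≤ (n : ℝ) ^ s := one_le_pow₀ (by exact_mod_cast hn)
    have claim : ∀ u, w ≤ u → u ≤ n → (α u : ℝ) ≤ ((n : ℝ) ^ s) ^ (u - w) * (B * A * c ^ n) := by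
      intro u
      induction u using Nat.strong_induction_on with
      | _ u ihu =>
      intro hwu hun
      rcases lt_or_ge u (w + D) with hu | hu
      · obtain ⟨q, hqS, b, hq2, rfl, hcop⟩ := hwin u hwu hu
        have hb : 1 ≤ b := by
          rcases Nat.eq_zero_or_pos b with rfl | h
          · omega
          · exact h
        have hqb : 2 * b ≤ q * b := Nat.mul_le_mul_right b hq2
        have h1 : (α b : ℝ) ≤ A * c ^ n := by
          refine (ih b (by omega) hb).trans ?_
          rw [← pow_mul]
          gcongr
          · exact hc.le
          · omega
        rw [hmul q b (by omega) hb hcop]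
        push_cast
        calc (α q : ℝ) * α b ≤ B * (A * c ^ n) := by
              gcongr
              exact hBle q hqS
          _ = B * A * c ^ n := by ring
          _ ≤ _ := le_mul_of_one_le_left (by positivity) (one_le_pow₀ hn1)
      · obtain ⟨b, hb1, hbD, hbu, hle⟩ := hrec u (by omega)
        have h1 := ihu (u - b) (by omega) (by omega) (by omega)
        have h2 : (α u : ℝ) ≤ (u : ℝ) ^ s * α (u - b) := by exact_mod_cast hle
        calc (α u : ℝ) ≤ (u : ℝ) ^ s * α (u - b) := h2
          _ ≤ (n : ℝ) ^ s * (((n : ℝ) ^ s) ^ (u - b - w) * (B * A * c ^ n)) := by gcongr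
          _ = ((n : ℝ) ^ s) ^ (u - b - w + 1) * (B * A * c ^ n) := by ring
          _ ≤ _ := by
            gcongr
            omega
    calc (α n : ℝ) ≤ ((n : ℝ) ^ s) ^ (n - w) * (B * A * c ^ n) := claim n hwn le_rfl
      _ ≤ ((n : ℝ) ^ s) ^ M * (B * A * c ^ n) := by
        gcongr
        omega
      _ = ((n : ℝ) ^ (s * M) * B) * (A * c ^ n) := by rw [pow_mul]; ring
      _ ≤ c ^ n * (A * c ^ n) := by
        gcongr
        exact hn₁ n (by omega)
      _ = A * (c ^ 2) ^ n := by ring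

/-- `F.HasValue x v` means that the complex power series `F` converges absolutely at `x`
with sum `v`. -/
def PowerSeries.HasValue (F : PowerSeries ℂ) (x v : ℂ) : Prop :=
  (Summable fun n => ‖PowerSeries.coeff n F * x ^ n‖) ∧
    HasSum (fun n => PowerSeries.coeff n F * x ^ n) v

namespace PowerSeries.HasValue

variable {F G : PowerSeries ℂ} {x v w : ℂ}

theorem add (hF : F.HasValue x v) (hG : G.HasValue x w) : (F + G).HasValue x (v + w) := by
  have h (n : ℕ) : coeff n (F + G) * x ^ n = coeff n F * x ^ n + coeff n G * x ^ n := by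
    rw [map_add, add_mul]
  refine ⟨?_, by simpa only [h] using hF.2.add hG.2⟩
  simp only [h]
  exact (hF.1.add hG.1).of_nonneg_of_le (fun _ => norm_nonneg _) fun n => norm_add_le _ _

theorem mul (hF : F.HasValue x v) (hG : G.HasValue x w) : (F * G).HasValue x (v * w) := by
  have h (n : ℕ) : coeff n (F * G) * x ^ n = ∑ kl ∈ Finset.HasAntidiagonal.antidiagonal n,
      (coeff kl.1 F * x ^ kl.1) * (coeff kl.2 G * x ^ kl.2) := by
    rw [coeff_mul, Finset.sum_mul]
    refine Finset.sum_congr rfl fun kl hkl => ?_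
    rw [← Finset.HasAntidiagonal.mem_antidiagonal.1 hkl, pow_add]
    ring
  have hs := summable_norm_sum_mul_antidiagonal_of_summable_norm hF.1 hG.1
  refine ⟨by simpa only [h] using hs, ?_⟩
  simp only [h]
  rw [← hF.2.tsum_eq, ← hG.2.tsum_eq,
    tsum_mul_tsum_eq_tsum_sum_antidiagonal_of_summable_norm hF.1 hG.1]
  exact hs.of_norm.hasSum

theorem coe_polynomial (p : Polynomial ℂ) (x : ℂ) :
    (p : PowerSeries ℂ).HasValue x (p.eval x) := by
  have h0 : ∀ n ∉ Finset.range (p.natDegree + 1),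
      coeff n (p : PowerSeries ℂ) * x ^ n = 0 := fun n hn => by
    rw [Polynomial.coeff_coe, Polynomial.coeff_eq_zero_of_natDegree_lt, zero_mul]
    have := Finset.mem_range.not.1 hn
    omega
  refine ⟨summable_of_ne_finset_zero fun n hn => by rw [h0 n hn, norm_zero], ?_⟩
  rw [Polynomial.eval_eq_sum_range]
  simpa only [Polynomial.coeff_coe] using hasSum_sum_of_ne_finset_zero h0

theorem pow (hF : F.HasValue x v) (n : ℕ) : (F ^ n).HasValue x (v ^ n) := by
  induction n with
  | zero => simpa using coe_polynomial 1 x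
  | succ n ih => simpa only [pow_succ] using ih.mul hF

theorem unique (hF : F.HasValue x v) (hG : F.HasValue x w) : v = w := hF.2.unique hG.2

theorem eval₂ (hF : F.HasValue x v) (P : Polynomial (Polynomial ℂ)) :
    (P.eval₂ Polynomial.coeToPowerSeries.ringHom F).HasValue x
      (P.eval₂ (Polynomial.evalRingHom x) v) := by
  induction P using Polynomial.induction_on' with
  | add p q hp hq => simpa only [Polynomial.eval₂_add] using hp.add hq
  | monomial n a =>
    simp only [Polynomial.eval₂_monomial]
    exact (coe_polynomial a x).mul (hF.pow n)

end PowerSeries.HasValue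

/-- Bessel's inequality for a bounded power series on the unit disk. -/
theorem sum_sq_norm_coeff_le_of_bounded {b : ℕ → ℂ} {C : ℝ} (hC : 0 ≤ C)
    (hs : ∀ x : ℂ, ‖x‖ < 1 → Summable fun n => ‖b n * x ^ n‖)
    (hb : ∀ x : ℂ, ‖x‖ < 1 → ‖∑' n, b n * x ^ n‖ ≤ C) (N : ℕ) :
    ∑ n ∈ Finset.range N, ‖b n‖ ^ 2 ≤ C ^ 2 := by
  have hfact : Fact (0 < (1 : ℝ)) := ⟨one_pos⟩
  have key (r : ℝ) (hr0 : 0 ≤ r) (hr1 : r < 1) :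
      ∑ n ∈ Finset.range N, (‖b n‖ * r ^ n) ^ 2 ≤ C ^ 2 := by
    let u : ℕ → C(AddCircle (1 : ℝ), ℂ) := fun n => (b n * (r : ℂ) ^ n) • fourier (n : ℤ)
    have hu : Summable u := by
      refine Summable.of_norm ?_
      have := hs r (by simpa [abs_of_nonneg hr0] using hr1)
      simpa [u, norm_smul, fourier_norm] using this
    let g := ∑' n, u n
    have hg : ‖g‖ ≤ C := by
      rw [ContinuousMap.norm_le _ hC]
      intro t
      have h1 : g t = ∑' n, u n t := (ContinuousMap.tsum_apply hu t).symm
      have h2 (n : ℕ) : u n t = b n * ((r : ℂ) * fourier 1 t) ^ n := by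
        simp [u, fourier_apply, mul_pow, mul_assoc, AddCircle.toCircle_nsmul]
      simp only [h1, h2]
      refine hb _ ?_
      rw [norm_mul, fourier_apply, Circle.norm_coe, mul_one, Complex.norm_real,
        Real.norm_of_nonneg hr0]
      exact hr1
    let Φ := ContinuousMap.toLp (E := ℂ) 2 (@AddCircle.haarAddCircle 1 hfact) ℂ
    have hΦ : ‖Φ g‖ ≤ C := by
      refine (ContinuousLinearMap.le_opNorm _ _).trans ?_
      have := ContinuousMap.toLp_norm_le (E := ℂ) (p := 2)
        (@AddCircle.haarAddCircle 1 hfact) (𝕜 := ℂ)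
      rw [MeasureTheory.measureUnivNNReal, MeasureTheory.measure_univ, ENNReal.toNNReal_one,
        NNReal.coe_one, Real.one_rpow] at this
      nlinarith [norm_nonneg g]
    have hsum : HasSum (fun n => (b n * (r : ℂ) ^ n) • fourierLp 2 (n : ℤ)) (Φ g) := by
      simpa [u] using hu.hasSum.mapL Φ
    have horth := (orthonormal_fourier (T := 1)).comp (fun n : ℕ => (n : ℤ)) Nat.cast_injective
    have hin (m : ℕ) : inner ℂ (fourierLp 2 (m : ℤ)) (Φ g) = b m * (r : ℂ) ^ m := by
      have h := hsum.mapL (innerSL ℂ (fourierLp (T := 1) 2 (m : ℤ)))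
      refine h.unique ((hasSum_ite_eq m (b m * (r : ℂ) ^ m)).congr_fun fun n => ?_)
      have := orthonormal_iff_ite.1 horth m n
      simp only [Function.comp_apply] at this
      simp only [innerSL_apply_apply, inner_smul_right, this]
      by_cases hmn : n = m
      · simp [hmn]
      · simp [hmn, Ne.symm hmn]
    have hbes := horth.sum_inner_products_le (x := Φ g) (s := Finset.range N)
    simp only [Function.comp_apply, hin, norm_mul, norm_pow, Complex.norm_real,
      Real.norm_of_nonneg hr0] at hbes
    exact hbes.trans (by gcongr)
  have hcont : Continuous fun r : ℝ => ∑ n ∈ Finset.range N, (‖b n‖ * r ^ n) ^ 2 := by fun_prop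
  have hlim : Filter.Tendsto (fun r : ℝ => ∑ n ∈ Finset.range N, (‖b n‖ * r ^ n) ^ 2)
      (nhdsWithin 1 (Set.Iio 1)) (nhds (∑ n ∈ Finset.range N, (‖b n‖ * 1 ^ n) ^ 2)) :=
    (hcont.tendsto 1).mono_left nhdsWithin_le_nhds
  simp only [one_pow, mul_one] at hlim
  refine le_of_tendsto hlim ?_
  filter_upwards [Ioo_mem_nhdsLT (zero_lt_one (α := ℝ))] with r hr
  exact key r hr.1.le hr.2

/-- A power series whose coefficients grow subexponentially converges on the unit disk. -/
theorem PowerSeries.HasValue.exists_of_subexponential {F : PowerSeries ℂ}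
    (h : ∀ C : ℝ, 1 < C → ∃ A : ℝ, ∀ n, ‖PowerSeries.coeff n F‖ ≤ A * C ^ n) {x : ℂ}
    (hx : ‖x‖ < 1) : ∃ v, F.HasValue x v := by
  obtain ⟨r, hxr, hr1⟩ := exists_between hx
  have hr0 : 0 < r := (norm_nonneg x).trans_lt hxr
  obtain ⟨A, hA⟩ := h r⁻¹ ((one_lt_inv₀ hr0).2 hr1)
  have hq : r⁻¹ * ‖x‖ < 1 := by
    rwa [inv_mul_lt_iff₀ hr0, mul_one]
  have hs : Summable fun n => ‖PowerSeries.coeff n F * x ^ n‖ := by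
    refine ((summable_geometric_of_lt_one (by positivity) hq).mul_left A).of_nonneg_of_le
      (fun _ => norm_nonneg _) fun n => ?_
    rw [norm_mul, norm_pow, mul_pow, ← mul_assoc]
    exact mul_le_mul_of_nonneg_right (hA n) (by positivity)
  exact ⟨_, hs, hs.of_norm.hasSum⟩

theorem norm_leading_mul_root_le {d : ℕ} {a : ℕ → ℂ} {v : ℂ} {M : ℝ} (hd : 1 ≤ d) (hM : 1 ≤ M)
    (ha : ∀ i ≤ d, ‖a i‖ ≤ M) (h : ∑ i ∈ Finset.range (d + 1), a i * v ^ i = 0) :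
    ‖a d * v‖ ≤ 1 + d * M ^ d := by
  have hM0 : 0 ≤ M := by linarith
  rcases le_or_gt ‖a d * v‖ 1 with h1 | h1
  · exact h1.trans (le_add_of_nonneg_right (by positivity))
  obtain ⟨e, rfl⟩ := Nat.exists_eq_add_of_le' hd
  set w := a (e + 1) * v with hw
  have hw0 : 0 < ‖w‖ := by linarith
  have heq : w ^ (e + 1) = -∑ i ∈ Finset.range (e + 1), a i * a (e + 1) ^ (e - i) * w ^ i := by
    rw [Finset.sum_range_succ] at h
    have h2 : a (e + 1) ^ e * (∑ i ∈ Finset.range (e + 1), a i * v ^ i) =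
        ∑ i ∈ Finset.range (e + 1), a i * a (e + 1) ^ (e - i) * w ^ i := by
      rw [Finset.mul_sum]
      refine Finset.sum_congr rfl fun i hi => ?_
      have hpow : a (e + 1) ^ e = a (e + 1) ^ (e - i) * a (e + 1) ^ i := by
        rw [← pow_add, Nat.sub_add_cancel (Nat.lt_succ_iff.1 (Finset.mem_range.1 hi))]
      rw [hw, mul_pow, hpow]
      ring
    rw [← h2, hw]
    linear_combination a (e + 1) ^ e * h
  have hle : ‖w‖ ^ (e + 1) ≤ ((e + 1 : ℕ) * M ^ (e + 1)) * ‖w‖ ^ e := by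
    rw [← norm_pow, heq, norm_neg]
    refine (norm_sum_le _ _).trans ?_
    calc ∑ i ∈ Finset.range (e + 1), ‖a i * a (e + 1) ^ (e - i) * w ^ i‖
        ≤ ∑ i ∈ Finset.range (e + 1), M ^ (e + 1) * ‖w‖ ^ e := by
          refine Finset.sum_le_sum fun i hi => ?_
          have hi' : i ≤ e := Nat.lt_succ_iff.1 (Finset.mem_range.1 hi)
          rw [norm_mul, norm_mul, norm_pow, norm_pow]
          calc ‖a i‖ * ‖a (e + 1)‖ ^ (e - i) * ‖w‖ ^ i
              ≤ M * M ^ (e - i) * ‖w‖ ^ e := by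
                gcongr
                · exact ha i (by omega)
                · exact ha _ le_rfl
                · exact h1.le
            _ ≤ M * M ^ e * ‖w‖ ^ e := by
                gcongr
                omega
            _ = _ := by ring
      _ = _ := by simp [mul_assoc]
  rw [pow_succ', mul_le_mul_iff_left₀ (pow_pos hw0 e)] at hle
  linarith

theorem Polynomial.norm_eval_le_sum_norm_coeff (p : Polynomial ℂ) {x : ℂ} (hx : ‖x‖ ≤ 1) :
    ‖p.eval x‖ ≤ ∑ i ∈ Finset.range (p.natDegree + 1), ‖p.coeff i‖ := by
  rw [Polynomial.eval_eq_sum_range]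
  refine (norm_sum_le _ _).trans (Finset.sum_le_sum fun i _ => ?_)
  rw [norm_mul, norm_pow]
  exact mul_le_of_le_one_right (norm_nonneg _) (pow_le_one₀ (norm_nonneg _) hx)

theorem PowerSeries.eq_coe_trunc_of_eventually_zero {R : Type*} [CommSemiring R]
    {F : PowerSeries R} {N : ℕ} (h : ∀ n, N ≤ n → PowerSeries.coeff n F = 0) :
    F = (PowerSeries.trunc N F : PowerSeries R) := by
  ext n
  rw [Polynomial.coeff_coe, PowerSeries.coeff_trunc]
  split_ifs with hn
  · rfl
  · exact h n (not_lt.1 hn)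

/-- An algebraic power series converging on the unit disk becomes bounded there after
multiplication with a suitable nonzero polynomial. -/
theorem exists_bounded_multiple_of_algebraic {F : PowerSeries ℚ} (hF : PSAlgebraic F)
    (hconv : ∀ x : ℂ, ‖x‖ < 1 → ∃ v, (F.map (algebraMap ℚ ℂ)).HasValue x v) :
    ∃ (Q : Polynomial ℚ) (C : ℝ), Q ≠ 0 ∧ 0 ≤ C ∧ ∀ x : ℂ, ‖x‖ < 1 → ∃ v,
      ((Q * F : PowerSeries ℚ).map (algebraMap ℚ ℂ)).HasValue x v ∧ ‖v‖ ≤ C := by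
  obtain ⟨P, hP, hPF⟩ := hF
  set d := P.natDegree with hd
  have hd1 : 1 ≤ d := by
    by_contra! h0
    have h0' : P.natDegree = 0 := by omega
    rw [Polynomial.eq_C_of_natDegree_eq_zero h0', Polynomial.eval₂_C,
      Polynomial.coeToPowerSeries.ringHom_apply, Polynomial.coe_eq_zero_iff] at hPF
    apply hP
    rw [Polynomial.eq_C_of_natDegree_eq_zero h0', hPF, Polynomial.C_0]
  let a : ℕ → Polynomial ℂ := fun i => (P.coeff i).map (algebraMap ℚ ℂ)
  let M : ℝ := 1 + ∑ i ∈ Finset.range (d + 1),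
    ∑ j ∈ Finset.range ((a i).natDegree + 1), ‖(a i).coeff j‖
  have hM : ∀ i ≤ d, ∀ x : ℂ, ‖x‖ < 1 → ‖(a i).eval x‖ ≤ M := fun i hi x hx => by
    refine ((a i).norm_eval_le_sum_norm_coeff hx.le).trans ?_
    refine le_trans ?_ (le_add_of_nonneg_left zero_le_one)
    exact Finset.single_le_sum
      (f := fun i => ∑ j ∈ Finset.range ((a i).natDegree + 1), ‖(a i).coeff j‖)
      (fun _ _ => Finset.sum_nonneg fun _ _ => norm_nonneg _) (Finset.mem_range.2 (by omega))
  have hM1 : 1 ≤ M := le_add_of_nonneg_right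
    (Finset.sum_nonneg fun _ _ => Finset.sum_nonneg fun _ _ => norm_nonneg _)
  refine ⟨P.leadingCoeff, 1 + d * M ^ d, Polynomial.leadingCoeff_ne_zero.2 hP, by positivity,
    fun x hx => ?_⟩
  obtain ⟨v, hv⟩ := hconv x hx
  refine ⟨(a d).eval x * v, ?_, ?_⟩
  · rw [map_mul, ← Polynomial.polynomial_map_coe]
    exact (PowerSeries.HasValue.coe_polynomial _ x).mul hv
  · refine norm_leading_mul_root_le (a := fun i => (a i).eval x) hd1 hM1
      (fun i hi => hM i hi x hx) ?_
    have h0 := congrArg (PowerSeries.map (algebraMap ℚ ℂ)) hPF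
    have hcomp : (PowerSeries.map (algebraMap ℚ ℂ)).comp Polynomial.coeToPowerSeries.ringHom =
        (Polynomial.coeToPowerSeries.ringHom).comp
          (Polynomial.mapRingHom (algebraMap ℚ ℂ)) := by
      refine RingHom.ext fun p => ?_
      simp [Polynomial.polynomial_map_coe]
    rw [Polynomial.hom_eval₂, hcomp, ← Polynomial.eval₂_map, map_zero] at h0
    have h1 := hv.eval₂ (P.map (Polynomial.mapRingHom (algebraMap ℚ ℂ)))
    rw [h0] at h1
    have h2 : (0 : PowerSeries ℂ).HasValue x 0 := by
      simpa using PowerSeries.HasValue.coe_polynomial 0 x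
    have h3 := h1.unique h2
    rw [Polynomial.eval₂_map, Polynomial.eval₂_eq_sum_range] at h3
    simpa [a] using h3

/-- **Fatou.** An algebraic power series with integer coefficients converging on the unit disk
is rational. -/
theorem rational_of_algebraic_of_convergent {F : PowerSeries ℤ}
    (hF : PSAlgebraic (F.map (Int.castRingHom ℚ)))
    (hconv : ∀ x : ℂ, ‖x‖ < 1 → ∃ v, (F.map (Int.castRingHom ℂ)).HasValue x v) :
    ∃ Q B : Polynomial ℤ, Q ≠ 0 ∧ (Q : PowerSeries ℤ) * F = B := by
  have hcast : (algebraMap ℚ ℂ).comp (Int.castRingHom ℚ) = Int.castRingHom ℂ :=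
    RingHom.ext_int _ _
  obtain ⟨Q, C, hQ, hC, hb⟩ := exists_bounded_multiple_of_algebraic hF (by
    simpa only [← RingHom.comp_apply, ← PowerSeries.map_comp, hcast] using hconv)
  obtain ⟨c, hc, hcQ⟩ := IsLocalization.integerNormalization_spec (nonZeroDivisors ℤ) Q
  set Q' := IsLocalization.integerNormalization (nonZeroDivisors ℤ) Q with hQ'
  have hc0 : c ≠ 0 := nonZeroDivisors.ne_zero hc
  have hQ0 : Q' ≠ 0 := by
    intro h
    rw [h, Polynomial.map_zero] at hcQ
    have h2 : c • Q = 0 := hcQ.symm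
    exact (smul_ne_zero hc0 hQ) h2
  let b : ℕ → ℂ := fun n => PowerSeries.coeff n
    ((Q * F.map (Int.castRingHom ℚ) : PowerSeries ℚ).map (algebraMap ℚ ℂ))
  have hbes := sum_sq_norm_coeff_le_of_bounded (b := b) hC
    (fun x hx => (hb x hx).choose_spec.1.1)
    (fun x hx => by
      rw [(hb x hx).choose_spec.1.2.tsum_eq]
      exact (hb x hx).choose_spec.2)
  have hcb (n : ℕ) : ((PowerSeries.coeff n ((Q' : PowerSeries ℤ) * F) : ℤ) : ℂ) = c * b n := by
    have h1 : ((Q' : PowerSeries ℤ) * F).map (Int.castRingHom ℚ) =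
        c • (Q * F.map (Int.castRingHom ℚ) : PowerSeries ℚ) := by
      rw [map_mul, ← Polynomial.polynomial_map_coe]
      have h2 : Q'.map (Int.castRingHom ℚ) = c • Q := hcQ
      rw [h2, ← smul_mul_assoc]
      congr 1
    have h3 := congrArg (PowerSeries.coeff n) h1
    rw [PowerSeries.coeff_map, map_zsmul, zsmul_eq_mul, eq_intCast] at h3
    simp only [b]
    rw [PowerSeries.coeff_map, eq_ratCast]
    exact_mod_cast congrArg (Rat.cast : ℚ → ℂ) h3
  have hsum : Summable fun n => ‖b n‖ ^ 2 :=
    summable_of_sum_range_le (fun _ => by positivity) hbes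
  have hlim := (hsum.tendsto_atTop_zero.const_mul (|(c : ℝ)| ^ 2)).eventually_lt_const
    (u := 1) (by simp)
  obtain ⟨N, hN⟩ := Filter.eventually_atTop.1 hlim
  refine ⟨Q', PowerSeries.trunc N ((Q' : PowerSeries ℤ) * F), hQ0,
    PowerSeries.eq_coe_trunc_of_eventually_zero fun n hn => ?_⟩
  have h := hN n hn
  have h2 := congrArg norm (hcb n)
  rw [norm_mul, Complex.norm_intCast, Complex.norm_intCast] at h2
  rw [← mul_pow, ← h2] at h
  by_contra hne
  have : (1 : ℝ) ≤ |((PowerSeries.coeff n ((Q' : PowerSeries ℤ) * F) : ℤ) : ℝ)| := by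
    exact_mod_cast Int.one_le_abs hne
  nlinarith

/-- **Kronecker.** If an integer polynomial has constant term `±1` and no root in the open unit
disk, then all its complex roots are roots of unity. -/
theorem Polynomial.pow_eq_one_of_one_le_norm_roots {Q : Polynomial ℤ} (hQ : IsUnit (Q.coeff 0))
    (hroot : ∀ z : ℂ, Q.eval₂ (Int.castRingHom ℂ) z = 0 → 1 ≤ ‖z‖) {z : ℂ}
    (hz : Q.eval₂ (Int.castRingHom ℂ) z = 0) : ∃ n, 0 < n ∧ z ^ n = 1 := by
  have hne (w : ℂ) (hw : Q.eval₂ (Int.castRingHom ℂ) w = 0) : w ≠ 0 := by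
    rintro rfl
    simpa using (hroot 0 hw).trans_lt' one_pos
  have hR (w : ℂ) (hw : w ≠ 0) : Q.reverse.eval₂ (Int.castRingHom ℂ) w⁻¹ = 0 ↔
      Q.eval₂ (Int.castRingHom ℂ) w = 0 := by
    let : Invertible w := invertibleOfNonzero hw
    rw [← Polynomial.eval₂_reverse_eq_zero_iff (Int.castRingHom ℂ) w Q, invOf_eq_inv]
  have hlead : Q.reverse.leadingCoeff = Q.coeff 0 := by
    rw [Polynomial.reverse_leadingCoeff, Polynomial.trailingCoeff,
      Polynomial.natTrailingDegree_eq_zero.2 (.inr hQ.ne_zero)]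
  have hR0 : Q.reverse.map (Int.castRingHom ℂ) ≠ 0 := by
    rw [Polynomial.map_ne_zero_iff (Int.castRingHom ℂ).injective_int, Ne,
      ← Polynomial.leadingCoeff_eq_zero, hlead]
    exact hQ.ne_zero
  have hmahler : (Q.reverse.map (Int.castRingHom ℂ)).mahlerMeasure = 1 := by
    rw [Polynomial.mahlerMeasure_eq_leadingCoeff_mul_prod_roots,
      Polynomial.leadingCoeff_map_of_injective (Int.castRingHom ℂ).injective_int, hlead,
      Multiset.prod_eq_one, mul_one, eq_intCast, Complex.norm_intCast]
    · exact_mod_cast Int.isUnit_iff_abs_eq.1 hQ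
    · simp only [Multiset.mem_map, Polynomial.mem_roots hR0, Polynomial.IsRoot.def,
        Polynomial.eval_map]
      rintro _ ⟨w, hw, rfl⟩
      rcases eq_or_ne w 0 with rfl | hw0
      · simp
      refine max_eq_left ?_
      have := hroot w⁻¹ ((hR w⁻¹ (inv_ne_zero hw0)).1 (by rwa [inv_inv]))
      rw [norm_inv] at this
      exact (one_le_inv₀ (norm_pos_iff.2 hw0)).1 this
  obtain ⟨n, hn, h1⟩ := Polynomial.pow_eq_one_of_mahlerMeasure_eq_one hmahler
    (inv_ne_zero (hne z hz)) ((Polynomial.mem_aroots).2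
      ⟨fun h => hR0 (by rw [h, Polynomial.map_zero]), (hR z (hne z hz)).2 hz⟩)
  exact ⟨n, hn, by rwa [inv_pow, inv_eq_one] at h1⟩

/-- A nonzero polynomial over `ℚ` whose complex roots are roots of unity divides some
`(X ^ T - 1) ^ m`. -/
theorem Polynomial.dvd_X_pow_sub_one_pow {Q : Polynomial ℚ} (hQ : Q ≠ 0)
    (hroot : ∀ z : ℂ, Q.eval₂ (algebraMap ℚ ℂ) z = 0 → ∃ n, 0 < n ∧ z ^ n = 1) :
    ∃ T m : ℕ, 1 ≤ T ∧ Q ∣ (Polynomial.X ^ T - 1) ^ m := by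
  classical
  set R := Q.map (algebraMap ℚ ℂ) with hR
  have hR0 : R ≠ 0 := Polynomial.map_ne_zero hQ
  have hmem (z : ℂ) (hz : z ∈ R.roots) : ∃ n, 0 < n ∧ z ^ n = 1 :=
    hroot z (by
      rw [← Polynomial.eval_map]; exact (Polynomial.mem_roots hR0).1 hz)
  choose! e he0 he using hmem
  let T := ∏ z ∈ R.roots.toFinset, e z
  have hT : 1 ≤ T := Finset.prod_pos fun z hz => he0 z (Multiset.mem_toFinset.1 hz)
  refine ⟨T, R.natDegree, hT, (Polynomial.map_dvd_map' (algebraMap ℚ ℂ)).1 ?_⟩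
  have hne : (Polynomial.X ^ T - 1 : Polynomial ℂ) ≠ 0 :=
    Polynomial.X_pow_sub_C_ne_zero hT 1
  simp only [Polynomial.map_pow, Polynomial.map_sub, Polynomial.map_X, Polynomial.map_one]
  refine (IsAlgClosed.splits R).dvd_of_roots_le_roots hR0 (Multiset.le_iff_count.2 fun z => ?_)
  by_cases hz : z ∈ R.roots
  · rw [Polynomial.roots_pow, Multiset.count_nsmul]
    have h1 : z ∈ (Polynomial.X ^ T - 1 : Polynomial ℂ).roots := by
      rw [Polynomial.mem_roots hne]
      obtain ⟨c, hc⟩ : e z ∣ T := Finset.dvd_prod_of_mem e (Multiset.mem_toFinset.2 hz)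
      simp [hc, pow_mul, he z hz]
    exact (Multiset.count_le_card _ _).trans ((Polynomial.card_roots' R).trans
      (Nat.le_mul_of_pos_right _ (Multiset.count_pos.2 h1)))
  · rw [Multiset.count_eq_zero_of_notMem hz]
    exact Nat.zero_le _

/-- **Gauss.** A primitive integer polynomial dividing a nonzero integer in `ℤ⟦X⟧` is a unit
in `ℤ⟦X⟧`. -/
theorem PowerSeries.isUnit_of_isPrimitive_of_mul_eq_natCast {Q : Polynomial ℤ}
    (hQ : Q.IsPrimitive) (n : ℕ) (hn : n ≠ 0) (H : PowerSeries ℤ)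
    (h : (Q : PowerSeries ℤ) * H = PowerSeries.C (n : ℤ)) : IsUnit (Q : PowerSeries ℤ) := by
  induction n using induction_on_primes generalizing H with
  | zero => exact absurd rfl hn
  | one => exact IsUnit.of_mul_eq_one H (by simpa using h)
  | prime_mul p a hp ih =>
    have : Fact p.Prime := ⟨hp⟩
    have hQp : ((Q.map (Int.castRingHom (ZMod p)) : Polynomial (ZMod p)) :
        PowerSeries (ZMod p)) ≠ 0 := by
      rw [Ne, Polynomial.coe_eq_zero_iff]
      intro h0
      have hdvd : Polynomial.C (p : ℤ) ∣ Q := by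
        rw [Polynomial.C_dvd_iff_dvd_coeff]
        intro i
        rw [← ZMod.intCast_zmod_eq_zero_iff_dvd]
        simpa using congrArg (fun q => Polynomial.coeff q i) h0
      exact (Nat.prime_iff_prime_int.1 hp).not_isUnit (hQ _ hdvd)
    have hHp : H.map (Int.castRingHom (ZMod p)) = 0 := by
      have h1 := congrArg (PowerSeries.map (Int.castRingHom (ZMod p))) h
      rw [map_mul, ← Polynomial.polynomial_map_coe, PowerSeries.map_C, Nat.cast_mul, map_mul,
        map_natCast, CharP.cast_eq_zero, zero_mul, map_zero] at h1
      exact (mul_eq_zero.1 h1).resolve_left hQp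
    have hdvd (i : ℕ) : (p : ℤ) ∣ PowerSeries.coeff i H := by
      rw [← ZMod.intCast_zmod_eq_zero_iff_dvd]
      simpa using congrArg (PowerSeries.coeff i) hHp
    choose c hc using hdvd
    have hH : H = PowerSeries.C (p : ℤ) * PowerSeries.mk c := by
      ext i
      rw [hc i, PowerSeries.coeff_C_mul, PowerSeries.coeff_mk]
    refine ih (right_ne_zero_of_mul hn) (PowerSeries.mk c) ?_
    have hp0 : PowerSeries.C (p : ℤ) ≠ 0 := by
      rw [Ne, map_eq_zero_iff _ PowerSeries.C_injective]
      exact_mod_cast hp.ne_zero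
    refine mul_left_cancel₀ hp0 ?_
    rw [hH, Nat.cast_mul, map_mul] at h
    linear_combination h

/-- A rational power series with integer coefficients has a primitive integral denominator of the
same degree as any given rational denominator. -/
theorem exists_isPrimitive_mul_eq {F : PowerSeries ℤ} {Q B : Polynomial ℚ} (hQ : Q ≠ 0)
    (h : (Q : PowerSeries ℚ) * F.map (Int.castRingHom ℚ) = B) :
    ∃ Q' B' : Polynomial ℤ, Q'.IsPrimitive ∧ Q'.natDegree = Q.natDegree ∧
      (Q' : PowerSeries ℤ) * F = B' := by
  obtain ⟨c, hc, hcQ⟩ := IsLocalization.integerNormalization_spec (nonZeroDivisors ℤ) Q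
  set Z := IsLocalization.integerNormalization (nonZeroDivisors ℤ) Q
  have hc0 : c ≠ 0 := nonZeroDivisors.ne_zero hc
  have hZ0 : Z ≠ 0 := by
    intro h0
    rw [h0, Polynomial.map_zero] at hcQ
    exact smul_ne_zero hc0 hQ hcQ.symm
  have hdeg : Z.natDegree = Q.natDegree := by
    rw [← Polynomial.natDegree_map_eq_of_injective (algebraMap ℤ ℚ).injective_int, hcQ,
      Polynomial.natDegree_smul_of_smul_regular _ (smul_right_injective _ hc0)]
  have hcont : Z.content ≠ 0 := Polynomial.content_eq_zero_iff.not.2 hZ0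
  have hev (n : ℕ) (hn : B.natDegree + 1 ≤ n) :
      PowerSeries.coeff n ((Z.primPart : PowerSeries ℤ) * F) = 0 := by
    have h1 : ((Z : PowerSeries ℤ) * F).map (Int.castRingHom ℚ) = c • (B : PowerSeries ℚ) := by
      have h2 : Z.map (Int.castRingHom ℚ) = c • Q := hcQ
      rw [map_mul, ← Polynomial.polynomial_map_coe, h2, ← h, ← smul_mul_assoc]
      congr 1
    have h2 : PowerSeries.coeff n ((Z : PowerSeries ℤ) * F) = 0 := by
      have h3 := congrArg (PowerSeries.coeff n) h1
      rw [PowerSeries.coeff_map, map_zsmul, Polynomial.coeff_coe,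
        Polynomial.coeff_eq_zero_of_natDegree_lt hn, smul_zero, eq_intCast] at h3
      exact_mod_cast h3
    have h3 : (Z : PowerSeries ℤ) * F =
        PowerSeries.C Z.content * ((Z.primPart : PowerSeries ℤ) * F) := by
      conv_lhs => rw [Z.eq_C_content_mul_primPart]
      rw [Polynomial.coe_mul, Polynomial.coe_C, mul_assoc]
    rw [h3, PowerSeries.coeff_C_mul] at h2
    exact (mul_eq_zero.1 h2).resolve_left hcont
  exact ⟨Z.primPart, _, Z.isPrimitive_primPart, by rw [Polynomial.natDegree_primPart, hdeg],
    PowerSeries.eq_coe_trunc_of_eventually_zero hev⟩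

/-- A rational power series with integer coefficients can be written in lowest terms with a
primitive denominator. -/
theorem exists_isPrimitive_isCoprime {F : PowerSeries ℤ} {Q B : Polynomial ℚ} (hQ : Q ≠ 0)
    (h : (Q : PowerSeries ℚ) * F.map (Int.castRingHom ℚ) = B) :
    ∃ Q' B' : Polynomial ℤ, Q'.IsPrimitive ∧ (Q' : PowerSeries ℤ) * F = B' ∧
      IsCoprime (Q'.map (Int.castRingHom ℚ)) (B'.map (Int.castRingHom ℚ)) := by
  classical
  have hex : ∃ d, ∃ Q' B' : Polynomial ℤ, Q'.IsPrimitive ∧ Q'.natDegree = d ∧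
      (Q' : PowerSeries ℤ) * F = B' := ⟨_, exists_isPrimitive_mul_eq hQ h⟩
  obtain ⟨Q₁, B₁, hprim, hdeg, hQB⟩ := Nat.find_spec hex
  have hQ₁ : Q₁.map (Int.castRingHom ℚ) ≠ 0 :=
    (Polynomial.map_ne_zero_iff (Int.castRingHom ℚ).injective_int).2 hprim.ne_zero
  refine ⟨Q₁, B₁, hprim, hQB, isCoprime_of_irreducible_dvd (fun h0 => hQ₁ h0.1) ?_⟩
  rintro D hD ⟨Q₂, hQ₂⟩ ⟨B₂, hB₂⟩
  have hQ₂0 : Q₂ ≠ 0 := by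
    rintro rfl
    exact hQ₁ (by rw [hQ₂, mul_zero])
  have h2 : (Q₂ : PowerSeries ℚ) * F.map (Int.castRingHom ℚ) = B₂ := by
    have h3 := congrArg (PowerSeries.map (Int.castRingHom ℚ)) hQB
    rw [map_mul, ← Polynomial.polynomial_map_coe, ← Polynomial.polynomial_map_coe, hQ₂, hB₂,
      Polynomial.coe_mul, Polynomial.coe_mul, mul_assoc] at h3
    exact mul_left_cancel₀ (Polynomial.coe_eq_zero_iff.not.2 hD.ne_zero) h3
  refine Nat.find_min hex ?_ (exists_isPrimitive_mul_eq hQ₂0 h2)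
  rw [← hdeg, ← Polynomial.natDegree_map_eq_of_injective (Int.castRingHom ℚ).injective_int Q₁,
    hQ₂, Polynomial.natDegree_mul hD.ne_zero hQ₂0]
  exact Nat.lt_add_of_pos_left hD.natDegree_pos

/-- **Fatou.** The denominator of a rational power series with integer coefficients in lowest
terms has constant term `±1`. -/
theorem isUnit_coeff_zero_of_isPrimitive_of_isCoprime {F : PowerSeries ℤ} {Q B : Polynomial ℤ}
    (hprim : Q.IsPrimitive) (h : (Q : PowerSeries ℤ) * F = B)
    (hco : IsCoprime (Q.map (Int.castRingHom ℚ)) (B.map (Int.castRingHom ℚ))) :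
    IsUnit (Q.coeff 0) := by
  obtain ⟨u, v, huv⟩ := hco
  obtain ⟨c, hc, hcu⟩ := IsLocalization.integerNormalization_spec (nonZeroDivisors ℤ) u
  obtain ⟨d, hd, hdv⟩ := IsLocalization.integerNormalization_spec (nonZeroDivisors ℤ) v
  set U := IsLocalization.integerNormalization (nonZeroDivisors ℤ) u
  set V := IsLocalization.integerNormalization (nonZeroDivisors ℤ) v
  have hcd : c * d ≠ 0 := mul_ne_zero (nonZeroDivisors.ne_zero hc) (nonZeroDivisors.ne_zero hd)
  have hid : Polynomial.C d * U * Q + Polynomial.C c * V * B = Polynomial.C (c * d) := by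
    apply Polynomial.map_injective (Int.castRingHom ℚ) (Int.castRingHom ℚ).injective_int
    have hcu' : U.map (Int.castRingHom ℚ) = Polynomial.C (Int.castRingHom ℚ c) * u := by
      rw [eq_intCast, ← Polynomial.smul_eq_C_mul, Int.cast_smul_eq_zsmul]; exact hcu
    have hdv' : V.map (Int.castRingHom ℚ) = Polynomial.C (Int.castRingHom ℚ d) * v := by
      rw [eq_intCast, ← Polynomial.smul_eq_C_mul, Int.cast_smul_eq_zsmul]; exact hdv
    simp only [Polynomial.map_add, Polynomial.map_mul, Polynomial.map_C, hcu', hdv', map_mul]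
    linear_combination
      Polynomial.C (Int.castRingHom ℚ c) * Polynomial.C (Int.castRingHom ℚ d) * huv
  have hid' := congrArg (fun p : Polynomial ℤ => (p : PowerSeries ℤ)) hid
  simp only [Polynomial.coe_add, Polynomial.coe_mul, ← h, Polynomial.coe_C] at hid'
  obtain ⟨n, hn⟩ := Int.eq_nat_or_neg (c * d)
  have hunit : IsUnit (Q : PowerSeries ℤ) := by
    have hn0 : n ≠ 0 := by
      rintro rfl
      exact hcd (by simpa using hn)
    rcases hn with hn | hn
    · refine PowerSeries.isUnit_of_isPrimitive_of_mul_eq_natCast hprim n hn0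
        (PowerSeries.C d * U + PowerSeries.C c * V * F) ?_
      rw [hn] at hid'
      linear_combination hid'
    · refine PowerSeries.isUnit_of_isPrimitive_of_mul_eq_natCast hprim n hn0
        (-(PowerSeries.C d * U +
          PowerSeries.C c * V * F)) ?_
      rw [hn, map_neg] at hid'
      linear_combination -hid'
  have := PowerSeries.isUnit_constantCoeff _ hunit
  rwa [← PowerSeries.coeff_zero_eq_constantCoeff_apply, Polynomial.coeff_coe] at this

/-- A rational power series with integer coefficients converging on the unit disk becomes a
polynomial after multiplication with some `(X ^ T - 1) ^ m`. -/
theorem exists_X_pow_sub_one_pow_mul_eq_of_rational {F : PowerSeries ℤ} {Q B : Polynomial ℤ}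
    (hQ : Q ≠ 0) (h : (Q : PowerSeries ℤ) * F = B)
    (hconv : ∀ x : ℂ, ‖x‖ < 1 → ∃ v, (F.map (Int.castRingHom ℂ)).HasValue x v) :
    ∃ (T m : ℕ) (R : Polynomial ℚ), 1 ≤ T ∧
      ((PowerSeries.X ^ T - 1) ^ m * F.map (Int.castRingHom ℚ) : PowerSeries ℚ) = R := by
  have hQB (Q B : Polynomial ℤ) (h : (Q : PowerSeries ℤ) * F = B) {S : Type} [CommRing S] :
      ((Q.map (Int.castRingHom S) : Polynomial S) : PowerSeries S) *
        F.map (Int.castRingHom S) = (B.map (Int.castRingHom S) : Polynomial S) := by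
    rw [Polynomial.polynomial_map_coe, Polynomial.polynomial_map_coe, ← map_mul, h]
  obtain ⟨Q₁, B₁, hprim, h₁, hco⟩ := exists_isPrimitive_isCoprime
    ((Polynomial.map_ne_zero_iff (Int.castRingHom ℚ).injective_int).2 hQ) (hQB Q B h)
  have hroot (z : ℂ) (hz : Q₁.eval₂ (Int.castRingHom ℂ) z = 0) : 1 ≤ ‖z‖ := by
    by_contra! hlt
    obtain ⟨v, hv⟩ := hconv z hlt
    have hB := ((PowerSeries.HasValue.coe_polynomial _ z).mul hv).unique
      (hQB Q₁ B₁ h₁ (S := ℂ) ▸ PowerSeries.HasValue.coe_polynomial _ z)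
    rw [Polynomial.eval_map, hz, zero_mul, Polynomial.eval_map] at hB
    obtain ⟨u, w, huw⟩ := hco
    have h2 := congrArg (Polynomial.eval₂ (algebraMap ℚ ℂ) z) huw
    rw [Polynomial.eval₂_add, Polynomial.eval₂_mul, Polynomial.eval₂_mul, Polynomial.eval₂_map,
      Polynomial.eval₂_map, RingHom.ext_int ((algebraMap ℚ ℂ).comp _) (Int.castRingHom ℂ), hz,
      ← hB, Polynomial.eval₂_one] at h2
    simp at h2
  obtain ⟨T, m, hT, R, hR⟩ := Polynomial.dvd_X_pow_sub_one_pow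
    (Q := Q₁.map (Int.castRingHom ℚ))
    ((Polynomial.map_ne_zero_iff (Int.castRingHom ℚ).injective_int).2 hprim.ne_zero)
    fun z hz => Polynomial.pow_eq_one_of_one_le_norm_roots
      (isUnit_coeff_zero_of_isPrimitive_of_isCoprime hprim h₁ hco) hroot (by
        rwa [Polynomial.eval₂_map,
          RingHom.ext_int ((algebraMap ℚ ℂ).comp _) (Int.castRingHom ℂ)] at hz)
  refine ⟨T, m, R * B₁.map (Int.castRingHom ℚ), hT, ?_⟩
  have h3 := congrArg (fun p : Polynomial ℚ => (p : PowerSeries ℚ)) hR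
  simp only [Polynomial.coe_pow, Polynomial.coe_sub, Polynomial.coe_X, Polynomial.coe_one,
    Polynomial.coe_mul] at h3
  rw [h3, Polynomial.coe_mul, ← hQB Q₁ B₁ h₁]
  ring

theorem coeff_X_pow_sub_one_pow_mul (F : PowerSeries ℚ) (T m n : ℕ) :
    PowerSeries.coeff (n + m * T) ((PowerSeries.X ^ T - 1) ^ m * F) =
      (-1) ^ m * (fwdDiff T)^[m] (fun k => PowerSeries.coeff k F) n := by
  induction m generalizing F n with
  | zero => simp
  | succ m ih =>
    rw [pow_succ, mul_assoc, Nat.succ_mul, ← add_assoc, add_right_comm, ih]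
    have : (fun k => PowerSeries.coeff k ((PowerSeries.X ^ T - 1) * F)) ∘ (· + T) =
        -fwdDiff T (fun k => PowerSeries.coeff k F) := by
      ext k
      simp [fwdDiff, sub_mul]
    have h2 : (fwdDiff T)^[m] (fun k => PowerSeries.coeff k ((PowerSeries.X ^ T - 1) * F)) (n + T) =
        (fwdDiff T)^[m] (-fwdDiff T (fun k => PowerSeries.coeff k F)) n := by
      rw [← this, fwdDiff_iter_eq_sum_shift, fwdDiff_iter_eq_sum_shift]
      simp [add_right_comm]
    rw [h2, Function.iterate_succ_apply, pow_succ, mul_neg_one, neg_mul, ← mul_neg]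
    congr 1
    rw [fwdDiff_iter_eq_sum_shift, fwdDiff_iter_eq_sum_shift]
    simp

/-- A function annihilated by a power of a difference operator is eventually quasi-polynomial. -/
theorem quasiPolynomial_of_fwdDiff_iter_eq_zero {f : ℕ → ℚ} {T m n₀ : ℕ} (hT : 1 ≤ T)
    (h : ∀ n, n₀ ≤ n → (fwdDiff T)^[m] f n = 0) :
    ∃ P : ℕ → Polynomial ℚ, ∀ n, n₀ * T ≤ n → f n = (P (n % T)).eval (n : ℚ) := by
  have hzero (j n : ℕ) (hj : m ≤ j) (hn : n₀ ≤ n) : (fwdDiff T)^[j] f n = 0 := by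
    obtain ⟨i, rfl⟩ := Nat.exists_eq_add_of_le' hj
    rw [Function.iterate_add_apply, fwdDiff_iter_eq_sum_shift]
    exact Finset.sum_eq_zero fun k _ => by rw [h _ (by omega), smul_zero]
  refine ⟨fun r => ∑ j ∈ Finset.range m,
    Polynomial.C ((fwdDiff T)^[j] f (r + n₀ * T) / j.factorial) *
    (descPochhammer ℚ j).comp
      (Polynomial.C (1 / (T : ℚ)) * (Polynomial.X - Polynomial.C ((r + n₀ * T : ℕ) : ℚ))),
    fun n hn => ?_⟩
  have hT0 : (T : ℚ) ≠ 0 := by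
    norm_cast
    omega
  have hn0 : n₀ ≤ n / T := (Nat.le_div_iff_mul_le hT).2 hn
  set r := n % T with hr
  set k := n / T - n₀ with hk
  have hrk : n = r + n₀ * T + k * T := by
    have := Nat.mod_add_div n T
    rw [add_assoc, ← Nat.add_mul, hk, Nat.add_sub_of_le hn0, mul_comm]
    exact this.symm
  have harg : 1 / (T : ℚ) * ((n : ℚ) - ((r + n₀ * T : ℕ) : ℚ)) = k := by
    rw [hrk]
    push_cast
    field_simp
    ring
  have hbase : n₀ ≤ r + n₀ * T := by nlinarith
  conv_lhs => rw [hrk, ← smul_eq_mul (a := k), shift_eq_sum_fwdDiff_iter T f k]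
  rw [Polynomial.eval_finsetSum]
  have hterm (j : ℕ) : Polynomial.eval (n : ℚ)
      (Polynomial.C ((fwdDiff T)^[j] f (r + n₀ * T) / j.factorial) * (descPochhammer ℚ j).comp
      (Polynomial.C (1 / (T : ℚ)) * (Polynomial.X - Polynomial.C ((r + n₀ * T : ℕ) : ℚ)))) =
      k.choose j • (fwdDiff T)^[j] f (r + n₀ * T) := by
    simp only [Polynomial.eval_mul, Polynomial.eval_comp, Polynomial.eval_C, Polynomial.eval_sub,
      Polynomial.eval_X]
    rw [harg, descPochhammer_eval_eq_descFactorial, Nat.descFactorial_eq_factorial_mul_choose,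
      nsmul_eq_mul]
    have : (j.factorial : ℚ) ≠ 0 := by exact_mod_cast j.factorial_ne_zero
    push_cast
    field_simp
  simp only [hterm]
  have hl : ∑ j ∈ Finset.range (k + 1), k.choose j • (fwdDiff T)^[j] f (r + n₀ * T) =
      ∑ j ∈ Finset.range (k + 1 + m), k.choose j • (fwdDiff T)^[j] f (r + n₀ * T) := by
    refine Finset.sum_subset (Finset.range_mono (by omega)) fun j _ hj => ?_
    rw [Nat.choose_eq_zero_of_lt (by simpa using hj), zero_smul]
  rw [hl]
  symm
  refine Finset.sum_subset (Finset.range_mono (by omega)) fun j _ hj => ?_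
  rw [hzero j _ (by simpa using hj) hbase, smul_zero]

/-- A multiplicative function which is eventually polynomial on every residue class modulo `T`
is eventually zero or a monomial times a periodic multiplicative function. -/
theorem eventually_zero_or_monomial_of_quasiPolynomial {α : ℕ → ℕ}
    (hmul : ∀ m n : ℕ, 1 ≤ m → 1 ≤ n → Nat.Coprime m n → α (m * n) = α m * α n)
    {T n₀ : ℕ} (hT : 1 ≤ T) {P : ℕ → Polynomial ℚ}
    (hP : ∀ n, n₀ ≤ n → (α n : ℚ) = (P (n % T)).eval (n : ℚ)) :
    (∃ N : ℕ, ∀ n : ℕ, N ≤ n → α n = 0) ∨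
    (∃ (k : ℕ) (χ : ℕ → ℚ),
      (∀ m n : ℕ, 1 ≤ m → 1 ≤ n → Nat.Coprime m n → χ (m * n) = χ m * χ n) ∧
      (∃ T : ℕ, 1 ≤ T ∧ ∀ n : ℕ, 1 ≤ n → χ (n + T) = χ n) ∧
      ∀ n : ℕ, 1 ≤ n → (α n : ℚ) = (n : ℚ) ^ k * χ n) := by
  have key (a : ℕ) (ha : 1 ≤ a) :
      (P (a % T)).comp (Polynomial.C (a : ℚ) * Polynomial.X) =
        Polynomial.C (α a : ℚ) * P (1 % T) := by
    apply Polynomial.eq_of_infinite_eval_eq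
    apply (Set.infinite_range_of_injective (f := fun k : ℕ => ((1 + a * T * (k + n₀) : ℕ) : ℚ))
      ?_).mono
    · rintro _ ⟨k, rfl⟩
      set n := 1 + a * T * (k + n₀) with hn
      have hge : n₀ ≤ n := by
        have : 1 ≤ a * T := Nat.mul_pos ha hT
        nlinarith
      have hcop : Nat.Coprime a n := by
        rw [hn, mul_assoc, Nat.coprime_add_mul_left_right]
        exact Nat.coprime_one_right a
      have h1 : n % T = 1 % T := by
        rw [hn, mul_comm a T, mul_assoc, Nat.add_mul_mod_self_left]
      have h2 : (a * n) % T = a % T := by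
        rw [Nat.mul_mod, h1, ← Nat.mul_mod, mul_one]
      have h := hmul a n ha (by omega) hcop
      have h3 := hP (a * n) (hge.trans (Nat.le_mul_of_pos_left n ha))
      rw [h, h2] at h3
      have h4 := hP n hge
      rw [h1] at h4
      simp only [Set.mem_ofPred_eq, Polynomial.eval_comp, Polynomial.eval_mul, Polynomial.eval_C,
        Polynomial.eval_X]
      rw [← h4]
      push_cast at h3
      exact h3.symm
    · intro k l hkl
      have h : 1 + a * T * (k + n₀) = 1 + a * T * (l + n₀) := Nat.cast_injective (R := ℚ) hkl
      have : 0 < a * T := Nat.mul_pos ha hT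
      have := Nat.eq_of_mul_eq_mul_left this (Nat.add_left_cancel h)
      omega
  have coeff_key (a : ℕ) (ha : 1 ≤ a) (j : ℕ) :
      (P (a % T)).coeff j * (a : ℚ) ^ j = α a * (P (1 % T)).coeff j := by
    have := congrArg (fun q => Polynomial.coeff q j) (key a ha)
    simpa only [Polynomial.comp_C_mul_X_coeff, Polynomial.coeff_C_mul] using this
  by_cases h0 : P (1 % T) = 0
  · refine Or.inl ⟨n₀ + 1, fun n hn => ?_⟩
    have hn0 : (n : ℚ) ≠ 0 := by
      norm_cast
      omega
    have hz : P (n % T) = 0 := by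
      ext j
      have := coeff_key n (by omega) j
      rw [h0, Polynomial.coeff_zero, mul_zero] at this
      simpa [hn0] using this
    have := hP n (by omega)
    rw [hz, Polynomial.eval_zero] at this
    exact_mod_cast this
  · right
    obtain ⟨k, hk⟩ : ∃ k, (P (1 % T)).coeff k ≠ 0 := by
      by_contra! h
      exact h0 (Polynomial.ext (by simpa using h))
    refine ⟨k, fun n => (α n : ℚ) / (n : ℚ) ^ k, fun m n hm hn hmn => ?_,
      ⟨T, hT, fun n hn => ?_⟩, fun n hn => ?_⟩
    · simp only [hmul m n hm hn hmn, Nat.cast_mul, mul_pow]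
      rw [mul_div_mul_comm]
    · have h1 := coeff_key (n + T) (by omega) k
      have h2 := coeff_key n hn k
      rw [Nat.add_mod_right] at h1
      have hn0 : (n : ℚ) ^ k ≠ 0 := pow_ne_zero _ (by norm_cast; omega)
      have hn1 : ((n + T : ℕ) : ℚ) ^ k ≠ 0 := pow_ne_zero _ (by norm_cast; omega)
      simp only
      rw [div_eq_div_iff hn1 hn0]
      apply mul_right_cancel₀ hk
      linear_combination (-(n : ℚ) ^ k) * h1 + ((n + T : ℕ) : ℚ) ^ k * h2
    · have hn0 : (n : ℚ) ^ k ≠ 0 := pow_ne_zero _ (by norm_cast; omega)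
      field_simp

/-- **Bézivin.** Let `α : ℕ → ℕ` be a multiplicative function whose generating function
`a(t) = ∑_{n≥1} α(n) tⁿ` is algebraic over `ℚ(t)`. Then either `α(n) = 0` for all sufficiently
large `n`, or `α(n) = n^k · χ(n)` for some `k ∈ ℕ` and some multiplicative periodic function
`χ : ℕ → ℚ`. -/
theorem bezivin_multiplicative_algebraic (α : ℕ → ℕ)
    (hmul : ∀ m n : ℕ, 1 ≤ m → 1 ≤ n → Nat.Coprime m n → α (m * n) = α m * α n)
    (halg : PSAlgebraic (PowerSeries.mk fun n => if n = 0 then 0 else (α n : ℚ))) :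
    (∃ N : ℕ, ∀ n : ℕ, N ≤ n → α n = 0) ∨
    (∃ (k : ℕ) (χ : ℕ → ℚ),
      (∀ m n : ℕ, 1 ≤ m → 1 ≤ n → Nat.Coprime m n → χ (m * n) = χ m * χ n) ∧
      (∃ T : ℕ, 1 ≤ T ∧ ∀ n : ℕ, 1 ≤ n → χ (n + T) = χ n) ∧
      ∀ n : ℕ, 1 ≤ n → (α n : ℚ) = (n : ℚ) ^ k * χ n) := by
  set F : PowerSeries ℤ := PowerSeries.mk fun n => if n = 0 then 0 else (α n : ℤ) with hF
  have hFℚ : F.map (Int.castRingHom ℚ) =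
      PowerSeries.mk fun n => if n = 0 then 0 else (α n : ℚ) := by
    ext n
    rw [PowerSeries.coeff_map, PowerSeries.coeff_mk, PowerSeries.coeff_mk]
    split_ifs <;> simp
  have hcoeff (n : ℕ) (hn : 1 ≤ n) :
      PowerSeries.coeff n (F.map (Int.castRingHom ℚ)) = α n := by
    rw [hFℚ, PowerSeries.coeff_mk, if_neg (by omega)]
  rw [← hFℚ] at halg
  obtain ⟨D, s, N, hrec⟩ := exists_abs_coeff_le_of_algebraic halg
  have hrec' : ∀ m, N ≤ m → ∃ b, 1 ≤ b ∧ b ≤ D ∧ b ≤ m ∧ α m ≤ m ^ s * α (m - b) := by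
    intro m hm
    obtain ⟨b, hb1, hbD, hbm, h⟩ := hrec m hm
    rw [hcoeff m (by omega), hcoeff (m - b) (by omega), Nat.abs_cast, Nat.abs_cast] at h
    exact ⟨b, hb1, hbD, hbm.le, by exact_mod_cast h⟩
  have hconv (x : ℂ) (hx : ‖x‖ < 1) :
      ∃ v, (F.map (Int.castRingHom ℂ)).HasValue x v := by
    refine PowerSeries.HasValue.exists_of_subexponential (fun C hC => ?_) hx
    obtain ⟨A, hA⟩ := subexponential_of_recurrence hmul hrec' hC
    have hA0 : 0 ≤ A := by
      have := (Nat.cast_nonneg (α 1)).trans (hA 1 le_rfl)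
      rw [pow_one] at this
      exact nonneg_of_mul_nonneg_left this (by linarith)
    refine ⟨A, fun n => ?_⟩
    rw [PowerSeries.coeff_map, hF, PowerSeries.coeff_mk]
    split_ifs with hn
    · simpa using by positivity
    · simpa using hA n (by omega)
  obtain ⟨Q, B, hQ, hQB⟩ := rational_of_algebraic_of_convergent halg hconv
  obtain ⟨T, m, R, hT, hR⟩ := exists_X_pow_sub_one_pow_mul_eq_of_rational hQ hQB hconv
  obtain ⟨P, hP⟩ := quasiPolynomial_of_fwdDiff_iter_eq_zero
    (f := fun k => PowerSeries.coeff k (F.map (Int.castRingHom ℚ))) (m := m)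
    (n₀ := R.natDegree + 1) hT fun n hn => by
      have h := coeff_X_pow_sub_one_pow_mul (F.map (Int.castRingHom ℚ)) T m n
      rw [hR, Polynomial.coeff_coe, Polynomial.coeff_eq_zero_of_natDegree_lt (by omega)] at h
      exact (mul_eq_zero.1 h.symm).resolve_left (pow_ne_zero _ (by norm_num))
  refine eventually_zero_or_monomial_of_quasiPolynomial hmul hT (P := P)
    (n₀ := (R.natDegree + 1) * T) fun n hn => ?_
  rw [← hP n hn, hcoeff n (le_trans (Nat.mul_pos (Nat.succ_pos _) hT) hn)]
end

section
/- If α : ℕ → ℕ is a multiplicative function with nonnegative integer values (α(mn) = α(m)·α(n) for all coprime m, n ≥ 1), then its generating function a(t) = ∑_{n≥1} α(n)·t^n is either rational or transcendental over ℚ(t): if a(t) is algebraic over ℚ(t), then a(t) is rational. -/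
open scoped Polynomial PowerSeries

/-- If multiplication by `G` carries derivatives of elements of `B` into `B`, then it clears the
denominators arising from differentiation of quotients of elements of `B` by powers of `G`. -/
theorem Derivation.pow_add_two_mul_mem {k A : Type*} [CommRing k] [CommRing A] [Algebra k A]
    (D : Derivation k A A) (B : Subring A) {G : A} (hG : G ∈ B)
    (hD : ∀ b ∈ B, G * D b ∈ B) {m : ℕ} {h : A} (hh : G ^ m * h ∈ B) :
    G ^ (m + 2) * D h ∈ B := by
  have key : G ^ (m + 2) * D h
      = G * (G * D (G ^ m * h)) - (m : A) * ((G ^ m * h) * (G * D G)) := by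
    rw [D.leibniz, D.leibniz_pow]
    cases m with
    | zero => simp; ring
    | succ m => simp only [smul_eq_mul, nsmul_eq_mul, Nat.add_sub_cancel]; ring
  rw [key]
  exact B.sub_mem (B.mul_mem hG (hD _ hh))
    (B.mul_mem (natCast_mem B m) (B.mul_mem hh (hD _ hG)))

/-- The chain rule for polynomials in `f`, modulo the subalgebra generated by `f`. -/
theorem PowerSeries.derivative_aeval_sub_mem_adjoin (f : ℚ⟦X⟧) (Q : ℚ[X][X]) :
    d⁄dX ℚ (Polynomial.aeval f Q)
      - Polynomial.aeval f (Polynomial.derivative Q) * d⁄dX ℚ f ∈ Algebra.adjoin ℚ[X] {f} := by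
  induction Q using Polynomial.induction_on' with
  | add p q hp hq =>
    have := add_mem hp hq
    convert this using 1
    simp only [map_add]
    ring
  | monomial n c =>
    have hf : f ∈ Algebra.adjoin ℚ[X] {f} := Algebra.self_mem_adjoin_singleton _ _
    have hc := Subalgebra.algebraMap_mem (Algebra.adjoin ℚ[X] {f}) (Polynomial.derivative c)
    convert mul_mem hc (pow_mem hf n) using 1
    have h1 : d⁄dX ℚ (algebraMap ℚ[X] ℚ⟦X⟧ c)
        = algebraMap ℚ[X] ℚ⟦X⟧ (Polynomial.derivative c) := PowerSeries.derivative_coe c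
    rw [Polynomial.derivative_monomial, Polynomial.aeval_monomial, Polynomial.aeval_monomial,
      Derivation.leibniz, Derivation.leibniz_pow, h1]
    simp only [smul_eq_mul, nsmul_eq_mul, map_mul, map_natCast]
    ring

/-- An algebraic power series generates an algebra on which differentiation has a common
denominator. -/
theorem PowerSeries.exists_mul_derivative_mem_adjoin {f : ℚ⟦X⟧} (hf : IsAlgebraic ℚ[X] f) :
    ∃ g ∈ Algebra.adjoin ℚ[X] {f}, g ≠ 0 ∧
      ∀ b ∈ Algebra.adjoin ℚ[X] {f}, g * d⁄dX ℚ b ∈ Algebra.adjoin ℚ[X] {f} := by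
  classical
  have hex : ∃ n, ∃ P : ℚ[X][X], P ≠ 0 ∧ Polynomial.aeval f P = 0 ∧ P.natDegree = n := by
    obtain ⟨P, h0, h1⟩ := hf
    exact ⟨_, P, h0, h1, rfl⟩
  obtain ⟨P, hP0, hPf, hPdeg⟩ := Nat.find_spec hex
  have hmin : ∀ Q : ℚ[X][X], Q.natDegree < P.natDegree → Polynomial.aeval f Q = 0 → Q = 0 := by
    intro Q hQ hQf
    by_contra h
    rw [hPdeg] at hQ
    exact Nat.find_min hex hQ ⟨Q, h, hQf, rfl⟩
  have hpos : P.natDegree ≠ 0 := by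
    intro h
    rw [Polynomial.eq_C_of_natDegree_eq_zero h, Polynomial.aeval_C] at hPf
    have : P.coeff 0 = 0 := Polynomial.coe_injective ℚ (hPf.trans Polynomial.coe_zero.symm)
    exact hP0 (by rw [Polynomial.eq_C_of_natDegree_eq_zero h, this, map_zero])
  have hg : Polynomial.aeval f (Polynomial.derivative P) ≠ 0 := by
    intro h
    have := hmin _ (Polynomial.natDegree_derivative_lt hpos) h
    exact hpos (Polynomial.derivative_eq_zero.mp this)
  have hmem : Polynomial.aeval f (Polynomial.derivative P) ∈ Algebra.adjoin ℚ[X] {f} :=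
    Polynomial.aeval_mem_adjoin_singleton _ _
  refine ⟨_, hmem, hg, fun b hb ↦ ?_⟩
  induction hb using Algebra.adjoin_induction with
  | mem x hx =>
    rw [Set.mem_singleton_iff] at hx
    subst hx
    have := PowerSeries.derivative_aeval_sub_mem_adjoin x P
    rw [hPf] at this
    simpa using this
  | algebraMap r =>
    have h1 : d⁄dX ℚ (algebraMap ℚ[X] ℚ⟦X⟧ r)
        = algebraMap ℚ[X] ℚ⟦X⟧ (Polynomial.derivative r) := PowerSeries.derivative_coe r
    rw [h1]
    exact mul_mem hmem (Subalgebra.algebraMap_mem _ _)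
  | add x y _ _ hx hy => rw [map_add, mul_add]; exact add_mem hx hy
  | mul x y hx' hy' hx hy =>
    rw [Derivation.leibniz]
    convert add_mem (mul_mem hx' hy) (mul_mem hy' hx) using 1
    simp only [smul_eq_mul]
    ring

/-- An algebraic power series satisfies a linear differential equation with polynomial
coefficients. -/
theorem PowerSeries.exists_linear_differential_equation {f : ℚ⟦X⟧} (hf : IsAlgebraic ℚ[X] f) :
    ∃ (N : ℕ) (c : Fin N → ℚ[X]), c ≠ 0 ∧ ∑ i, (c i : ℚ⟦X⟧) * (d⁄dX ℚ)^[i] f = 0 := by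
  obtain ⟨y, hy, hint⟩ := hf.exists_integral_multiple
  set F := y • f with hF
  obtain ⟨g, hgB, hg0, hgD⟩ := PowerSeries.exists_mul_derivative_mem_adjoin hint.isAlgebraic
  set B := Algebra.adjoin ℚ[X] {F} with hB
  have hyf : algebraMap ℚ[X] ℚ⟦X⟧ y * f ∈ B := by
    rw [← Algebra.smul_def]; exact Algebra.self_mem_adjoin_singleton _ _
  set G := g * algebraMap ℚ[X] ℚ⟦X⟧ y with hGdef
  have hy' : algebraMap ℚ[X] ℚ⟦X⟧ y ≠ 0 := by
    intro h
    exact hy (Polynomial.coe_injective ℚ (h.trans Polynomial.coe_zero.symm))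
  have hG0 : G ≠ 0 := mul_ne_zero hg0 hy'
  have hGB : G ∈ B := mul_mem hgB (B.algebraMap_mem y)
  have hGD : ∀ b ∈ B, G * d⁄dX ℚ b ∈ B := by
    intro b hb
    convert mul_mem (B.algebraMap_mem y) (hgD b hb) using 1
    rw [hGdef]; ring
  have hiter : ∀ i : ℕ, G ^ (2 * i + 1) * (d⁄dX ℚ)^[i] f ∈ B := by
    intro i
    induction i with
    | zero =>
      convert mul_mem hgB hyf using 1
      simp [hGdef, mul_assoc]
    | succ i ih =>
      rw [Function.iterate_succ_apply']
      exact Derivation.pow_add_two_mul_mem (d⁄dX ℚ) B.toSubring hGB hGD ih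
  have hfin : Module.Finite ℚ[X] B := Module.Finite.iff_fg.mpr hint.fg_adjoin_singleton
  set N := Module.finrank ℚ[X] B + 1 with hN
  have hmem : ∀ i : Fin N, G ^ (2 * N + 1) * (d⁄dX ℚ)^[i] f ∈ B := by
    intro i
    have : 2 * N + 1 = 2 * (N - i) + (2 * i + 1) := by have := i.2; omega
    rw [this, pow_add, mul_assoc]
    exact mul_mem (pow_mem hGB _) (hiter i)
  let v : Fin N → B := fun i ↦ ⟨_, hmem i⟩
  have hdep : ¬ LinearIndependent ℚ[X] v := by
    intro h
    have := h.fintype_card_le_finrank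
    rw [Fintype.card_fin] at this
    omega
  obtain ⟨c, hc, i, hi⟩ := Fintype.not_linearIndependent_iff.mp hdep
  refine ⟨N, c, fun h ↦ hi (by simp [h]), ?_⟩
  have hc' := congrArg (Subtype.val) hc
  have : G ^ (2 * N + 1) * ∑ i, (c i : ℚ⟦X⟧) * (d⁄dX ℚ)^[i] f = 0 := by
    rw [Finset.mul_sum]
    simp only [AddSubmonoidClass.coe_finsetSum, v, ZeroMemClass.coe_zero,
      Algebra.smul_def] at hc'
    rw [← hc']
    refine Finset.sum_congr rfl fun i _ ↦ ?_
    change _ = (c i : ℚ⟦X⟧) * _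
    ring
  exact (mul_eq_zero.mp this).resolve_left (pow_ne_zero _ hG0)

/-- Falling factorials of distinct degrees are linearly independent. -/
theorem descPochhammer_linear_combination_eq_zero {N : ℕ} {e : Fin N → ℚ}
    (h : ∑ i : Fin N, Polynomial.C (e i) * descPochhammer ℚ i = 0) : e = 0 := by
  funext i
  obtain ⟨i, hi⟩ := i
  induction i using Nat.strong_induction_on with
  | _ i ih =>
    have h1 := congrArg (Polynomial.eval (i : ℚ)) h
    rw [Polynomial.eval_finsetSum, Finset.sum_eq_single ⟨i, hi⟩] at h1
    · rw [Polynomial.eval_mul, Polynomial.eval_C, descPochhammer_eval_eq_descFactorial,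
        Nat.descFactorial_self, Polynomial.eval_zero] at h1
      exact (mul_eq_zero.mp h1).resolve_right (by exact_mod_cast i.factorial_ne_zero)
    · rintro ⟨j, hj⟩ - hne
      rw [Polynomial.eval_mul, Polynomial.eval_C, descPochhammer_eval_eq_descFactorial]
      rcases lt_or_gt_of_ne (fun h : j = i ↦ hne (by simp [h])) with hlt | hgt
      · rw [ih j hlt hj]; simp
      · rw [Nat.descFactorial_of_lt hgt]; simp
    · simp

theorem PowerSeries.coeff_coe_mul_of_natDegree_le {q : ℚ[X]} {D : ℕ} (hq : q.natDegree ≤ D)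
    (h : ℚ⟦X⟧) (n : ℕ) :
    PowerSeries.coeff (n + D) ((q : ℚ⟦X⟧) * h)
      = ∑ u ∈ Finset.range (D + 1), q.coeff (D - u) * PowerSeries.coeff (n + u) h := by
  rw [PowerSeries.coeff_mul, Finset.Nat.sum_antidiagonal_eq_sum_range_succ_mk]
  rw [← Finset.sum_subset (Finset.range_mono (show D + 1 ≤ (n + D).succ by omega)),
    ← Finset.sum_range_reflect]
  · refine Finset.sum_congr rfl fun u hu ↦ ?_
    have hu' := Finset.mem_range.mp hu
    rw [Polynomial.coeff_coe]
    congr 3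
    omega
  · intro x _ hx
    rw [Finset.mem_range, not_lt] at hx
    rw [Polynomial.coeff_coe, Polynomial.coeff_eq_zero_of_natDegree_lt (by omega), zero_mul]

/-- The coefficients of an algebraic power series satisfy a linear recurrence with polynomial
coefficients. -/
theorem PowerSeries.exists_polynomial_recurrence {f : ℚ⟦X⟧} (hf : IsAlgebraic ℚ[X] f) :
    ∃ (S : ℕ) (p : ℕ → ℚ[X]), p S ≠ 0 ∧ ∀ n : ℕ,
      ∑ s ∈ Finset.range (S + 1), (p s).eval (n : ℚ) * PowerSeries.coeff (n + s) f = 0 := by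
  classical
  obtain ⟨N, c, hc, hsum⟩ := PowerSeries.exists_linear_differential_equation hf
  obtain ⟨D, hD⟩ : ∃ D, ∀ i, (c i).natDegree ≤ D :=
    ⟨Finset.univ.sup fun i ↦ (c i).natDegree, fun i ↦
      Finset.le_sup (f := fun i ↦ (c i).natDegree) (Finset.mem_univ i)⟩
  let e : ℕ → Fin N → ℚ := fun s i ↦
    ∑ u ∈ Finset.range (D + 1), if u + i = s then (c i).coeff (D - u) else 0
  let q : ℕ → ℚ[X] := fun s ↦
    (∑ i : Fin N, Polynomial.C (e s i) * descPochhammer ℚ i).comp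
      (Polynomial.X + Polynomial.C (s : ℚ))
  have hq_eval : ∀ s n : ℕ, (q s).eval (n : ℚ)
      = ∑ i : Fin N, e s i * ((n + s).descFactorial i : ℚ) := by
    intro s n
    simp only [q, Polynomial.eval_comp, Polynomial.eval_finsetSum, Polynomial.eval_mul,
      Polynomial.eval_C, Polynomial.eval_add, Polynomial.eval_X]
    refine Finset.sum_congr rfl fun i _ ↦ ?_
    rw [← Nat.cast_add, descPochhammer_eval_eq_descFactorial]
  have hrec : ∀ n : ℕ, ∑ s ∈ Finset.range (D + N + 1),
      (q s).eval (n : ℚ) * PowerSeries.coeff (n + s) f = 0 := by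
    intro n
    have h0 := congrArg (PowerSeries.coeff (n + D)) hsum
    rw [map_sum, map_zero] at h0
    rw [← h0]
    simp_rw [hq_eval, Finset.sum_mul]
    rw [Finset.sum_comm]
    refine Finset.sum_congr rfl fun i _ ↦ ?_
    rw [PowerSeries.coeff_coe_mul_of_natDegree_le (hD i)]
    simp only [e, Finset.sum_mul]
    rw [Finset.sum_comm]
    refine Finset.sum_congr rfl fun u hu ↦ ?_
    have hu' := Finset.mem_range.mp hu
    rw [Finset.sum_eq_single (u + i)]
    · rw [if_pos rfl, PowerSeries.coeff_iterate_derivative, ← add_assoc,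
        Nat.add_descFactorial_eq_ascFactorial, mul_assoc]
    · intro s _ hs
      rw [if_neg hs.symm, zero_mul, zero_mul]
    · intro h
      exact absurd (Finset.mem_range.mpr (by have := i.2; omega)) h
  have hne : ∃ s ≤ D + N, q s ≠ 0 := by
    obtain ⟨i, hi⟩ := Function.ne_iff.mp hc
    obtain ⟨j, hj⟩ : ∃ j, (c i).coeff j ≠ 0 := by
      by_contra! h
      exact hi (Polynomial.ext h)
    have hjD : j ≤ D := (Polynomial.le_natDegree_of_ne_zero hj).trans (hD i)
    refine ⟨D - j + i, by have := i.2; omega, fun hq ↦ hj ?_⟩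
    have hz : ∑ k : Fin N, Polynomial.C (e (D - j + i) k) * descPochhammer ℚ k = 0 :=
      Polynomial.comp_X_add_C_eq_zero_iff.mp hq
    have := congrFun (descPochhammer_linear_combination_eq_zero hz) i
    simp only [e, Pi.zero_apply] at this
    rw [Finset.sum_eq_single (D - j), if_pos rfl, Nat.sub_sub_self hjD] at this
    · exact this
    · intro u _ hu
      exact if_neg (by omega)
    · intro h
      exact absurd (Finset.mem_range.mpr (by omega)) h
  obtain ⟨s, hs, hqs⟩ := hne
  refine ⟨Nat.findGreatest (fun s ↦ q s ≠ 0) (D + N), q,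
    Nat.findGreatest_spec (P := fun s ↦ q s ≠ 0) hs hqs, fun n ↦ ?_⟩
  rw [← hrec n]
  have hle := Nat.findGreatest_le (P := fun s ↦ q s ≠ 0) (D + N)
  refine Finset.sum_subset (Finset.range_mono (by omega)) fun t ht ht' ↦ ?_
  rw [Finset.mem_range] at ht ht'
  have : q t = 0 := not_not.mp
    (Nat.findGreatest_is_greatest (P := fun s ↦ q s ≠ 0) (by omega) (by omega : t ≤ D + N))
  simp [this]

/-- A linear recurrence with polynomial coefficients bounds each term by polynomially many times
the preceding ones. -/
theorem exists_le_mul_sum_of_polynomial_recurrence {a : ℕ → ℝ} {S : ℕ} {p : ℕ → ℝ[X]}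
    (hp : p S ≠ 0)
    (hrec : ∀ n : ℕ, ∑ s ∈ Finset.range (S + 1), (p s).eval (n : ℝ) * a (n + s) = 0) :
    ∃ (K : ℝ) (c n₀ : ℕ), 0 ≤ K ∧ ∀ n ≥ n₀,
      |a (n + S)| ≤ K * (n : ℝ) ^ c * ∑ s ∈ Finset.range S, |a (n + s)| := by
  set c := (Finset.range S).sup fun s ↦ (p s).natDegree with hc
  have hO : ∀ s ∈ Finset.range S, ∃ k : ℝ, 0 ≤ k ∧ ∀ᶠ n : ℕ in Filter.atTop,
      |(p s).eval (n : ℝ)| ≤ k * ((n : ℝ) ^ c * |(p S).eval (n : ℝ)|) := by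
    intro s hs
    have hdeg : (p s).degree ≤ (Polynomial.X ^ c * p S).degree := by
      rw [Polynomial.degree_mul, Polynomial.degree_X_pow]
      calc (p s).degree ≤ (p s).natDegree := Polynomial.degree_le_natDegree
        _ ≤ (c : WithBot ℕ) := by
          exact_mod_cast Finset.le_sup (f := fun s ↦ (p s).natDegree) hs
        _ ≤ c + (p S).degree := le_add_of_nonneg_right (Polynomial.zero_le_degree_iff.mpr hp)
    obtain ⟨k, hk0, hk⟩ := (Polynomial.isBigO_atTop_of_degree_le _ _ hdeg).exists_nonneg
    refine ⟨k, hk0, ?_⟩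
    filter_upwards [tendsto_natCast_atTop_atTop.eventually hk.bound] with n hn
    simpa [abs_mul] using hn
  choose! k hk0 hk using hO
  have hall : ∀ᶠ n : ℕ in Filter.atTop, ∀ s ∈ Finset.range S,
      |(p s).eval (n : ℝ)| ≤ k s * ((n : ℝ) ^ c * |(p S).eval (n : ℝ)|) :=
    (Filter.eventually_all_finset _).mpr hk
  have hnz : ∀ᶠ n : ℕ in Filter.atTop, (p S).eval (n : ℝ) ≠ 0 :=
    tendsto_natCast_atTop_atTop.eventually (Polynomial.eventually_atTop_not_isRoot _ hp)
  obtain ⟨n₀, hn₀⟩ := Filter.eventually_atTop.mp (hall.and hnz)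
  refine ⟨∑ s ∈ Finset.range S, k s, c, n₀, Finset.sum_nonneg hk0, fun n hn ↦ ?_⟩
  obtain ⟨h1, h2⟩ := hn₀ n hn
  have h3 : 0 < |(p S).eval (n : ℝ)| := abs_pos.mpr h2
  have h4 := hrec n
  rw [Finset.sum_range_succ] at h4
  refine le_of_mul_le_mul_left ?_ h3
  calc |(p S).eval (n : ℝ)| * |a (n + S)|
      = |∑ s ∈ Finset.range S, (p s).eval (n : ℝ) * a (n + s)| := by
        rw [← abs_mul, eq_neg_of_add_eq_zero_right h4, abs_neg]
    _ ≤ ∑ s ∈ Finset.range S, |(p s).eval (n : ℝ) * a (n + s)| := Finset.abs_sum_le_sum_abs _ _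
    _ ≤ ∑ s ∈ Finset.range S, ((∑ s ∈ Finset.range S, k s) *
          ((n : ℝ) ^ c * |(p S).eval (n : ℝ)|)) * |a (n + s)| := by
        refine Finset.sum_le_sum fun s hs ↦ ?_
        rw [abs_mul]
        refine mul_le_mul_of_nonneg_right ((h1 s hs).trans ?_) (abs_nonneg _)
        exact mul_le_mul_of_nonneg_right (Finset.single_le_sum hk0 hs) (by positivity)
    _ = _ := by rw [← Finset.mul_sum]; ring

/-- Growth of a sequence after a window on which it is bounded, when each term is polynomially
bounded by the preceding ones. -/
theorem le_mul_pow_of_le_mul_sum {a : ℕ → ℝ} {S c n₀ : ℕ} {K : ℝ} (hK : 0 ≤ K)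
    (hstep : ∀ n ≥ n₀, a (n + S) ≤ K * (n : ℝ) ^ c * ∑ s ∈ Finset.range S, a (n + s))
    {w : ℕ} (hw : n₀ ≤ w) (hw1 : 1 ≤ w) {B : ℝ} (hB : 0 ≤ B) (hwin : ∀ i < S, a (w + i) ≤ B)
    (t : ℕ) : a (w + t) ≤ B * ((K * S + 1) * ((w + t : ℕ) : ℝ) ^ c) ^ t := by
  have hone : ∀ t : ℕ, 1 ≤ (K * S + 1) * ((w + t : ℕ) : ℝ) ^ c := by
    intro t
    have h1 : (1 : ℝ) ≤ ((w + t : ℕ) : ℝ) ^ c :=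
      one_le_pow₀ (by exact_mod_cast (by omega : 1 ≤ w + t))
    have h2 : (0 : ℝ) ≤ K * S := by positivity
    nlinarith
  induction t using Nat.strong_induction_on with
  | _ t ih =>
    rcases lt_or_ge t S with ht | ht
    · exact (hwin t ht).trans (le_mul_of_one_le_right hB (one_le_pow₀ (hone t)))
    · set X := (K * S + 1) * ((w + t : ℕ) : ℝ) ^ c with hX
      have hprev : ∀ s ∈ Finset.range S, a (w + (t - S) + s) ≤ B * X ^ (t - 1) := by
        intro s hs
        rw [Finset.mem_range] at hs
        rw [add_assoc]
        refine (ih (t - S + s) (by omega)).trans (mul_le_mul_of_nonneg_left ?_ hB)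
        calc _ ≤ X ^ (t - S + s) := by
              refine pow_le_pow_left₀ (zero_le_one.trans (hone _)) ?_ _
              rw [hX]
              gcongr
              omega
          _ ≤ X ^ (t - 1) := pow_le_pow_right₀ (hone t) (by omega)
      rcases Nat.eq_zero_or_pos S with hS | hS
      · subst hS
        have := hstep (w + t) (by omega)
        simp only [Finset.range_zero, Finset.sum_empty, mul_zero, add_zero] at this
        exact this.trans (mul_nonneg hB (pow_nonneg (zero_le_one.trans (hone t)) _))
      have h1 := hstep (w + (t - S)) (by omega)
      rw [show w + (t - S) + S = w + t by omega] at h1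
      calc a (w + t) ≤ _ := h1
        _ ≤ K * ((w + (t - S) : ℕ) : ℝ) ^ c * ∑ s ∈ Finset.range S, B * X ^ (t - 1) := by
          gcongr with s hs
          exact hprev s hs
        _ = (K * S * ((w + (t - S) : ℕ) : ℝ) ^ c) * (B * X ^ (t - 1)) := by
          rw [Finset.sum_const, Finset.card_range, nsmul_eq_mul]; ring
        _ ≤ X * (B * X ^ (t - 1)) := by
          have : 0 ≤ X := zero_le_one.trans (hone t)
          refine mul_le_mul_of_nonneg_right ?_ (by positivity)
          rw [hX]
          gcongr
          · exact le_add_of_nonneg_right zero_le_one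
          · omega
        _ = B * X ^ t := by
          obtain ⟨m, rfl⟩ : ∃ m, t = m + 1 := ⟨t - 1, by omega⟩
          rw [Nat.add_sub_cancel, pow_succ]; ring

/-- Within bounded distance of every integer there is a window of prescribed length, each of whose
members is exactly divisible by a prime from a fixed list. -/
theorem exists_window_exactly_divisible (S : ℕ) :
    ∃ M : ℕ, ∀ n : ℕ, ∃ w, n ≤ w ∧ w ≤ n + M ∧ ∀ i < S, ∃ k, 1 ≤ k ∧
      w + i = Nat.nth Nat.Prime i * k ∧ Nat.Coprime (Nat.nth Nat.Prime i) k := by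
  set p : ℕ → ℕ := Nat.nth Nat.Prime with hp
  have hprime : ∀ i, (p i).Prime := Nat.prime_nth_prime
  have hinj : Function.Injective p := Nat.nth_injective Nat.infinite_setOfPred_prime
  have hcop : Set.Pairwise (Finset.range S : Set ℕ) (Function.onFun Nat.Coprime fun i ↦ p i ^ 2) := by
    intro i _ j _ hij
    exact Nat.Coprime.pow 2 2 ((Nat.coprime_primes (hprime i) (hprime j)).mpr (hinj.ne hij))
  obtain ⟨w₀, hw₀⟩ := Nat.chineseRemainderOfFinset (fun i ↦ p i + i * (p i ^ 2 - 1))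
    (fun i ↦ p i ^ 2) (Finset.range S) (fun i _ ↦ pow_ne_zero 2 (hprime i).ne_zero) hcop
  set M := ∏ i ∈ Finset.range S, p i ^ 2 with hM
  have hMpos : 0 < M := Finset.prod_pos fun i _ ↦ pow_pos (hprime i).pos 2
  refine ⟨2 * M, fun n ↦ ⟨w₀ % M + M * (n / M + 1), ?_, ?_, fun i hi ↦ ?_⟩⟩
  · have := Nat.div_add_mod n M
    have := Nat.mod_lt n hMpos
    rw [mul_add]; omega
  · have := Nat.div_add_mod n M
    have := Nat.mod_lt w₀ hMpos
    rw [mul_add]; omega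
  · set w := w₀ % M + M * (n / M + 1) with hw
    have hdvd : p i ^ 2 ∣ M := Finset.dvd_prod_of_mem (fun i ↦ p i ^ 2) (Finset.mem_range.mpr hi)
    have h1 : w ≡ w₀ [MOD p i ^ 2] := by
      refine Nat.ModEq.of_dvd hdvd ?_
      simp [hw, Nat.ModEq]
    have h2 : w + i ≡ p i [MOD p i ^ 2] := by
      refine ((h1.trans (hw₀ i (Finset.mem_range.mpr hi))).add_right i).trans ?_
      have hpos : 1 ≤ p i ^ 2 := pow_pos (hprime i).pos 2
      have : p i + i * (p i ^ 2 - 1) + i = p i + p i ^ 2 * i := by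
        obtain ⟨m, hm⟩ : ∃ m, p i ^ 2 = m + 1 := ⟨p i ^ 2 - 1, by omega⟩
        rw [hm, Nat.add_sub_cancel]; ring
      rw [this]
      simp [Nat.ModEq]
    have h3 : p i ∣ w + i := (h2.dvd_iff (dvd_pow_self _ two_ne_zero)).mpr dvd_rfl
    obtain ⟨k, hk⟩ := h3
    have h4 : k ≡ 1 [MOD p i] := by
      rw [hk, pow_two] at h2
      exact Nat.ModEq.mul_left_cancel' (hprime i).ne_zero (by simpa using h2)
    have h5 : Nat.Coprime (p i) k := by
      rw [Nat.coprime_comm, Nat.Coprime, h4.gcd_eq, Nat.gcd_one_left]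
    refine ⟨k, Nat.pos_of_ne_zero fun hk0 ↦ ?_, hk, h5⟩
    rw [hk0, Nat.coprime_zero_right] at h5
    exact (hprime i).one_lt.ne' h5

/-- A nonnegative multiplicative sequence satisfying a linear recurrence with polynomial
coefficients grows subexponentially. -/
theorem exists_le_mul_pow_of_multiplicative_of_recurrence {a : ℕ → ℝ} (ha : ∀ n, 0 ≤ a n)
    (hmul : ∀ m n : ℕ, 1 ≤ m → 1 ≤ n → Nat.Coprime m n → a (m * n) = a m * a n)
    {S : ℕ} {p : ℕ → ℝ[X]} (hp : p S ≠ 0)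
    (hrec : ∀ n : ℕ, ∑ s ∈ Finset.range (S + 1), (p s).eval (n : ℝ) * a (n + s) = 0)
    {ρ : ℝ} (hρ : 1 < ρ) : ∃ C : ℝ, ∀ n, a n ≤ C * (ρ ^ 2) ^ n := by
  obtain ⟨K, c, n₀, hK, hstep⟩ := exists_le_mul_sum_of_polynomial_recurrence hp hrec
  simp only [abs_of_nonneg (ha _)] at hstep
  obtain ⟨M, hM⟩ := exists_window_exactly_divisible S
  set P := ∑ i ∈ Finset.range S, a (Nat.nth Nat.Prime i) with hPdef
  have hP : 0 ≤ P := Finset.sum_nonneg fun i _ ↦ ha _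
  set L := K * S + 1 with hLdef
  have hL : 1 ≤ L := le_add_of_nonneg_left (by positivity)
  have hev : ∀ᶠ n : ℕ in Filter.atTop, P * ρ ^ S * L ^ M * (n : ℝ) ^ (c * M) ≤ ρ ^ n := by
    have h := (isLittleO_pow_const_const_pow_of_one_lt (R := ℝ) (c * M) hρ).const_mul_left
      (P * ρ ^ S * L ^ M)
    filter_upwards [h.bound one_pos] with n hn
    have hρn : 0 ≤ ρ ^ n := by positivity
    rw [one_mul, Real.norm_of_nonneg hρn] at hn
    exact (le_abs_self _).trans hn
  obtain ⟨n₁, hn₁⟩ := Filter.eventually_atTop.mp hev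
  set T := n₁ + n₀ + M + S + 1 with hT
  set C := ∑ n ∈ Finset.range T, a n with hCdef
  have hC : 0 ≤ C := Finset.sum_nonneg fun i _ ↦ ha _
  have hρ2 : 1 ≤ ρ ^ 2 := one_le_pow₀ hρ.le
  refine ⟨C, fun n ↦ ?_⟩
  induction n using Nat.strong_induction_on with
  | _ n ih =>
    rcases lt_or_ge n T with hn | hn
    · exact (Finset.single_le_sum (fun i _ ↦ ha i) (Finset.mem_range.mpr hn)).trans
        (le_mul_of_one_le_right hC (one_le_pow₀ hρ2))
    obtain ⟨w, hw1, hw2, hwin⟩ := hM (n - M)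
    have hbound : ∀ i < S, a (w + i) ≤ P * (C * ρ ^ (n + S)) := by
      intro i hi
      obtain ⟨k, hk1, hk, hcop⟩ := hwin i hi
      have hpr : (Nat.nth Nat.Prime i).Prime := Nat.prime_nth_prime i
      have h2k : 2 * k ≤ w + i := by
        rw [hk]; exact Nat.mul_le_mul_right k hpr.two_le
      rw [hk, hmul _ _ hpr.one_lt.le hk1 hcop]
      refine mul_le_mul (Finset.single_le_sum (f := fun i ↦ a (Nat.nth Nat.Prime i))
        (fun i _ ↦ ha _) (Finset.mem_range.mpr hi)) ?_ (ha _) hP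
      refine (ih k (by omega)).trans (mul_le_mul_of_nonneg_left ?_ hC)
      rw [← pow_mul]
      exact pow_le_pow_right₀ hρ.le (by omega)
    have hfin := le_mul_pow_of_le_mul_sum hK hstep (w := w) (by omega) (by omega)
      (by positivity) hbound (n - w)
    rw [show w + (n - w) = n by omega] at hfin
    have hn1 : (1 : ℝ) ≤ (n : ℝ) ^ c := one_le_pow₀ (by exact_mod_cast (by omega : 1 ≤ n))
    calc a n ≤ _ := hfin
      _ ≤ P * (C * ρ ^ (n + S)) * (L * (n : ℝ) ^ c) ^ M := by
        refine mul_le_mul_of_nonneg_left ?_ (by positivity)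
        exact pow_le_pow_right₀ (one_le_mul_of_one_le_of_one_le hL hn1) (by omega)
      _ = C * ρ ^ n * (P * ρ ^ S * L ^ M * (n : ℝ) ^ (c * M)) := by
        rw [mul_pow, ← pow_mul, pow_add]; ring
      _ ≤ C * ρ ^ n * ρ ^ n := by
        refine mul_le_mul_of_nonneg_left (hn₁ n (by omega)) (by positivity)
      _ = C * (ρ ^ 2) ^ n := by rw [← pow_mul, two_mul, pow_add]; ring

/-- The power series with rational coefficients that converge absolutely at `z`. -/
def PowerSeries.absConvergentSubring (z : ℂ) : Subring ℚ⟦X⟧ where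
  carrier := {f | Summable fun n ↦ ‖((PowerSeries.coeff n f : ℚ) : ℂ) * z ^ n‖}
  zero_mem' := by simp
  one_mem' := by
    refine summable_of_ne_finset_zero (s := {0}) fun n hn ↦ ?_
    rw [Finset.mem_singleton] at hn
    simp [PowerSeries.coeff_one, hn]
  add_mem' {f g} hf hg := by
    refine Summable.of_nonneg_of_le (fun _ ↦ norm_nonneg _) (fun n ↦ ?_) (Summable.add hf hg)
    rw [map_add, Rat.cast_add, add_mul]
    exact norm_add_le _ _
  neg_mem' {f} hf := by simpa using hf
  mul_mem' {f g} hf hg := by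
    refine (summable_norm_sum_mul_antidiagonal_of_summable_norm hf hg).congr fun n ↦ ?_
    rw [PowerSeries.coeff_mul, Rat.cast_sum, Finset.sum_mul]
    congr 1
    refine Finset.sum_congr rfl fun kl hkl ↦ ?_
    rw [← Finset.HasAntidiagonal.mem_antidiagonal.mp hkl, Rat.cast_mul, pow_add]
    ring

/-- Evaluation at `z` of power series converging absolutely at `z`. -/
noncomputable def PowerSeries.absConvergentEval (z : ℂ) :
    PowerSeries.absConvergentSubring z →+* ℂ where
  toFun f := ∑' n, ((PowerSeries.coeff n f.1 : ℚ) : ℂ) * z ^ n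
  map_zero' := by simp
  map_one' := by
    rw [tsum_eq_single 0]
    · simp
    · intro n hn
      simp [PowerSeries.coeff_one, hn]
  map_add' f g := by
    rw [← Summable.tsum_add (Summable.of_norm f.2) (Summable.of_norm g.2)]
    simp [add_mul]
  map_mul' f g := by
    rw [tsum_mul_tsum_eq_tsum_sum_antidiagonal_of_summable_norm f.2 g.2]
    refine tsum_congr fun n ↦ ?_
    rw [Subring.coe_mul, PowerSeries.coeff_mul, Rat.cast_sum, Finset.sum_mul]
    refine Finset.sum_congr rfl fun kl hkl ↦ ?_
    rw [← Finset.HasAntidiagonal.mem_antidiagonal.mp hkl, Rat.cast_mul, pow_add]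
    ring

theorem PowerSeries.absConvergentEval_apply (z : ℂ) (f : PowerSeries.absConvergentSubring z) :
    PowerSeries.absConvergentEval z f = ∑' n, ((PowerSeries.coeff n f.1 : ℚ) : ℂ) * z ^ n := rfl

theorem Polynomial.coe_mem_absConvergentSubring (q : ℚ[X]) (z : ℂ) :
    (q : ℚ⟦X⟧) ∈ PowerSeries.absConvergentSubring z := by
  refine summable_of_ne_finset_zero (s := q.support) fun n hn ↦ ?_
  rw [Polynomial.coeff_coe, Polynomial.notMem_support_iff.mp hn]
  simp

theorem PowerSeries.norm_absConvergentEval_coe_le (q : ℚ[X]) {z : ℂ} (hz : ‖z‖ ≤ 1) :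
    ‖PowerSeries.absConvergentEval z ⟨q, q.coe_mem_absConvergentSubring z⟩‖
      ≤ ∑ n ∈ q.support, ‖((q.coeff n : ℚ) : ℂ)‖ := by
  rw [PowerSeries.absConvergentEval_apply, tsum_eq_sum (s := q.support)]
  · refine norm_sum_le_of_le _ fun n _ ↦ ?_
    rw [Polynomial.coeff_coe, norm_mul, norm_pow]
    exact mul_le_of_le_one_right (norm_nonneg _) (pow_le_one₀ (norm_nonneg _) hz)
  · intro n hn
    rw [Polynomial.coeff_coe, Polynomial.notMem_support_iff.mp hn]
    simp

/-- A root of a monic polynomial is bounded in terms of the coefficients. -/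
theorem norm_le_of_pow_add_sum_eq_zero {d : ℕ} {c : ℕ → ℂ} {w : ℂ} {M : ℝ}
    (h : w ^ d + ∑ i ∈ Finset.range d, c i * w ^ i = 0)
    (hM : ∑ i ∈ Finset.range d, ‖c i‖ ≤ M) : ‖w‖ ≤ 1 + M := by
  have hM0 : 0 ≤ M := (Finset.sum_nonneg fun i _ ↦ norm_nonneg _).trans hM
  rcases le_or_gt ‖w‖ 1 with hw | hw
  · linarith
  rcases Nat.eq_zero_or_pos d with rfl | hd
  · simp at h
  obtain ⟨e, rfl⟩ : ∃ e, d = e + 1 := ⟨d - 1, by omega⟩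
  have h1 : ‖w‖ ^ (e + 1) ≤ M * ‖w‖ ^ e := by
    rw [← norm_pow, eq_neg_of_add_eq_zero_left h, norm_neg]
    calc _ ≤ ∑ i ∈ Finset.range (e + 1), ‖c i‖ * ‖w‖ ^ e := by
          refine norm_sum_le_of_le _ fun i hi ↦ ?_
          rw [norm_mul, norm_pow]
          have := Finset.mem_range.mp hi
          exact mul_le_mul_of_nonneg_left (pow_le_pow_right₀ hw.le (by omega)) (norm_nonneg _)
      _ ≤ M * ‖w‖ ^ e := by
          rw [← Finset.sum_mul]
          exact mul_le_mul_of_nonneg_right hM (by positivity)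
  have hpos : 0 < ‖w‖ ^ e := by positivity
  rw [pow_succ, mul_comm] at h1
  linarith [le_of_mul_le_mul_right h1 hpos]

/-- A power series integral over the polynomials is bounded on the unit disc, provided that it
converges there. -/
theorem PowerSeries.exists_norm_absConvergentEval_le {b : ℚ⟦X⟧} (hb : IsIntegral ℚ[X] b)
    (hconv : ∀ z : ℂ, ‖z‖ < 1 → b ∈ PowerSeries.absConvergentSubring z) :
    ∃ M : ℝ, ∀ (z : ℂ) (hz : ‖z‖ < 1),
      ‖PowerSeries.absConvergentEval z ⟨b, hconv z hz⟩‖ ≤ M := by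
  obtain ⟨Q, hQ, hQb⟩ := hb
  refine ⟨1 + ∑ i ∈ Finset.range Q.natDegree, ∑ n ∈ (Q.coeff i).support,
    ‖(((Q.coeff i).coeff n : ℚ) : ℂ)‖, fun z hz ↦ ?_⟩
  refine norm_le_of_pow_add_sum_eq_zero (d := Q.natDegree) (c := fun i ↦
    PowerSeries.absConvergentEval z ⟨Q.coeff i, (Q.coeff i).coe_mem_absConvergentSubring z⟩)
    ?_ (Finset.sum_le_sum fun i _ ↦ PowerSeries.norm_absConvergentEval_coe_le _ hz.le)
  rw [← map_pow]
  simp_rw [← map_pow, ← map_mul]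
  rw [← map_sum, ← map_add]
  convert map_zero (PowerSeries.absConvergentEval z)
  rw [Polynomial.eval₂_eq_sum_range, Finset.sum_range_succ, hQ.coeff_natDegree, map_one, one_mul,
    add_comm] at hQb
  apply Subtype.ext
  rw [← Subring.coe_zero] at hQb
  convert hQb using 1
  simp only [Subring.coe_add, Subring.coe_pow, AddSubmonoidClass.coe_finsetSum, Subring.coe_mul]
  rfl

/-- Parseval's inequality for a power series bounded on a circle. -/
theorem sum_sq_norm_mul_pow_le_of_norm_tsum_le {b : ℕ → ℂ} {r M : ℝ} (hr : 0 ≤ r)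
    (hsum : Summable fun n ↦ ‖b n‖ * r ^ n)
    (hM : ∀ z : ℂ, ‖z‖ = r → ‖∑' n, b n * z ^ n‖ ≤ M) (N : ℕ) :
    ∑ n ∈ Finset.range N, ‖b n‖ ^ 2 * r ^ (2 * n) ≤ M ^ 2 := by
  have htail := tendsto_sum_nat_add fun n ↦ ‖b n‖ * r ^ n
  have hlim : Filter.Tendsto (fun L ↦ (M + ∑' n, ‖b (n + L)‖ * r ^ (n + L)) ^ 2) Filter.atTop
      (nhds (M ^ 2)) := by
    simpa using (htail.const_add M).pow 2
  refine ge_of_tendsto hlim ?_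
  filter_upwards [Filter.eventually_ge_atTop N] with L hL
  set q : ℂ[X] := ∑ n ∈ Finset.range L, Polynomial.monomial n (b n * (r : ℂ) ^ n) with hq
  have hcoeff : ∀ n < L, q.coeff n = b n * (r : ℂ) ^ n := by
    intro n hn
    rw [hq, Polynomial.finsetSum_coeff, Finset.sum_eq_single n]
    · simp
    · intro m _ hm
      exact Polynomial.coeff_monomial_of_ne _ hm.symm
    · intro h
      exact absurd (Finset.mem_range.mpr hn) h
  have hcoeff' : ∀ n, L ≤ n → q.coeff n = 0 := by
    intro n hn
    rw [hq, Polynomial.finsetSum_coeff]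
    refine Finset.sum_eq_zero fun m hm ↦ Polynomial.coeff_monomial_of_ne _ ?_
    have := Finset.mem_range.mp hm
    omega
  have hsupp : ∑ n ∈ Finset.range L, ‖b n‖ ^ 2 * r ^ (2 * n)
      = ∑ n ∈ q.support, ‖q.coeff n‖ ^ 2 := by
    symm
    rw [Finset.sum_subset (s₂ := Finset.range L)]
    · refine Finset.sum_congr rfl fun n hn ↦ ?_
      rw [hcoeff n (Finset.mem_range.mp hn), norm_mul, norm_pow, Complex.norm_of_nonneg hr]
      ring
    · intro n hn
      by_contra h
      exact Polynomial.mem_support_iff.mp hn (hcoeff' n (by simpa using h))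
    · intro n _ hn
      rw [Polynomial.notMem_support_iff.mp hn]
      simp
  calc ∑ n ∈ Finset.range N, ‖b n‖ ^ 2 * r ^ (2 * n)
      ≤ ∑ n ∈ Finset.range L, ‖b n‖ ^ 2 * r ^ (2 * n) :=
        Finset.sum_le_sum_of_subset_of_nonneg (Finset.range_mono hL) fun n _ _ ↦ by positivity
    _ = Real.circleAverage (fun θ ↦ ‖Polynomial.eval θ q‖ ^ 2) 0 1 := by
        rw [hsupp, Polynomial.sum_sq_norm_coeff_eq_circleAverage]
    _ ≤ _ := by
        refine Real.circleAverage_mono_on_of_le_circle ?_ fun θ hθ ↦ ?_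
        · exact ContinuousOn.circleIntegrable' (by fun_prop)
        · have hθ1 : ‖θ‖ = 1 := by simpa using hθ
          have hz : ‖(r : ℂ) * θ‖ = r := by
            rw [norm_mul, hθ1, mul_one, Complex.norm_of_nonneg hr]
          have hs : Summable fun n ↦ ‖b n * ((r : ℂ) * θ) ^ n‖ := by
            simpa only [norm_mul (b _), norm_pow, hz] using hsum
          refine pow_le_pow_left₀ (norm_nonneg _) ?_ 2
          have heval : Polynomial.eval θ q = ∑' n, b n * ((r : ℂ) * θ) ^ n
              - ∑' n, b (n + L) * ((r : ℂ) * θ) ^ (n + L) := by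
            rw [← hs.of_norm.sum_add_tsum_nat_add L, add_sub_cancel_right, hq,
              Polynomial.eval_finsetSum]
            refine Finset.sum_congr rfl fun n _ ↦ ?_
            rw [Polynomial.eval_monomial]; ring
          rw [heval]
          refine (norm_sub_le _ _).trans (add_le_add (hM _ hz) ?_)
          have hs' := (summable_nat_add_iff L).mpr hs
          refine (norm_tsum_le_tsum_norm hs').trans_eq (tsum_congr fun n ↦ ?_)
          rw [norm_mul, norm_pow, hz]

/-- A power series bounded on the unit disc has square-summable coefficients. -/
theorem summable_sq_norm_of_norm_tsum_le {b : ℕ → ℂ} {M : ℝ}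
    (hsum : ∀ r : ℝ, 0 ≤ r → r < 1 → Summable fun n ↦ ‖b n‖ * r ^ n)
    (hM : ∀ z : ℂ, ‖z‖ < 1 → ‖∑' n, b n * z ^ n‖ ≤ M) : Summable fun n ↦ ‖b n‖ ^ 2 := by
  refine summable_of_sum_range_le (c := M ^ 2) (fun _ ↦ by positivity) fun N ↦ ?_
  have hlim : Filter.Tendsto (fun r : ℝ ↦ ∑ n ∈ Finset.range N, ‖b n‖ ^ 2 * r ^ (2 * n))
      (nhdsWithin 1 (Set.Iio 1)) (nhds (∑ n ∈ Finset.range N, ‖b n‖ ^ 2)) := by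
    have hcont : Continuous fun r : ℝ ↦ ∑ n ∈ Finset.range N, ‖b n‖ ^ 2 * r ^ (2 * n) := by
      fun_prop
    simpa using (hcont.tendsto 1).mono_left nhdsWithin_le_nhds
  refine le_of_tendsto hlim ?_
  filter_upwards [Ioo_mem_nhdsLT zero_lt_one] with r hr
  exact sum_sq_norm_mul_pow_le_of_norm_tsum_le hr.1.le (hsum r hr.1.le hr.2)
    (fun z hz ↦ hM z (hz ▸ hr.2)) N

/-- The coefficients of the product of a rational polynomial and a power series with integer
coefficients have a common denominator. -/
theorem Polynomial.exists_int_mul_coeff_coe_mul (y : ℚ[X]) {f : ℚ⟦X⟧}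
    (hint : ∀ n, ∃ m : ℤ, PowerSeries.coeff n f = m) :
    ∃ d : ℤ, d ≠ 0 ∧
      ∀ n, ∃ m : ℤ, (d : ℚ) * PowerSeries.coeff n ((y : ℚ⟦X⟧) * f) = m := by
  choose m hm using hint
  obtain ⟨d, hd, hdy⟩ := IsLocalization.integerNormalization_spec (nonZeroDivisors ℤ) y
  set Y := IsLocalization.integerNormalization (nonZeroDivisors ℤ) y
  refine ⟨d, nonZeroDivisors.ne_zero hd, fun n ↦
    ⟨∑ kl ∈ Finset.HasAntidiagonal.antidiagonal n, Y.coeff kl.1 * m kl.2, ?_⟩⟩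
  rw [PowerSeries.coeff_mul, Finset.mul_sum, Int.cast_sum]
  refine Finset.sum_congr rfl fun kl _ ↦ ?_
  have h := congrArg (Polynomial.coeff · kl.1) hdy
  rw [Polynomial.coeff_map, Polynomial.coeff_smul, zsmul_eq_mul, eq_intCast] at h
  rw [Polynomial.coeff_coe, hm, Int.cast_mul, h, mul_assoc]

/-- **Fatou's theorem**: an algebraic power series with integer coefficients of subexponential
growth is rational. -/
theorem PSRational.of_isAlgebraic_of_int_coeff {f : ℚ⟦X⟧} (hf : IsAlgebraic ℚ[X] f)
    (hint : ∀ n, ∃ m : ℤ, PowerSeries.coeff n f = m)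
    (hgrowth : ∀ R : ℝ, 1 < R → ∃ C : ℝ, ∀ n,
      |((PowerSeries.coeff n f : ℚ) : ℝ)| ≤ C * R ^ n) : PSRational f := by
  obtain ⟨y, hy, hyint⟩ := hf.exists_integral_multiple
  have hb : IsIntegral ℚ[X] ((y : ℚ⟦X⟧) * f) := by
    rw [Algebra.smul_def] at hyint
    exact hyint
  set b := (y : ℚ⟦X⟧) * f with hbdef
  have hfconv : ∀ z : ℂ, ‖z‖ < 1 → f ∈ PowerSeries.absConvergentSubring z := by
    intro z hz
    have hz0 := norm_nonneg z
    have hs0 : 0 < (1 + ‖z‖) / 2 := by linarith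
    obtain ⟨C, hC⟩ := hgrowth ((1 + ‖z‖) / 2)⁻¹ ((one_lt_inv₀ hs0).mpr (by linarith))
    have hlt : ((1 + ‖z‖) / 2)⁻¹ * ‖z‖ < 1 := by
      rw [inv_mul_lt_iff₀ hs0]; linarith
    refine Summable.of_nonneg_of_le (fun _ ↦ norm_nonneg _) (fun n ↦ ?_)
      ((summable_geometric_of_lt_one (by positivity) hlt).mul_left C)
    rw [norm_mul, norm_pow, mul_pow, ← mul_assoc]
    refine mul_le_mul_of_nonneg_right ((le_of_eq ?_).trans (hC n)) (by positivity)
    rw [← Complex.ofReal_ratCast, Complex.norm_real, Real.norm_eq_abs]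
  have hbconv : ∀ z : ℂ, ‖z‖ < 1 → b ∈ PowerSeries.absConvergentSubring z := fun z hz ↦
    mul_mem (y.coe_mem_absConvergentSubring z) (hfconv z hz)
  obtain ⟨M, hM⟩ := PowerSeries.exists_norm_absConvergentEval_le hb hbconv
  have hsq : Summable fun n ↦ ‖((PowerSeries.coeff n b : ℚ) : ℂ)‖ ^ 2 := by
    refine summable_sq_norm_of_norm_tsum_le (fun r hr0 hr1 ↦ ?_) hM
    have hr : ‖(r : ℂ)‖ = r := Complex.norm_of_nonneg hr0
    have h : Summable _ := hbconv r (hr.trans_lt hr1)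
    simpa only [norm_mul, norm_pow, hr] using h
  obtain ⟨d, hd, hdb⟩ := y.exists_int_mul_coeff_coe_mul hint
  have hdpos : (0 : ℝ) < 1 / (d : ℝ) ^ 2 := by positivity
  obtain ⟨T, hT⟩ := Filter.eventually_atTop.mp (hsq.tendsto_atTop_zero.eventually_lt_const hdpos)
  have hzero : ∀ n ≥ T, PowerSeries.coeff n b = 0 := by
    intro n hn
    obtain ⟨m, hm⟩ := hdb n
    have h1 := hT n hn
    rw [← Complex.ofReal_ratCast, Complex.norm_real, Real.norm_eq_abs, sq_abs,
      lt_div_iff₀ (by positivity), ← mul_pow, mul_comm] at h1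
    have h2 : ((d : ℝ) * ((PowerSeries.coeff n b : ℚ) : ℝ)) = (m : ℝ) := by exact_mod_cast hm
    rw [h2] at h1
    have h3 : m ^ 2 < 1 := by exact_mod_cast h1
    have h4 : m = 0 := pow_eq_zero_iff two_ne_zero |>.mp (by have := sq_nonneg m; omega)
    rw [h4, Int.cast_zero] at hm
    exact (mul_eq_zero.mp hm).resolve_left (by exact_mod_cast hd)
  refine ⟨PowerSeries.trunc T b, y, hy, ?_⟩
  ext n
  rw [Polynomial.coeff_coe, PowerSeries.coeff_trunc]
  split_ifs with h
  · rfl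
  · exact hzero n (not_lt.mp h)

/-- The generating function `a(t) = ∑_{n≥1} α(n) tⁿ` of a multiplicative function
`α : ℕ → ℕ` is either rational or transcendental over `ℚ(t)`: if it is algebraic, then it is
rational. -/
theorem multiplicative_generating_function_rational_or_transcendental (α : ℕ → ℕ)
    (hmul : ∀ m n : ℕ, 1 ≤ m → 1 ≤ n → Nat.Coprime m n → α (m * n) = α m * α n)
    (halg : PSAlgebraic (PowerSeries.mk fun n => if n = 0 then 0 else (α n : ℚ))) :
    PSRational (PowerSeries.mk fun n => if n = 0 then 0 else (α n : ℚ)) := by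
  set f : ℚ⟦X⟧ := PowerSeries.mk fun n => if n = 0 then 0 else (α n : ℚ) with hf
  have hcoeff : ∀ n, PowerSeries.coeff n f = ((if n = 0 then 0 else α n : ℕ) : ℚ) := by
    intro n
    rw [hf, PowerSeries.coeff_mk]
    split_ifs <;> simp
  have halg' : IsAlgebraic ℚ[X] f := halg
  refine PSRational.of_isAlgebraic_of_int_coeff halg' (fun n ↦ ⟨_, (hcoeff n).trans
    (Int.cast_natCast _).symm⟩) fun R hR ↦ ?_
  obtain ⟨S, p, hp, hrec⟩ := PowerSeries.exists_polynomial_recurrence halg'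
  obtain ⟨C, hC⟩ := exists_le_mul_pow_of_multiplicative_of_recurrence
    (a := fun n ↦ ((if n = 0 then 0 else α n : ℕ) : ℝ)) (S := S)
    (p := fun s ↦ (p s).map (algebraMap ℚ ℝ)) (ρ := √R) (fun n ↦ Nat.cast_nonneg _)
    (fun m n hm hn hmn ↦ by
      simp [hmul m n hm hn hmn, Nat.ne_of_gt hm, Nat.ne_of_gt hn])
    (by rwa [Ne, Polynomial.map_eq_zero])
    (fun n ↦ by
      have h := congrArg (algebraMap ℚ ℝ) (hrec n)
      rw [map_sum, map_zero] at h
      rw [← h]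
      refine Finset.sum_congr rfl fun s _ ↦ ?_
      rw [map_mul, hcoeff, Polynomial.eval_natCast_map, map_natCast])
    (Real.lt_sqrt_of_sq_lt (by simpa using hR))
  refine ⟨C, fun n ↦ ?_⟩
  have h := hC n
  rw [Real.sq_sqrt (zero_lt_one.trans hR).le] at h
  rw [hcoeff, Rat.cast_natCast, Nat.abs_cast]
  exact h
end
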